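/- Let H and F be generalised Hénon maps (each of degree at least 2), with non-escaping sets K_H⁺ = {z ∈ ℂ² : {H^n(z) : n ≥ 0} is bounded} and K_F⁺ = {z ∈ ℂ² : {F^n(z) : n ≥ 0} is bounded}, and suppose φ ∈ Aut(ℂ²) satisfies φ(K_F⁺) ⊆ K_H⁺. Then φ is a polynomial automorphism of ℂ², i.e., both coordinate functions of φ are polynomials in (x, y) (and likewise for φ⁻¹). -/

import Mathlib

noncomputable section

open Complex Filter Set Topology

/-- A simple Hénon factor `(x, y) ↦ (y, p(y) - a·x)`. -/
def henonStep (p : Polynomial ℂ) (a : ℂ) : ℂ × ℂ → ℂ × ℂ :=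
  fun z => (z.2, p.eval z.2 - a * z.1)

/-- The inverse of a simple Hénon factor. -/
def henonStepInv (p : Polynomial ℂ) (a : ℂ) : ℂ × ℂ → ℂ × ℂ :=
  fun w => ((p.eval w.1 - w.2) / a, w.1)

/-- The data of a generalised Hénon map `H = H_m ∘ ⋯ ∘ H_1`, where
`H_i(x,y) = (y, p_i(y) - a_i x)` with `deg p_i ≥ 2` and `a_i ≠ 0`. -/
structure GenHenon where
  m : ℕ
  hm : 0 < m
  p : Fin m → Polynomial ℂ
  a : Fin m → ℂ
  hdeg : ∀ i, 2 ≤ (p i).natDegree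
  ha : ∀ i, a i ≠ 0

namespace GenHenon

/-- The generalised Hénon map itself: apply `H_1` first, then `H_2`, ..., then `H_m`. -/
def toFun (H : GenHenon) : ℂ × ℂ → ℂ × ℂ :=
  fun z => (List.ofFn fun i => henonStep (H.p i) (H.a i)).foldl (fun w g => g w) z

/-- The inverse map `H⁻¹ = H_1⁻¹ ∘ ⋯ ∘ H_m⁻¹`: apply `H_m⁻¹` first. -/
def invFun (H : GenHenon) : ℂ × ℂ → ℂ × ℂ :=
  fun z => ((List.ofFn fun i => henonStepInv (H.p i) (H.a i)).reverse).foldl (fun w g => g w) z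

/-- The degree `d = d_1 ⋯ d_m`. -/
def deg (H : GenHenon) : ℕ := ∏ i, (H.p i).natDegree

/-- The codegree `d' = d_1 ⋯ d_{m-1}` (equal to `1` when `m = 1`). -/
def deg' (H : GenHenon) : ℕ :=
  ∏ i : Fin H.m, if (i : ℕ) + 1 < H.m then (H.p i).natDegree else 1

/-- The Jacobian determinant `a = a_1 ⋯ a_m`. -/
def jac (H : GenHenon) : ℂ := ∏ i, H.a i

/-- The iterate `H^s`, `s ∈ ℤ`: `s`-th iterate of `H` for `s ≥ 0`, `|s|`-th iterate of `H⁻¹`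
for `s < 0`. -/
def zIter (H : GenHenon) (s : ℤ) : ℂ × ℂ → ℂ × ℂ :=
  if 0 ≤ s then H.toFun^[s.toNat] else H.invFun^[(-s).toNat]

/-- The non-escaping set `K⁺`. -/
def Kplus (H : GenHenon) : Set (ℂ × ℂ) :=
  {z | Bornology.IsBounded (Set.range fun n : ℕ => H.toFun^[n] z)}

/-- The non-escaping set `K⁻` of the inverse. -/
def Kminus (H : GenHenon) : Set (ℂ × ℂ) :=
  {z | Bornology.IsBounded (Set.range fun n : ℕ => H.invFun^[n] z)}

/-- The escaping set `U⁺ = ℂ² ∖ K⁺`. -/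
def Uplus (H : GenHenon) : Set (ℂ × ℂ) := (H.Kplus)ᶜ

lemma deg_pos (H : GenHenon) : 0 < H.deg :=
  Finset.prod_pos fun i _ => lt_of_lt_of_le two_pos (H.hdeg i)

end GenHenon

/-- `f` is a holomorphic automorphism of `ℂ²`. -/
def IsAutC2 (f : ℂ × ℂ → ℂ × ℂ) : Prop :=
  Differentiable ℂ f ∧ ∃ g : ℂ × ℂ → ℂ × ℂ,
    Differentiable ℂ g ∧ Function.LeftInverse g f ∧ Function.RightInverse g f

/-- `L` is an affine automorphism of `ℂ²`: `L z = T z + b` with `T` an invertible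
`ℂ`-linear map. -/
def IsAffineAut (L : ℂ × ℂ → ℂ × ℂ) : Prop :=
  ∃ (T : (ℂ × ℂ) ≃ₗ[ℂ] ℂ × ℂ) (b : ℂ × ℂ), ∀ z, L z = T z + b

/-- `f : ℂ² → ℂ²` is a polynomial map: both coordinate functions are polynomials in
`(x, y)`. -/
def IsPolyMap (f : ℂ × ℂ → ℂ × ℂ) : Prop :=
  ∃ P Q : MvPolynomial (Fin 2) ℂ, ∀ z : ℂ × ℂ,
    f z = (MvPolynomial.eval ![z.1, z.2] P, MvPolynomial.eval ![z.1, z.2] Q)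

namespace HenonRigidity

/-! ### Holomorphic functions of two variables -/

lemma continuousOn_deriv_param {P : Type*} [TopologicalSpace P] {f : P → ℂ → ℂ} {O : Set (P × ℂ)}
    (hO : IsOpen O) (hc : ContinuousOn (fun z : P × ℂ => f z.1 z.2) O)
    (hd : ∀ z ∈ O, DifferentiableAt ℂ (f z.1) z.2) :
    ContinuousOn (fun z : P × ℂ => deriv (f z.1) z.2) O := by
  rintro ⟨p, s⟩ hz
  apply ContinuousAt.continuousWithinAt
  obtain ⟨U, V, hU, hpU, hV, hsV, hUV⟩ : ∃ (U : Set P) (V : Set ℂ), IsOpen U ∧ p ∈ U ∧ IsOpen V ∧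
      s ∈ V ∧ U ×ˢ V ⊆ O := by
    obtain ⟨U, V, h1, h2, h3, h4, h5⟩ := isOpen_prod_iff.1 hO p s hz
    exact ⟨U, V, h1, h3, h2, h4, h5⟩
  have hlu : TendstoLocallyUniformlyOn f (f p) (𝓝 p) V := by
    rw [Metric.tendstoLocallyUniformlyOn_iff]
    intro ε hε x hx
    have hcx := (hc (p, x) (hUV ⟨hpU, hx⟩)).continuousAt (hO.mem_nhds (hUV ⟨hpU, hx⟩))
    have := Metric.continuousAt_iff'.1 hcx (ε / 2) (half_pos hε)
    rw [nhds_prod_eq, eventually_prod_iff] at this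
    obtain ⟨pa, ha, pb, hb, hab⟩ := this
    refine ⟨{y | pb y}, mem_nhdsWithin_of_mem_nhds hb, ?_⟩
    filter_upwards [ha] with q hq y hy
    have h1 := hab hq hy
    have h2 := hab ha.self_of_nhds hy
    calc dist (f p y) (f q y) ≤ dist (f p y) (f p x) + dist (f q y) (f p x) :=
          dist_triangle_right _ _ _
      _ < ε := by simp only at h1 h2; linarith
  have hdiff : ∀ᶠ q in 𝓝 p, DifferentiableOn ℂ (f q) V := by
    filter_upwards [hU.mem_nhds hpU] with q hq y hy
    exact (hd (q, y) (hUV ⟨hq, hy⟩)).differentiableWithinAt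
  have hD := hlu.deriv hdiff hV
  have hcd : ContinuousOn (deriv (f p)) V :=
    ((hdiff.self_of_nhds).deriv hV).continuousOn
  have hDs : Tendsto (fun z : P × ℂ => deriv (f z.1) z.2) (𝓝 (p, s)) (𝓝 (deriv (f p) s)) := by
    rw [Metric.tendsto_nhds]
    intro ε hε
    obtain ⟨t, ht, hts⟩ := Metric.tendstoLocallyUniformlyOn_iff.1 hD (ε / 2) (half_pos hε) s hsV
    rw [hV.nhdsWithin_eq hsV] at ht
    have h3 := Metric.continuousAt_iff'.1 ((hcd s hsV).continuousAt (hV.mem_nhds hsV)) (ε / 2)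
      (half_pos hε)
    rw [nhds_prod_eq]
    filter_upwards [prod_mem_prod hts (inter_mem ht h3)] with z hz
    obtain ⟨hz1, hz2, hz3⟩ := hz
    have h4 : dist (deriv (f p) z.2) (deriv (f z.1) z.2) < ε / 2 := hz1 z.2 hz2
    have h5 : dist (deriv (f p) z.2) (deriv (f p) s) < ε / 2 := hz3
    calc dist (deriv (f z.1) z.2) (deriv (f p) s)
        ≤ dist (deriv (f p) z.2) (deriv (f z.1) z.2) + dist (deriv (f p) z.2) (deriv (f p) s) :=
          dist_triangle_left _ _ _
      _ < ε := by linarith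
  exact hDs

/-- Partial derivative in the first variable. -/
def dx (f : ℂ × ℂ → ℂ) (z : ℂ × ℂ) : ℂ := deriv (fun x => f (x, z.2)) z.1

/-- Partial derivative in the second variable. -/
def dy (f : ℂ × ℂ → ℂ) (z : ℂ × ℂ) : ℂ := deriv (fun y => f (z.1, y)) z.2

/-- The linear form with coefficients `a`, `b`. -/
def lform (a b : ℂ) : ℂ × ℂ →L[ℂ] ℂ :=
  (ContinuousLinearMap.toSpanSingleton ℂ a).coprod (ContinuousLinearMap.toSpanSingleton ℂ b)

@[simp] lemma lform_apply (a b : ℂ) (v : ℂ × ℂ) : lform a b v = a * v.1 + b * v.2 := by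
  simp [lform, mul_comm]

section
variable {f : ℂ × ℂ → ℂ} {O : Set (ℂ × ℂ)}

lemma continuousOn_dy_of_sep (hO : IsOpen O) (hc : ContinuousOn f O)
    (hd : ∀ z ∈ O, DifferentiableAt ℂ (fun y => f (z.1, y)) z.2) : ContinuousOn (dy f) O :=
  continuousOn_deriv_param (f := fun x y => f (x, y)) hO hc hd

lemma continuousOn_dx_of_sep (hO : IsOpen O) (hc : ContinuousOn f O)
    (hd : ∀ z ∈ O, DifferentiableAt ℂ (fun x => f (x, z.2)) z.1) : ContinuousOn (dx f) O := by
  have h := continuousOn_deriv_param (f := fun y x => f (x, y)) (O := Prod.swap ⁻¹' O)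
    (hO.preimage continuous_swap) (hc.comp continuous_swap.continuousOn fun _ h => h)
    (fun z hz => hd z.swap hz)
  exact h.comp continuous_swap.continuousOn (s := O) (fun z hz => by simpa using hz)

/-- A continuous separately holomorphic function is strictly differentiable. -/
theorem hasStrictFDerivAt_of_sep (hO : IsOpen O) (hc : ContinuousOn f O)
    (hx : ∀ z ∈ O, DifferentiableAt ℂ (fun x => f (x, z.2)) z.1)
    (hy : ∀ z ∈ O, DifferentiableAt ℂ (fun y => f (z.1, y)) z.2) {z : ℂ × ℂ} (hz : z ∈ O) :
    HasStrictFDerivAt f (lform (dx f z) (dy f z)) z := by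
  have h1 := continuousOn_dx_of_sep hO hc hx
  have h2 := continuousOn_dy_of_sep hO hc hy
  have := hasStrictFDerivAt_uncurry_coprod (𝕜 := ℂ) (u := z) (f := fun x y => f (x, y))
    (f₁ := fun x y => ContinuousLinearMap.toSpanSingleton ℂ (dx f (x, y)))
    (f₂ := fun x y => ContinuousLinearMap.toSpanSingleton ℂ (dy f (x, y)))
    (by
      filter_upwards [hO.mem_nhds hz] with v hv
      exact (hx v hv).hasDerivAt.hasFDerivAt)
    (by
      filter_upwards [hO.mem_nhds hz] with v hv
      exact (hy v hv).hasDerivAt.hasFDerivAt)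
    ?_ ?_
  · exact this
  · have := (h1 z hz).continuousAt (hO.mem_nhds hz)
    exact (ContinuousLinearMap.toSpanSingletonCLE (𝕜 := ℂ) (E := ℂ)).continuous.continuousAt.comp
      this
  · have := (h2 z hz).continuousAt (hO.mem_nhds hz)
    exact (ContinuousLinearMap.toSpanSingletonCLE (𝕜 := ℂ) (E := ℂ)).continuous.continuousAt.comp
      this

theorem differentiableOn_of_sep (hO : IsOpen O) (hc : ContinuousOn f O)
    (hx : ∀ z ∈ O, DifferentiableAt ℂ (fun x => f (x, z.2)) z.1)
    (hy : ∀ z ∈ O, DifferentiableAt ℂ (fun y => f (z.1, y)) z.2) : DifferentiableOn ℂ f O :=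
  fun _ hz => (hasStrictFDerivAt_of_sep hO hc hx hy hz).differentiableAt.differentiableWithinAt

lemma differentiableAt_slice_x {z : ℂ × ℂ} (h : DifferentiableAt ℂ f z) :
    DifferentiableAt ℂ (fun x => f (x, z.2)) z.1 := by
  have : DifferentiableAt ℂ (fun x : ℂ => (x, z.2)) z.1 := by fun_prop
  exact DifferentiableAt.comp z.1 (f := fun x : ℂ => (x, z.2)) h this

lemma differentiableAt_slice_y {z : ℂ × ℂ} (h : DifferentiableAt ℂ f z) :
    DifferentiableAt ℂ (fun y => f (z.1, y)) z.2 := by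
  have : DifferentiableAt ℂ (fun y : ℂ => (z.1, y)) z.2 := by fun_prop
  exact DifferentiableAt.comp z.2 (f := fun y : ℂ => (z.1, y)) h this

theorem hasStrictFDerivAt_of_diffOn (hO : IsOpen O) (h : DifferentiableOn ℂ f O) {z : ℂ × ℂ}
    (hz : z ∈ O) : HasStrictFDerivAt f (lform (dx f z) (dy f z)) z :=
  hasStrictFDerivAt_of_sep hO h.continuousOn
    (fun _ hw => differentiableAt_slice_x (h.differentiableAt (hO.mem_nhds hw)))
    (fun _ hw => differentiableAt_slice_y (h.differentiableAt (hO.mem_nhds hw))) hz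

lemma continuousOn_dy (hO : IsOpen O) (h : DifferentiableOn ℂ f O) :
    ContinuousOn (dy f) O :=
  continuousOn_dy_of_sep hO h.continuousOn
    (fun _ hw => differentiableAt_slice_y (h.differentiableAt (hO.mem_nhds hw)))

lemma hasDerivAt_dx {z : ℂ × ℂ} (h : DifferentiableAt ℂ f z) :
    HasDerivAt (fun x => f (x, z.2)) (dx f z) z.1 :=
  (differentiableAt_slice_x h).hasDerivAt

lemma hasDerivAt_dy {z : ℂ × ℂ} (h : DifferentiableAt ℂ f z) :
    HasDerivAt (fun y => f (z.1, y)) (dy f z) z.2 :=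
  (differentiableAt_slice_y h).hasDerivAt

end

lemma differentiableAt_integral_param {k : ℂ → ℝ → ℂ} {U : Set ℂ} (hU : IsOpen U)
    (hk : ContinuousOn (fun z : ℂ × ℝ => k z.1 z.2) (U ×ˢ univ))
    (hd : ∀ s, DifferentiableOn ℂ (fun x => k x s) U) (a b : ℝ) {x₀ : ℂ} (hx₀ : x₀ ∈ U) :
    DifferentiableAt ℂ (fun x => ∫ s in a..b, k x s) x₀ := by
  obtain ⟨r, hr, hrU⟩ : ∃ r > 0, Metric.closedBall x₀ r ⊆ U :=
    Metric.nhds_basis_closedBall.mem_iff.1 (hU.mem_nhds hx₀)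
  have hkx : ∀ x ∈ U, Continuous (k x) := fun x hx => by
    rw [← continuousOn_univ]
    exact hk.comp (f := fun s : ℝ => (x, s)) (by fun_prop) (fun s _ => ⟨hx, trivial⟩)
  obtain ⟨M, hM⟩ := ((isCompact_closedBall x₀ r).prod isCompact_uIcc).exists_bound_of_continuousOn
    (hk.mono (Set.prod_mono hrU (subset_univ (uIcc a b))))
  have hder : Continuous fun s => deriv (fun x => k x s) x₀ := by
    have := continuousOn_deriv_param (P := ℝ) (f := fun s x => k x s) (O := univ ×ˢ U)
      (isOpen_univ.prod hU)
      (hk.comp continuous_swap.continuousOn fun z hz => ⟨hz.2, trivial⟩)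
      (fun z hz => (hd z.1).differentiableAt (hU.mem_nhds hz.2))
    rw [← continuousOn_univ]
    exact this.comp (f := fun s : ℝ => (s, x₀)) (by fun_prop) (fun s _ => ⟨trivial, hx₀⟩)
  have hball : ∀ x ∈ Metric.ball x₀ (r / 2), Metric.closedBall x (r / 2) ⊆ Metric.closedBall x₀ r :=
    fun x hx => Metric.closedBall_subset_closedBall' (by
      have := Metric.mem_ball.1 hx; linarith)
  refine (intervalIntegral.hasDerivAt_integral_of_dominated_loc_of_deriv_le
    (F' := fun x s => deriv (fun x => k x s) x) (bound := fun _ => M / (r / 2))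
    (Metric.ball_mem_nhds x₀ (half_pos hr)) ?_ ((hkx x₀ hx₀).intervalIntegrable _ _)
    hder.aestronglyMeasurable ?_ intervalIntegrable_const ?_).2.differentiableAt
  · filter_upwards [hU.mem_nhds hx₀] with x hx
    exact (hkx x hx).aestronglyMeasurable
  · refine Eventually.of_forall fun s hs x hx => ?_
    refine Complex.norm_deriv_le_of_forall_mem_sphere_norm_le (half_pos hr) ?_ ?_
    · refine ((hd s).mono ?_).diffContOnCl
      exact (Metric.closure_ball_subset_closedBall.trans (hball x hx)).trans hrU
    · intro w hw
      exact hM (w, s) ⟨hball x hx (Metric.sphere_subset_closedBall hw), uIoc_subset_uIcc hs⟩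
  · refine Eventually.of_forall fun s _ x hx => ?_
    have : x ∈ U := hrU (hball x hx (Metric.mem_closedBall_self (half_pos hr).le))
    exact ((hd s).differentiableAt (hU.mem_nhds this)).hasDerivAt

lemma continuousOn_integral_param {P : Type*} [TopologicalSpace P] {k : P → ℝ → ℂ} {U : Set P}
    (hk : ContinuousOn (fun z : P × ℝ => k z.1 z.2) (U ×ˢ univ)) (a b : ℝ) :
    ContinuousOn (fun x => ∫ s in a..b, k x s) U := by
  rw [continuousOn_iff_continuous_domRestrict]
  refine intervalIntegral.continuous_parametric_intervalIntegral_of_continuous'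
    (f := fun (x : U) s => k x s) ?_ a b
  exact hk.comp_continuous (f := fun z : U × ℝ => ((z.1 : P), z.2)) (by fun_prop)
    fun z => ⟨z.1.2, trivial⟩

lemma differentiableOn_dy {f : ℂ × ℂ → ℂ} {O : Set (ℂ × ℂ)} (hO : IsOpen O)
    (h : DifferentiableOn ℂ f O) : DifferentiableOn ℂ (dy f) O := by
  refine differentiableOn_of_sep hO (continuousOn_dy hO h) ?_ ?_
  · rintro ⟨x₀, y₀⟩ hz
    obtain ⟨U, V, hU, hV, hxU, hyV, hUV⟩ := isOpen_prod_iff.1 hO x₀ y₀ hz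
    obtain ⟨r, hr, hrV⟩ : ∃ r > 0, Metric.closedBall y₀ r ⊆ V :=
      Metric.nhds_basis_closedBall.mem_iff.1 (hV.mem_nhds hyV)
    have hsub : ∀ x ∈ U, ∀ y ∈ Metric.closedBall y₀ r, (x, y) ∈ O :=
      fun x hx y hy => hUV ⟨hx, hrV hy⟩
    have key : ∀ x ∈ U, dy f (x, y₀) = (2 * Real.pi * I : ℂ)⁻¹ * ∫ s in (0 : ℝ)..2 * Real.pi,
        deriv (circleMap y₀ r) s * (((circleMap y₀ r s - y₀) ^ 2)⁻¹ * f (x, circleMap y₀ r s)) := by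
      intro x hx
      have hdd : DiffContOnCl ℂ (fun y => f (x, y)) (Metric.ball y₀ r) := by
        refine DifferentiableOn.diffContOnCl fun y hy => ?_
        have hy' := hsub x hx y (Metric.closure_ball_subset_closedBall hy)
        exact (differentiableAt_slice_y (h.differentiableAt
          (hO.mem_nhds hy'))).differentiableWithinAt
      have := hdd.deriv_eq_smul_circleIntegral hr
      rw [eq_inv_mul_iff_mul_eq₀ Complex.two_pi_I_ne_zero]
      simpa [circleIntegral, dy] using this.symm
    have hd : DifferentiableAt ℂ (fun x => (2 * Real.pi * I : ℂ)⁻¹ *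
        ∫ s in (0 : ℝ)..2 * Real.pi, deriv (circleMap y₀ r) s •
          (((circleMap y₀ r s - y₀) ^ 2)⁻¹ * f (x, circleMap y₀ r s))) x₀ := by
      refine DifferentiableAt.const_mul (differentiableAt_integral_param hU ?_ ?_ _ _ hxU) _
      · have h1 : ∀ s, (circleMap y₀ r s - y₀) ^ 2 ≠ 0 := fun s => by
          simp [hr.ne']
        have h2 : ContinuousOn (fun z : ℂ × ℝ => f (z.1, circleMap y₀ r z.2)) (U ×ˢ univ) := by
          refine h.continuousOn.comp (f := fun z : ℂ × ℝ => (z.1, circleMap y₀ r z.2))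
            (by fun_prop) ?_
          intro z hz
          exact hsub _ hz.1 _ (circleMap_mem_closedBall _ hr.le _)
        simp only [deriv_circleMap]
        have h4 : Continuous fun z : ℂ × ℝ => (circleMap y₀ r z.2 - y₀) ^ 2 := by fun_prop
        refine ContinuousOn.mul (Continuous.continuousOn (by fun_prop)) ((h4.continuousOn.inv₀ fun z _ => h1 z.2).mul h2)
      · intro s x hx
        have h3 : DifferentiableAt ℂ (fun x => f (x, circleMap y₀ r s)) x := differentiableAt_slice_x (h.differentiableAt
          (hO.mem_nhds (hsub x hx _ (circleMap_mem_closedBall y₀ hr.le s))))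
        exact ((h3.const_mul _).const_mul _).differentiableWithinAt
    refine hd.congr_of_eventuallyEq ?_
    filter_upwards [hU.mem_nhds hxU] with x hx using key x hx
  · rintro ⟨x₀, y₀⟩ hz
    have hV : IsOpen {y | (x₀, y) ∈ O} := hO.preimage (by fun_prop)
    have h1 : DifferentiableOn ℂ (fun y => f (x₀, y)) {y | (x₀, y) ∈ O} := fun y hy =>
      (differentiableAt_slice_y (h.differentiableAt (hO.mem_nhds hy))).differentiableWithinAt
    exact (h1.deriv hV).differentiableAt (hV.mem_nhds hz)

lemma exists_polynomial_of_growth (n : ℕ) : ∀ {f : ℂ → ℂ}, Differentiable ℂ f → ∀ {C : ℝ},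
    (∀ z, ‖f z‖ ≤ C * (1 + ‖z‖) ^ n) →
    ∃ P : Polynomial ℂ, P.natDegree ≤ n ∧ ∀ z, f z = P.eval z := by
  induction n with
  | zero =>
    intro f hf C hC
    refine ⟨Polynomial.C (f 0), by simp, fun z => ?_⟩
    rw [Polynomial.eval_C]
    refine hf.apply_eq_apply_of_bounded ?_ z 0
    exact (Metric.isBounded_closedBall (x := (0 : ℂ)) (r := C)).subset
      (by rintro _ ⟨w, rfl⟩; simpa using hC w)
  | succ n ih =>
    intro f hf C hC
    have hg : Differentiable ℂ (dslope f 0) := by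
      rw [← differentiableOn_univ]
      exact (differentiableOn_dslope univ_mem).2 hf.differentiableOn
    obtain ⟨M, hM⟩ := (isCompact_closedBall (0 : ℂ) 1).exists_bound_of_continuousOn
      hg.continuous.continuousOn
    have hC0 : 0 ≤ C := by simpa using (norm_nonneg _).trans (hC 0)
    obtain ⟨P, hPn, hP⟩ := ih hg (C := max M (4 * C)) fun z => by
      have h1 : 1 ≤ (1 + ‖z‖) ^ n := one_le_pow₀ (by linarith [norm_nonneg z])
      rcases le_total ‖z‖ 1 with hz | hz
      · have h2 := hM z (by simpa using hz)
        have : 0 ≤ max M (4 * C) := le_max_of_le_right (by positivity)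
        exact (h2.trans (le_max_left _ _)).trans (le_mul_of_one_le_right this h1)
      · have hz0 : z ≠ 0 := by rintro rfl; simp at hz; linarith
        rw [dslope_of_ne _ hz0, slope_def_field, norm_div, sub_zero,
          div_le_iff₀ (by positivity)]
        have h2 := hC z
        have h3 := hC 0
        simp only [norm_zero, add_zero, one_pow, mul_one] at h3
        calc ‖f z - f 0‖ ≤ ‖f z‖ + ‖f 0‖ := norm_sub_le _ _
          _ ≤ C * (1 + ‖z‖) ^ (n + 1) + C * (1 + ‖z‖) ^ (n + 1) := by
            gcongr
            exact h3.trans (le_mul_of_one_le_right hC0 (one_le_pow₀ (by linarith)))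
          _ = 2 * C * (1 + ‖z‖) ^ n * (1 + ‖z‖) := by ring
          _ ≤ 2 * C * (1 + ‖z‖) ^ n * (2 * ‖z‖) := by gcongr; linarith
          _ = 4 * C * (1 + ‖z‖) ^ n * ‖z‖ := by ring
          _ ≤ max M (4 * C) * (1 + ‖z‖) ^ n * ‖z‖ := by gcongr; exact le_max_right _ _
    refine ⟨Polynomial.C (f 0) + Polynomial.X * P, ?_, fun z => ?_⟩
    · refine (Polynomial.natDegree_add_le _ _).trans (max_le (by simp) ?_)
      refine Polynomial.natDegree_mul_le.trans ?_
      simp; omega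
    · have := sub_smul_dslope f 0 z
      simp only [sub_zero, smul_eq_mul] at this
      simp [← hP, this]

lemma exists_mvPolynomial_of_growth {f : ℂ × ℂ → ℂ} (hf : Differentiable ℂ f) (n : ℕ) {C : ℝ}
    (hC : ∀ z, ‖f z‖ ≤ C * (1 + ‖z‖) ^ n) :
    ∃ P : MvPolynomial (Fin 2) ℂ, ∀ z, f z = MvPolynomial.eval ![z.1, z.2] P := by
  have hC0 : 0 ≤ C := by simpa using (norm_nonneg _).trans (hC 0)
  have hmax : ∀ x y : ℂ, 1 + ‖(x, y)‖ ≤ (1 + ‖x‖) * (1 + ‖y‖) := fun x y => by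
    rw [Prod.norm_mk]
    rcases max_cases ‖x‖ ‖y‖ with h | h <;> rw [h.1] <;>
      nlinarith [norm_nonneg x, norm_nonneg y, mul_nonneg (norm_nonneg x) (norm_nonneg y)]
  have hx : ∀ y, ∃ P : Polynomial ℂ, P.natDegree ≤ n ∧ ∀ x, f (x, y) = P.eval x := fun y =>
    exists_polynomial_of_growth n (f := fun x => f (x, y)) (C := C * (1 + ‖y‖) ^ n)
      (fun x => differentiableAt_slice_x (hf (x, y)))
      fun x => (hC _).trans (by
        rw [mul_assoc, mul_comm ((1 + ‖y‖) ^ n), ← mul_pow]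
        gcongr; exact hmax x y)
  have hy : ∀ x, ∃ P : Polynomial ℂ, P.natDegree ≤ n ∧ ∀ y, f (x, y) = P.eval y := fun x =>
    exists_polynomial_of_growth n (f := fun y => f (x, y)) (C := C * (1 + ‖x‖) ^ n)
      (fun y => differentiableAt_slice_y (hf (x, y)))
      fun y => (hC _).trans (by
        rw [mul_assoc, ← mul_pow]
        gcongr; exact hmax x y)
  choose P hPn hP using hx
  choose Q _ hQ using hy
  let s := Finset.range (n + 1)
  let v : ℕ → ℂ := fun i => (i : ℂ)
  refine ⟨∑ i ∈ s, (Polynomial.aeval (MvPolynomial.X 0) (Lagrange.basis s v i)) *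
    (Polynomial.aeval (MvPolynomial.X 1) (Q i)), ?_⟩
  rintro ⟨x, y⟩
  have h1 : P y = Lagrange.interpolate s v fun i => (P y).eval (v i) :=
    Lagrange.eq_interpolate (s := s) (v := v) (fun a _ b _ h => by simpa [v] using h) (by
      refine (Polynomial.degree_le_natDegree).trans_lt ?_
      simp only [s, Finset.card_range]
      exact_mod_cast Nat.lt_succ_of_le (hPn y))
  rw [hP, h1, Lagrange.interpolate_apply, Polynomial.eval_finsetSum, map_sum]
  refine Finset.sum_congr rfl fun i _ => ?_
  have h2 : ∀ (R : Polynomial ℂ) (k : Fin 2), MvPolynomial.eval ![x, y]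
      (Polynomial.aeval (MvPolynomial.X k) R) = R.eval (![x, y] k) := fun R k => by
    simp [Polynomial.aeval_def, Polynomial.eval₂_eq_sum_range, Polynomial.eval_eq_sum_range]
  simp only [Polynomial.eval_mul, Polynomial.eval_C, map_mul, h2, ← hP, hQ, v]
  simp [mul_comm]

lemma entire_injective_affine {f : ℂ → ℂ} (hf : Differentiable ℂ f) (hi : Function.Injective f) :
    ∃ a b : ℂ, a ≠ 0 ∧ ∀ z, f z = a * z + b := by
  obtain ⟨z₀, hz₀⟩ : ∃ z₀, deriv f z₀ ≠ 0 := by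
    by_contra! h
    exact zero_ne_one (hi (is_const_of_deriv_eq_zero hf h 0 1))
  let g := dslope f z₀
  have hg : Differentiable ℂ g := by
    rw [← differentiableOn_univ]
    exact (differentiableOn_dslope univ_mem).2 hf.differentiableOn
  have hfg : ∀ z, f z = f z₀ + (z - z₀) * g z := fun z => by
    have := sub_smul_dslope f z₀ z
    simp only [smul_eq_mul] at this
    rw [this]; ring
  have hg0 : ∀ z, g z ≠ 0 := fun z hz => by
    rcases eq_or_ne z z₀ with rfl | h
    · exact hz₀ (by simpa [g] using hz)
    · exact h (hi (by rw [hfg z, hz]; simp))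
  obtain ⟨δ, hδ, hball⟩ : ∃ δ > 0, Metric.ball (f z₀) δ ⊆ f '' Metric.ball z₀ 1 := by
    have h1 : 𝓝 (f z₀) ≤ map f (𝓝 z₀) := by
      refine (AnalyticAt.eventually_constant_or_nhds_le_map_nhds (hf.analyticAt z₀)).resolve_left ?_
      intro h
      exact hz₀ (by
        rw [Filter.EventuallyEq.deriv_eq (f₁ := f) (f := fun _ => f z₀) h]; simp)
    exact Metric.mem_nhds_iff.1 (h1 (image_mem_map (Metric.ball_mem_nhds z₀ one_pos)))
  obtain ⟨M, hM⟩ := (isCompact_closedBall z₀ 1).exists_bound_of_continuousOn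
      ((hg.inv hg0).continuous.continuousOn)
  have hbig : ∀ z, 1 ≤ ‖z - z₀‖ → δ ≤ ‖f z - f z₀‖ := fun z hz => by
    by_contra! h
    obtain ⟨w, hw, hwz⟩ := hball (by simpa [dist_eq_norm] using h : f z ∈ Metric.ball (f z₀) δ)
    rw [← hi hwz] at hz
    rw [Metric.mem_ball, dist_eq_norm] at hw
    linarith
  have hgrow : ∀ z, ‖(g z)⁻¹‖ ≤ max M ((1 + ‖z₀‖) / δ) * (1 + ‖z‖) ^ 1 := fun z => by
    have hp : 0 ≤ max M ((1 + ‖z₀‖) / δ) := le_max_of_le_right (by positivity)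
    rcases le_total ‖z - z₀‖ 1 with h | h
    · refine ((hM z (by simpa [dist_eq_norm] using h)).trans
        (le_max_left M ((1 + ‖z₀‖) / δ))).trans ?_
      exact le_mul_of_one_le_right hp (by simp)
    · have h1 := hbig z h
      rw [hfg z, add_sub_cancel_left, norm_mul] at h1
      have h2 : 0 < ‖g z‖ := norm_pos_iff.2 (hg0 z)
      calc ‖(g z)⁻¹‖ ≤ ‖z - z₀‖ / δ := by
            rw [norm_inv, inv_le_iff_one_le_mul₀ h2, div_mul_eq_mul_div, one_le_div hδ]
            exact h1
        _ ≤ (‖z‖ + ‖z₀‖) / δ := by gcongr; exact norm_sub_le _ _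
        _ ≤ ((1 + ‖z₀‖) / δ) * (1 + ‖z‖) := by
            rw [div_mul_eq_mul_div]; gcongr
            nlinarith [norm_nonneg z, norm_nonneg z₀]
        _ ≤ _ := by rw [pow_one]; gcongr; exact le_max_right _ _
  obtain ⟨P, hP1, hP⟩ := exists_polynomial_of_growth 1 (hg.inv hg0) hgrow
  have hP0 : P.degree = 0 := by
    by_contra h
    obtain ⟨w, hw⟩ := Complex.exists_root (f := P) (by
      refine lt_of_le_of_ne ?_ (Ne.symm h)
      rw [Polynomial.zero_le_degree_iff]
      rintro rfl
      exact inv_ne_zero (hg0 0) (by simpa using hP 0))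
    exact inv_ne_zero (hg0 w) ((hP w).trans hw)
  have hconst : ∀ z, g z = g 0 := fun z => by
    rw [Polynomial.eq_C_of_degree_eq_zero hP0] at hP
    have h1 := hP z
    have h2 := hP 0
    simp only [Polynomial.eval_C] at h1 h2
    exact inv_injective (h1.trans h2.symm)
  refine ⟨g 0, f z₀ - z₀ * g 0, hg0 0, fun z => ?_⟩
  rw [hfg z, hconst z]; ring

lemma const_of_locally_log_norm {v : ℂ → ℝ} (hpos : ∀ t, 0 ≤ v t)
    (hloc : ∀ t, ∃ (f : ℂ → ℂ) (c : ℝ), AnalyticAt ℂ f t ∧ f t ≠ 0 ∧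
      ∀ᶠ s in 𝓝 t, v s = c * Real.log ‖f s‖) (t s : ℂ) : v t = v s := by
  have hharm : InnerProductSpace.HarmonicOnNhd v univ := fun t _ => by
    obtain ⟨f, c, hf, hf0, hv⟩ := hloc t
    rw [InnerProductSpace.harmonicAt_congr_nhds (f₂ := c • (Real.log ‖f ·‖))]
    · exact (hf.harmonicAt_log_norm hf0).const_smul
    · filter_upwards [hv] with s hs
      simp [hs]
  obtain ⟨F, hF, hre⟩ := hharm.exists_analyticOnNhd_univ_re_eq
  have hFd : Differentiable ℂ F := fun z => (hF z trivial).differentiableAt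
  have hb : Differentiable ℂ fun z => Complex.exp (-F z) := by fun_prop
  have hvF : ∀ z, ‖Complex.exp (-F z)‖ = Real.exp (-v z) := fun z => by
    rw [Complex.norm_exp, Complex.neg_re]
    exact congrArg (fun y => Real.exp (-y)) (congrFun hre z)
  have := hb.apply_eq_apply_of_bounded ?_ t s
  · have h := congrArg norm this
    rw [hvF, hvF] at h
    linarith [Real.exp_injective h]
  · refine (Metric.isBounded_closedBall (x := (0 : ℂ)) (r := 1)).subset ?_
    rintro _ ⟨w, rfl⟩
    simpa [hvF] using hpos w

/-! ### Inverting small perturbations of the identity -/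

lemma exists_solve {w : ℂ → ℂ} {τ : ℂ} {M : ℝ} (hM : 0 < M)
    (hw : DifferentiableOn ℂ w (Metric.ball τ (6 * M)))
    (hb : ∀ s ∈ Metric.ball τ (6 * M), ‖w s‖ ≤ M) :
    ∃ s ∈ Metric.closedBall τ M, s + w s = τ := by
  have hsub : Metric.closedBall τ (5 * M) ⊆ Metric.ball τ (6 * M) :=
    Metric.closedBall_subset_ball (by linarith)
  have hτ : τ ∈ Metric.ball τ (6 * M) := Metric.mem_ball_self (by linarith)
  have hdw : ‖deriv w τ‖ ≤ M / (5 * M) := by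
    refine Complex.norm_deriv_le_of_forall_mem_sphere_norm_le (by positivity) ?_ ?_
    · exact (hw.mono (Metric.closure_ball_subset_closedBall.trans hsub)).diffContOnCl
    · exact fun z hz => hb z (hsub (Metric.sphere_subset_closedBall hz))
  have hdw' : ‖deriv w τ‖ < 1 := hdw.trans_lt (by rw [div_lt_one (by positivity)]; linarith)
  have hf : DifferentiableOn ℂ (fun s => s + w s) (Metric.ball τ (6 * M)) :=
    differentiableOn_id.add hw
  have hder : HasDerivAt (fun s => s + w s) (1 + deriv w τ) τ :=
    (hasDerivAt_id τ).add
      (hw.differentiableAt (Metric.isOpen_ball.mem_nhds hτ)).hasDerivAt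
  have hne : 1 + deriv w τ ≠ 0 := fun h => by
    rw [add_comm] at h
    rw [eq_neg_of_add_eq_zero_left h] at hdw'
    simp at hdw'
  have hball := DiffContOnCl.ball_subset_image_closedBall (f := fun s => s + w s) (z₀ := τ)
    (r := 5 * M) (ε := 3 * M)
    (hf.mono (Metric.closure_ball_subset_closedBall.trans hsub)).diffContOnCl (by positivity)
    (fun z hz => by
      have h1 := hb z (hsub (Metric.sphere_subset_closedBall hz))
      have h2 := hb τ hτ
      have h3 : ‖z - τ‖ = 5 * M := by rw [← dist_eq_norm]; exact hz
      have h4 : z - τ = (z + w z - (τ + w τ)) - w z + w τ := by ring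
      have h5 : ‖z - τ‖ ≤ ‖z + w z - (τ + w τ)‖ + ‖w z‖ + ‖w τ‖ := by
        conv_lhs => rw [h4]
        exact (norm_add_le _ _).trans (by gcongr; exact norm_sub_le _ _)
      linarith)
    (((hder.eventually_ne hne).frequently).filter_mono nhdsWithin_le_nhds)
  obtain ⟨s, hs, hsτ⟩ := hball (show τ ∈ Metric.ball (τ + w τ) (3 * M / 2) by
    rw [Metric.mem_ball, dist_eq_norm]
    have := hb τ hτ
    simp; linarith)
  refine ⟨s, ?_, hsτ⟩
  have h6 : s - τ = -w s := by linear_combination hsτ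
  rw [Metric.mem_closedBall, dist_eq_norm, h6, norm_neg]
  exact hb s (hsub hs)

lemma solve_unique {w : ℂ → ℂ} {τ : ℂ} {M : ℝ} (hM : 0 < M)
    (hw : DifferentiableOn ℂ w (Metric.ball τ (6 * M)))
    (hb : ∀ s ∈ Metric.ball τ (6 * M), ‖w s‖ ≤ M) {s s' : ℂ} (hs : s ∈ Metric.closedBall τ M)
    (hs' : s' ∈ Metric.closedBall τ M) (h : s + w s = s' + w s') : s = s' := by
  have hsub : ∀ z ∈ Metric.closedBall τ M,
      Metric.closedBall z (4 * M) ⊆ Metric.ball τ (6 * M) := fun z hz y hy => by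
    have h1 := Metric.mem_closedBall.1 hz
    have h2 := Metric.mem_closedBall.1 hy
    have := dist_triangle y z τ
    rw [Metric.mem_ball]; linarith
  have hmem : ∀ z ∈ Metric.closedBall τ M, z ∈ Metric.ball τ (6 * M) := fun z hz =>
    hsub z hz (Metric.mem_closedBall_self (by positivity))
  have hd : ∀ z ∈ Metric.closedBall τ M, ‖deriv w z‖ ≤ 1 / 4 := fun z hz => by
    have : M / (4 * M) = 1 / 4 := by field_simp
    rw [← this]
    refine Complex.norm_deriv_le_of_forall_mem_sphere_norm_le (by positivity) ?_ ?_
    · exact (hw.mono (Metric.closure_ball_subset_closedBall.trans (hsub z hz))).diffContOnCl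
    · exact fun y hy => hb y (hsub z hz (Metric.sphere_subset_closedBall hy))
  have hlip := (convex_closedBall τ M).norm_image_sub_le_of_norm_deriv_le
    (fun z hz => hw.differentiableAt (Metric.isOpen_ball.mem_nhds (hmem z hz))) hd hs' hs
  have h1 : w s - w s' = -(s - s') := by linear_combination h
  rw [h1, norm_neg] at hlip
  have := norm_nonneg (s - s')
  exact sub_eq_zero.1 (norm_eq_zero.1 (by linarith))

/-- The linear map of `ℂ²` given by an invertible matrix. -/
def lequiv (a b c d : ℂ) (h : a * d - b * c ≠ 0) : (ℂ × ℂ) ≃L[ℂ] ℂ × ℂ :=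
  ContinuousLinearEquiv.equivOfInverse ((lform a b).prod (lform c d))
    ((lform (d * (a * d - b * c)⁻¹) (-b * (a * d - b * c)⁻¹)).prod
      (lform (-c * (a * d - b * c)⁻¹) (a * (a * d - b * c)⁻¹)))
    (fun v => by
      have he := mul_inv_cancel₀ h
      ext
      · simp; linear_combination v.1 * he
      · simp; linear_combination v.2 * he)
    (fun v => by
      have he := mul_inv_cancel₀ h
      ext
      · simp; linear_combination v.1 * he
      · simp; linear_combination v.2 * he)

lemma differentiableAt_of_leftInverse {f₁ f₂ : ℂ × ℂ → ℂ} {g : ℂ × ℂ → ℂ × ℂ} {O : Set (ℂ × ℂ)}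
    (hO : IsOpen O) (h₁ : DifferentiableOn ℂ f₁ O) (h₂ : DifferentiableOn ℂ f₂ O)
    (hg : ∀ w ∈ O, g (f₁ w, f₂ w) = w) {z : ℂ × ℂ} (hz : z ∈ O)
    (hj : dx f₁ z * dy f₂ z - dy f₁ z * dx f₂ z ≠ 0) : DifferentiableAt ℂ g (f₁ z, f₂ z) := by
  have hs : HasStrictFDerivAt (fun w => (f₁ w, f₂ w))
      (lequiv (dx f₁ z) (dy f₁ z) (dx f₂ z) (dy f₂ z) hj : ℂ × ℂ →L[ℂ] ℂ × ℂ) z :=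
    (hasStrictFDerivAt_of_diffOn hO h₁ hz).prodMk (hasStrictFDerivAt_of_diffOn hO h₂ hz)
  exact (hs.to_local_left_inverse (g := g) (by
    filter_upwards [hO.mem_nhds hz] with w hw using hg w hw)).differentiableAt

/-- A polynomial-like Hénon map, normalised so that its second coordinate is `y ^ (e + 1)` up to
terms of lower order in the region where `y` dominates. -/
structure HenonLike where
  H : ℂ × ℂ → ℂ × ℂ
  Hi : ℂ × ℂ → ℂ × ℂ
  e : ℕ
  he : 1 ≤ e
  a : ℂ
  ha : a ≠ 0
  C : ℝ
  R : ℝ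
  hC : 1 ≤ C
  hR : 64 * C ≤ R
  diff : Differentiable ℂ H
  diffi : Differentiable ℂ Hi
  left : ∀ z, Hi (H z) = z
  right : ∀ z, H (Hi z) = z
  jac : ∀ z, dx (fun w => (H w).1) z * dy (fun w => (H w).2) z -
    dy (fun w => (H w).1) z * dx (fun w => (H w).2) z = a
  snd_est : ∀ z, R ≤ ‖z.2‖ → ‖z.1‖ ≤ ‖z.2‖ → ‖(H z).2 - z.2 ^ (e + 1)‖ ≤ C * ‖z.2‖ ^ e
  fst_est : ∀ z, R ≤ ‖z.2‖ → ‖z.1‖ ≤ ‖z.2‖ → ‖(H z).1‖ ≤ C * ‖z.2‖ ^ e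
  growthi : ∃ (n : ℕ) (c : ℝ), ∀ z, ‖Hi z‖ ≤ c * (1 + ‖z‖) ^ n
  K : Set (ℂ × ℂ)
  hK : ∀ R', R ≤ R' → ∀ z, z ∉ K ↔
    ∃ n, R' < ‖(H^[n] z).2‖ ∧ ‖(H^[n] z).1‖ < ‖(H^[n] z).2‖

namespace HenonLike
variable (h : HenonLike)

lemma R_ge : 64 ≤ h.R := by linarith [h.hC, h.hR]

/-- The region where the second coordinate dominates. -/
def V : Set (ℂ × ℂ) := {z | h.R < ‖z.2‖ ∧ ‖z.1‖ < ‖z.2‖}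

lemma isOpen_V : IsOpen h.V :=
  (isOpen_lt continuous_const continuous_snd.norm).inter
    (isOpen_lt continuous_fst.norm continuous_snd.norm)

lemma pow_le_snd {z : ℂ × ℂ} (hz : z ∈ h.V) : 63 * ‖z.2‖ ^ h.e ≤ ‖(h.H z).2‖ := by
  have h1 := h.snd_est z hz.1.le hz.2.le
  have h2 := norm_sub_norm_le (z.2 ^ (h.e + 1)) (z.2 ^ (h.e + 1) - (h.H z).2)
  rw [sub_sub_cancel, norm_sub_rev (z.2 ^ (h.e+1)), norm_pow, pow_succ] at h2
  have h3 := hz.1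
  have h4 : 0 ≤ ‖z.2‖ ^ h.e := by positivity
  nlinarith [h.hC, h.hR]

lemma pow_le_snd' {z : ℂ × ℂ} (hz : z ∈ h.V) : 63 / 64 * ‖z.2‖ ^ (h.e + 1) ≤ ‖(h.H z).2‖ := by
  have h1 := h.snd_est z hz.1.le hz.2.le
  have h2 := norm_sub_norm_le (z.2 ^ (h.e + 1)) (z.2 ^ (h.e + 1) - (h.H z).2)
  rw [sub_sub_cancel, norm_sub_rev (z.2 ^ (h.e+1)), norm_pow, pow_succ] at h2
  have h3 := hz.1
  have h4 : 0 ≤ ‖z.2‖ ^ h.e := by positivity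
  rw [pow_succ]
  nlinarith [h.hC, h.hR]

lemma le_snd {z : ℂ × ℂ} (hz : z ∈ h.V) : 32 * ‖z.2‖ ≤ ‖(h.H z).2‖ := by
  have h1 := h.pow_le_snd hz
  have h2 : ‖z.2‖ ≤ ‖z.2‖ ^ h.e :=
    le_self_pow₀ (by linarith [hz.1, h.R_ge]) (by have := h.he; omega)
  linarith [norm_nonneg z.2]

lemma fst_le {z : ℂ × ℂ} (hz : z ∈ h.V) : 32 * ‖(h.H z).1‖ ≤ ‖(h.H z).2‖ := by
  have h1 := h.pow_le_snd' hz
  have h2 := h.fst_est z hz.1.le hz.2.le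
  have h3 := hz.1
  have h4 : 0 ≤ ‖z.2‖ ^ h.e := by positivity
  rw [pow_succ] at h1
  nlinarith [h.hC, h.hR]

lemma map_V {z : ℂ × ℂ} (hz : z ∈ h.V) : h.H z ∈ h.V := by
  have h1 := h.le_snd hz
  have h2 := h.fst_le hz
  have := hz.1
  have := h.R_ge
  exact ⟨by linarith, by linarith⟩

lemma iter_V {z : ℂ × ℂ} (hz : z ∈ h.V) (n : ℕ) : h.H^[n] z ∈ h.V := by
  induction n with
  | zero => exact hz
  | succ n ih => rw [Function.iterate_succ_apply']; exact h.map_V ih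

lemma iter_snd_ge {z : ℂ × ℂ} (hz : z ∈ h.V) (n : ℕ) : ‖z.2‖ ≤ ‖(h.H^[n] z).2‖ := by
  induction n with
  | zero => rfl
  | succ n ih =>
    rw [Function.iterate_succ_apply']
    have := h.le_snd (h.iter_V hz n)
    linarith [norm_nonneg (h.H^[n] z).2]

/-- The relative deviation of the second coordinate from `y ^ (e + 1)`. -/
def eps (z : ℂ × ℂ) : ℂ := (h.H z).2 / z.2 ^ (h.e + 1) - 1

lemma snd_ne {z : ℂ × ℂ} (hz : z ∈ h.V) : z.2 ≠ 0 :=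
  norm_pos_iff.1 (by linarith [hz.1, h.R_ge])

lemma eps_spec {z : ℂ × ℂ} (hz : z ∈ h.V) : z.2 ^ (h.e + 1) * (1 + h.eps z) = (h.H z).2 := by
  have := pow_ne_zero (h.e + 1) (h.snd_ne hz)
  unfold eps
  field_simp
  ring

lemma norm_eps {z : ℂ × ℂ} (hz : z ∈ h.V) : ‖h.eps z‖ * ‖z.2‖ ≤ h.C := by
  have h1 := h.snd_est z hz.1.le hz.2.le
  have h2 := h.eps_spec hz
  have h3 : 0 < ‖z.2‖ := norm_pos_iff.2 (h.snd_ne hz)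
  have h4 : 0 < ‖z.2‖ ^ h.e := by positivity
  rw [← h2, show z.2 ^ (h.e + 1) * (1 + h.eps z) - z.2 ^ (h.e + 1) = z.2 ^ h.e * (h.eps z * z.2) by
    ring, norm_mul, norm_pow, mul_comm, norm_mul] at h1
  exact le_of_mul_le_mul_right h1 h4

lemma norm_eps_le {z : ℂ × ℂ} (hz : z ∈ h.V) : ‖h.eps z‖ ≤ 1 / 64 := by
  have h1 := h.norm_eps hz
  have h2 := hz.1
  have h3 := h.hR
  have := h.hC
  have : ‖h.eps z‖ * (64 * h.C) ≤ ‖h.eps z‖ * ‖z.2‖ := by gcongr; linarith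
  nlinarith

lemma differentiableOn_eps : DifferentiableOn ℂ h.eps h.V := by
  intro z hz
  have := pow_ne_zero (h.e + 1) (h.snd_ne hz)
  have h1 : DifferentiableAt ℂ h.H z := h.diff z
  have h2 : DifferentiableAt ℂ (fun w : ℂ × ℂ => w.2 ^ (h.e + 1)) z := by fun_prop
  have h3 : DifferentiableAt ℂ (fun w => (h.H w).2) z := h1.snd
  simp only [show h.eps = fun w => (h.H w).2 * (w.2 ^ (h.e + 1))⁻¹ - 1 from
    funext fun w => by rw [eps, div_eq_mul_inv]]
  exact ((h3.mul (h2.inv this)).sub_const 1).differentiableWithinAt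

lemma differentiable_iter (n : ℕ) : Differentiable ℂ (h.H^[n]) := h.diff.iterate n

/-- The general term of the series for the logarithm of the Böttcher coordinate. -/
def term (n : ℕ) (z : ℂ × ℂ) : ℂ :=
  ((h.e + 1 : ℕ) : ℂ)⁻¹ ^ (n + 1) * Complex.log (1 + h.eps (h.H^[n] z))

lemma norm_log_le {z : ℂ × ℂ} (hz : z ∈ h.V) : ‖Complex.log (1 + h.eps z)‖ ≤ 3 / 2 * ‖h.eps z‖ :=
  Complex.norm_log_one_add_half_le_self (by linarith [h.norm_eps_le hz])

lemma norm_term {z : ℂ × ℂ} (hz : z ∈ h.V) (n : ℕ) :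
    ‖h.term n z‖ ≤ (1 / 2 : ℝ) ^ (n + 1) * (3 / 2 * h.C / ‖z.2‖) := by
  unfold term
  rw [norm_mul, norm_pow, norm_inv, Complex.norm_natCast]
  have hd : ((h.e + 1 : ℕ) : ℝ)⁻¹ ≤ 1 / 2 := by
    rw [one_div]
    apply inv_anti₀ two_pos
    have := h.he
    exact_mod_cast (by omega : 2 ≤ h.e + 1)
  have h3 : 0 < ‖z.2‖ := norm_pos_iff.2 (h.snd_ne hz)
  gcongr
  have hn := h.iter_V hz n
  refine (h.norm_log_le hn).trans ?_
  rw [mul_div_assoc]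
  gcongr
  rw [le_div_iff₀ h3]
  exact le_trans (by gcongr; exact h.iter_snd_ge hz n) (h.norm_eps hn)

lemma norm_term' {z : ℂ × ℂ} (hz : z ∈ h.V) (n : ℕ) :
    ‖h.term n z‖ ≤ (1 / 2 : ℝ) ^ (n + 1) := by
  refine (h.norm_term hz n).trans (mul_le_of_le_one_right (by positivity) ?_)
  have h3 : 0 < ‖z.2‖ := norm_pos_iff.2 (h.snd_ne hz)
  rw [div_le_one h3]
  linarith [hz.1, h.hR, h.hC]

lemma summable_half : Summable fun n : ℕ => (1 / 2 : ℝ) ^ (n + 1) :=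
  (summable_nat_add_iff 1).2 summable_geometric_two

lemma tsum_half : ∑' n : ℕ, (1 / 2 : ℝ) ^ (n + 1) = 1 := by
  have := summable_geometric_two.sum_add_tsum_nat_add 1
  rw [tsum_geometric_two] at this
  simp only [Finset.range_one, Finset.sum_singleton, pow_zero] at this
  linarith

lemma differentiableOn_term (n : ℕ) : DifferentiableOn ℂ (h.term n) h.V := by
  intro z hz
  have hn := h.iter_V hz n
  have h1 : DifferentiableAt ℂ h.eps (h.H^[n] z) :=
    (h.differentiableOn_eps _ hn).differentiableAt (h.isOpen_V.mem_nhds hn)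
  have h2 : DifferentiableAt ℂ (fun w => 1 + h.eps (h.H^[n] w)) z :=
    (DifferentiableAt.comp z h1 (h.differentiable_iter n z)).const_add 1
  refine ((h2.clog ?_).const_mul _).differentiableWithinAt
  apply Complex.mem_slitPlane_of_norm_lt_one
  linarith [h.norm_eps_le hn]

/-- The logarithm of the ratio of the Böttcher coordinate and `y`. -/
def S (z : ℂ × ℂ) : ℂ := ∑' n, h.term n z

lemma summable_term {z : ℂ × ℂ} (hz : z ∈ h.V) : Summable fun n => h.term n z :=
  Summable.of_norm_bounded summable_half (h.norm_term' hz)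

lemma continuousOn_S : ContinuousOn h.S h.V :=
  continuousOn_tsum (fun n => (h.differentiableOn_term n).continuousOn) summable_half
    (fun n _ hz => h.norm_term' hz n)

lemma differentiableOn_S : DifferentiableOn ℂ h.S h.V := by
  apply differentiableOn_of_sep h.isOpen_V h.continuousOn_S
  · intro z hz
    have hO : IsOpen ((fun x : ℂ => (x, z.2)) ⁻¹' h.V) := h.isOpen_V.preimage (by fun_prop)
    have := differentiableOn_tsum_of_summable_norm (F := fun n (x : ℂ) => h.term n (x, z.2))
      summable_half (fun n x hx => (differentiableAt_slice_x (z := (x, z.2))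
        ((h.differentiableOn_term n).differentiableAt (h.isOpen_V.mem_nhds hx))).differentiableWithinAt) hO
      (fun n x hx => h.norm_term' hx n)
    exact this.differentiableAt (hO.mem_nhds hz)
  · intro z hz
    have hO : IsOpen ((fun y : ℂ => (z.1, y)) ⁻¹' h.V) := h.isOpen_V.preimage (by fun_prop)
    have := differentiableOn_tsum_of_summable_norm (F := fun n (y : ℂ) => h.term n (z.1, y))
      summable_half (fun n y hy => (differentiableAt_slice_y (z := (z.1, y))
        ((h.differentiableOn_term n).differentiableAt (h.isOpen_V.mem_nhds hy))).differentiableWithinAt) hO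
      (fun n y hy => h.norm_term' hy n)
    exact this.differentiableAt (hO.mem_nhds hz)

lemma norm_S {z : ℂ × ℂ} (hz : z ∈ h.V) : ‖h.S z‖ ≤ 3 / 2 * h.C / ‖z.2‖ := by
  refine tsum_of_norm_bounded (g := fun n : ℕ => (1 / 2 : ℝ) ^ (n + 1) * (3 / 2 * h.C / ‖z.2‖))
    ?_ (h.norm_term hz)
  have := summable_half.hasSum.mul_right (3 / 2 * h.C / ‖z.2‖)
  rwa [tsum_half, one_mul] at this

/-- The Böttcher coordinate. -/
def b (z : ℂ × ℂ) : ℂ := z.2 * Complex.exp (h.S z)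

lemma differentiableOn_b : DifferentiableOn ℂ h.b h.V :=
  differentiable_snd.differentiableOn.mul h.differentiableOn_S.cexp

lemma norm_b_sub {z : ℂ × ℂ} (hz : z ∈ h.V) : ‖h.b z - z.2‖ ≤ 4 * h.C := by
  have h3 : 0 < ‖z.2‖ := norm_pos_iff.2 (h.snd_ne hz)
  have h1 := h.norm_S hz
  have h4 : ‖h.S z‖ ≤ 1 := by
    refine h1.trans ((div_le_one h3).2 ?_)
    linarith [hz.1, h.hR, h.hC]
  have h2 := Complex.norm_exp_sub_one_le h4
  rw [le_div_iff₀ h3] at h1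
  rw [b, show z.2 * cexp (h.S z) - z.2 = z.2 * (cexp (h.S z) - 1) by ring, norm_mul]
  nlinarith [h.hC]

lemma b_H {z : ℂ × ℂ} (hz : z ∈ h.V) : h.b (h.H z) = h.b z ^ (h.e + 1) := by
  have h1 : ((h.e + 1 : ℕ) : ℂ) * h.S z = Complex.log (1 + h.eps z) + h.S (h.H z) := by
    have hd : ((h.e + 1 : ℕ) : ℂ) ≠ 0 := Nat.cast_ne_zero.2 (by omega)
    have := (h.summable_term hz).sum_add_tsum_nat_add 1
    rw [S, ← this, mul_add, S, ← tsum_mul_left]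
    congr 1
    · simp only [Finset.range_one, Finset.sum_singleton, term, Function.iterate_zero, id_eq,
        zero_add, pow_one]
      rw [← mul_assoc, mul_inv_cancel₀ hd, one_mul]
    · refine tsum_congr fun n => ?_
      simp only [term, Function.iterate_succ_apply]
      rw [pow_succ' _ (n + 1), ← mul_assoc, ← mul_assoc, mul_inv_cancel₀ hd, one_mul]
  have h2 : 1 + h.eps z ≠ 0 := fun h0 => by
    have := h.norm_eps_le hz
    rw [show h.eps z = -1 by linear_combination h0] at this
    norm_num at this
  rw [b, b, mul_pow, ← Complex.exp_nat_mul, h1, Complex.exp_add, Complex.exp_log h2, ← mul_assoc,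
    h.eps_spec hz]

end HenonLike

lemma norm_deriv_le_of_ball {f : ℂ → ℂ} {c : ℂ} {r r' M : ℝ} (hr : 0 < r) (hrr : r < r')
    (hf : DifferentiableOn ℂ f (Metric.ball c r')) (hM : ∀ z ∈ Metric.ball c r', ‖f z‖ ≤ M) :
    ‖deriv f c‖ ≤ M / r := by
  refine Complex.norm_deriv_le_of_forall_mem_sphere_norm_le hr ?_ fun z hz => hM z ?_
  · exact (hf.mono (Metric.closedBall_subset_ball hrr)).diffContOnCl_ball subset_rfl
  · exact Metric.closedBall_subset_ball hrr (Metric.sphere_subset_closedBall hz)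

namespace HenonLike
variable (h : HenonLike)

/-- Domain of the inverse of the Böttcher coordinate along vertical lines. -/
def D1 : Set (ℂ × ℂ) := {z | 2 * h.R < ‖z.2‖ ∧ 2 * ‖z.1‖ < ‖z.2‖}

/-- Domain on which the transverse coordinate is integrated. -/
def D2 : Set (ℂ × ℂ) := {z | 4 * h.R < ‖z.2‖ ∧ 4 * ‖z.1‖ < ‖z.2‖}

lemma isOpen_D1 : IsOpen h.D1 :=
  (isOpen_lt continuous_const continuous_snd.norm).inter
    (isOpen_lt (continuous_const.mul continuous_fst.norm) continuous_snd.norm)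

lemma isOpen_D2 : IsOpen h.D2 :=
  (isOpen_lt continuous_const continuous_snd.norm).inter
    (isOpen_lt (continuous_const.mul continuous_fst.norm) continuous_snd.norm)

lemma D2_sub {z : ℂ × ℂ} (hz : z ∈ h.D2) : z ∈ h.D1 := by
  have := h.R_ge
  have := hz.1
  have := hz.2
  exact ⟨by linarith, by linarith [norm_nonneg z.1]⟩

lemma ball_sub_V {z : ℂ × ℂ} (hz : z ∈ h.D1) {y : ℂ}
    (hy : y ∈ Metric.ball z.2 (6 * (4 * h.C))) : (z.1, y) ∈ h.V := by
  have h1 := hz.1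
  have h2 := hz.2
  have h3 := h.hR
  have := h.hC
  rw [Metric.mem_ball, dist_eq_norm] at hy
  have h4 : ‖z.2‖ ≤ ‖y‖ + ‖y - z.2‖ := by
    rw [norm_sub_rev]; exact norm_le_norm_add_norm_sub' _ _
  constructor
  · show h.R < ‖y‖
    linarith
  · show ‖z.1‖ < ‖y‖
    linarith

lemma w_diff {z : ℂ × ℂ} (hz : z ∈ h.D1) :
    DifferentiableOn ℂ (fun y => h.b (z.1, y) - y) (Metric.ball z.2 (6 * (4 * h.C))) := by
  intro y hy
  have := differentiableAt_slice_y (h.differentiableOn_b.differentiableAt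
    (h.isOpen_V.mem_nhds (h.ball_sub_V hz hy)))
  exact (this.sub differentiableAt_id).differentiableWithinAt

lemma exists_Y (z : ℂ × ℂ) : ∃ y, z ∈ h.D1 → y ∈ Metric.closedBall z.2 (4 * h.C) ∧
    h.b (z.1, y) = z.2 := by
  by_cases hz : z ∈ h.D1
  · obtain ⟨s, hs, e⟩ := exists_solve (by linarith [h.hC]) (h.w_diff hz)
      (fun y hy => h.norm_b_sub (h.ball_sub_V hz hy))
    exact ⟨s, fun _ => ⟨hs, by linear_combination e⟩⟩
  · exact ⟨0, fun h' => absurd h' hz⟩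

/-- The solution `y` of `b (x, y) = ζ`. -/
def Y (z : ℂ × ℂ) : ℂ := (h.exists_Y z).choose

lemma norm_Y_sub {z : ℂ × ℂ} (hz : z ∈ h.D1) : ‖h.Y z - z.2‖ ≤ 4 * h.C := by
  have := ((h.exists_Y z).choose_spec hz).1
  rwa [Metric.mem_closedBall, dist_eq_norm] at this

lemma b_Y {z : ℂ × ℂ} (hz : z ∈ h.D1) : h.b (z.1, h.Y z) = z.2 :=
  ((h.exists_Y z).choose_spec hz).2

lemma Y_mem_ball {z : ℂ × ℂ} (hz : z ∈ h.D1) : h.Y z ∈ Metric.ball z.2 (6 * (4 * h.C)) := by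
  rw [Metric.mem_ball, dist_eq_norm]
  linarith [h.norm_Y_sub hz, h.hC]

lemma Y_mem_V {z : ℂ × ℂ} (hz : z ∈ h.D1) : (z.1, h.Y z) ∈ h.V :=
  h.ball_sub_V hz (h.Y_mem_ball hz)

lemma Y_b {z : ℂ × ℂ} (hz : z ∈ h.V) (hb : (z.1, h.b z) ∈ h.D1) : h.Y (z.1, h.b z) = z.2 := by
  have h1 := h.norm_Y_sub hb
  have h2 := h.b_Y hb
  have h3 := h.norm_b_sub hz
  refine solve_unique (by linarith [h.hC]) (h.w_diff hb)
    (fun y hy => h.norm_b_sub (h.ball_sub_V hb hy)) (τ := h.b z) (M := 4 * h.C)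
    (by rwa [Metric.mem_closedBall, dist_eq_norm])
    (by rwa [Metric.mem_closedBall, dist_comm, dist_eq_norm]) ?_
  simp only at h2 ⊢
  rw [h2]
  ring

lemma norm_dy_b {z : ℂ × ℂ} (hz : z ∈ h.D1) : ‖dy h.b (z.1, h.Y z) - 1‖ ≤ 1 / 4 := by
  have hC := h.hC
  have hsub : Metric.ball (h.Y z) (20 * h.C) ⊆ Metric.ball z.2 (6 * (4 * h.C)) := by
    apply Metric.ball_subset_ball'
    rw [dist_eq_norm]
    linarith [h.norm_Y_sub hz]
  have h1 := norm_deriv_le_of_ball (r := 16 * h.C) (r' := 20 * h.C) (by linarith) (by linarith)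
    ((h.w_diff hz).mono hsub) (fun y hy => h.norm_b_sub (h.ball_sub_V hz (hsub hy)))
  have h2 := (hasDerivAt_dy (h.differentiableOn_b.differentiableAt
    (h.isOpen_V.mem_nhds (h.Y_mem_V hz)))).sub (hasDerivAt_id (h.Y z))
  have h3 : deriv (fun y => h.b (z.1, y) - y) (h.Y z) = dy h.b (z.1, h.Y z) - 1 := h2.deriv
  rw [h3] at h1
  refine h1.trans (le_of_eq ?_)
  field_simp
  norm_num

lemma dy_b_ne {z : ℂ × ℂ} (hz : z ∈ h.D1) : dy h.b (z.1, h.Y z) ≠ 0 := fun h0 => by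
  have := h.norm_dy_b hz
  rw [h0] at this
  norm_num at this

lemma differentiableOn_Y : DifferentiableOn ℂ h.Y h.D1 := by
  intro z hz
  have hO : IsOpen (h.V ∩ (fun w : ℂ × ℂ => (w.1, h.b w)) ⁻¹' h.D1) :=
    ContinuousOn.isOpen_inter_preimage (continuousOn_fst.prodMk h.differentiableOn_b.continuousOn)
      h.isOpen_V h.isOpen_D1
  have hzO : (z.1, h.Y z) ∈ h.V ∩ (fun w : ℂ × ℂ => (w.1, h.b w)) ⁻¹' h.D1 :=
    ⟨h.Y_mem_V hz, by show (z.1, h.b (z.1, h.Y z)) ∈ h.D1; rwa [h.b_Y hz]⟩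
  have key := differentiableAt_of_leftInverse (f₁ := Prod.fst) (f₂ := h.b)
    (g := fun w => (w.1, h.Y w)) hO differentiableOn_fst (h.differentiableOn_b.mono inter_subset_left)
    (fun w hw => Prod.ext rfl (h.Y_b hw.1 hw.2)) hzO (by
      have h1 : dx Prod.fst (z.1, h.Y z) = 1 := by simp [dx]
      have h2 : dy Prod.fst (z.1, h.Y z) = 0 := by simp [dy]
      rw [h1, h2, one_mul, zero_mul, sub_zero]
      exact h.dy_b_ne hz)
  simp only [h.b_Y hz] at key
  exact key.snd.differentiableWithinAt

/-- The density of the transverse coordinate. -/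
def g (z : ℂ × ℂ) : ℂ := z.2 * dy h.Y z

lemma differentiableOn_g : DifferentiableOn ℂ h.g h.D1 :=
  differentiableOn_snd.mul (differentiableOn_dy h.isOpen_D1 h.differentiableOn_Y)

lemma norm_g_sub {z : ℂ × ℂ} (hz : z ∈ h.D2) : ‖h.g z - z.2‖ ≤ 16 * h.C := by
  have hC := h.hC
  have hR := h.hR
  have h1 := hz.1
  have h2 := hz.2
  have hsub : ∀ y ∈ Metric.ball z.2 (‖z.2‖ / 3), (z.1, y) ∈ h.D1 := fun y hy => by
    rw [Metric.mem_ball, dist_eq_norm] at hy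
    have h4 : ‖z.2‖ ≤ ‖y‖ + ‖y - z.2‖ := by
      rw [norm_sub_rev]; exact norm_le_norm_add_norm_sub' _ _
    refine ⟨?_, ?_⟩
    · show _ < ‖y‖
      linarith
    · show 2 * ‖z.1‖ < ‖y‖
      linarith
  have hz1 := h.D2_sub hz
  have h3 := norm_deriv_le_of_ball (f := fun y => h.Y (z.1, y) - y) (r := ‖z.2‖ / 4)
    (r' := ‖z.2‖ / 3) (by linarith) (by linarith)
    (fun y hy => ((differentiableAt_slice_y (h.differentiableOn_Y.differentiableAt
      (h.isOpen_D1.mem_nhds (hsub y hy)))).sub differentiableAt_id).differentiableWithinAt)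
    (fun y hy => h.norm_Y_sub (hsub y hy))
  have h4 : deriv (fun y => h.Y (z.1, y) - y) z.2 = dy h.Y z - 1 :=
    ((hasDerivAt_dy (h.differentiableOn_Y.differentiableAt (h.isOpen_D1.mem_nhds hz1))).sub
      (hasDerivAt_id z.2)).deriv
  rw [h4, le_div_iff₀ (by linarith)] at h3
  rw [g, show z.2 * dy h.Y z - z.2 = z.2 * (dy h.Y z - 1) by ring, norm_mul]
  linarith

/-- Truncation of the real line to the unit interval. -/
def clamp (r : ℝ) : ℝ := max 0 (min 1 r)

lemma continuous_clamp : Continuous clamp := by unfold clamp; fun_prop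
lemma clamp_nonneg (r : ℝ) : 0 ≤ clamp r := le_max_left _ _
lemma clamp_le (r : ℝ) : clamp r ≤ 1 := max_le zero_le_one (min_le_left _ _)
lemma clamp_eq {r : ℝ} (h0 : 0 ≤ r) (h1 : r ≤ 1) : clamp r = r := by
  rw [clamp, min_eq_right h1, max_eq_right h0]

/-- The transverse coordinate, as a function of `x` and the Böttcher coordinate. -/
def thetaHat (z : ℂ × ℂ) : ℂ := ∫ r in (0 : ℝ)..1, z.1 * h.g ((clamp r : ℂ) * z.1, z.2)

lemma norm_smul_le (x : ℂ) (r : ℝ) : ‖(clamp r : ℂ) * x‖ ≤ ‖x‖ := by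
  rw [norm_mul, Complex.norm_real, Real.norm_of_nonneg (clamp_nonneg r)]
  exact mul_le_of_le_one_left (norm_nonneg _) (clamp_le r)

lemma smul_mem_D2 {z : ℂ × ℂ} (hz : z ∈ h.D2) {x : ℂ} (hx : ‖x‖ ≤ ‖z.1‖) :
    (x, z.2) ∈ h.D2 := by
  refine ⟨hz.1, ?_⟩
  have := hz.2
  show 4 * ‖x‖ < ‖z.2‖
  linarith

lemma g_cont : ContinuousOn h.g h.D2 :=
  h.differentiableOn_g.continuousOn.mono fun _ hz => h.D2_sub hz

lemma thetaHat_cont : ContinuousOn h.thetaHat h.D2 := by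
  apply continuousOn_integral_param
    (k := fun (z : ℂ × ℂ) (r : ℝ) => z.1 * h.g ((clamp r : ℂ) * z.1, z.2))
  have hc : Continuous clamp := continuous_clamp
  refine ContinuousOn.mul (by fun_prop) (h.g_cont.comp (f := fun p : (ℂ × ℂ) × ℝ =>
    ((clamp p.2 : ℂ) * p.1.1, p.1.2)) (by fun_prop) ?_)
  rintro ⟨z, r⟩ hz
  exact h.smul_mem_D2 hz.1 (norm_smul_le _ _)

lemma hasDerivAt_thetaHat {z : ℂ × ℂ} (hz : z ∈ h.D2) :
    HasDerivAt (fun x => h.thetaHat (x, z.2)) (h.g z) z.1 := by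
  have hR := h.R_ge
  have hm : ∀ x ∈ Metric.ball (0 : ℂ) (‖z.2‖ / 4), (x, z.2) ∈ h.D2 := fun x hx => by
    rw [Metric.mem_ball, dist_zero_right] at hx
    exact ⟨hz.1, by show 4 * ‖x‖ < ‖z.2‖; linarith⟩
  obtain ⟨G, hG⟩ := DifferentiableOn.isExactOn_ball (f := fun x => h.g (x, z.2)) (c := 0)
    (r := ‖z.2‖ / 4) (fun x hx => (differentiableAt_slice_x (h.differentiableOn_g.differentiableAt
      (h.isOpen_D1.mem_nhds (h.D2_sub (hm x hx))))).differentiableWithinAt)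
  have hz0 : z.1 ∈ Metric.ball (0 : ℂ) (‖z.2‖ / 4) := by
    rw [Metric.mem_ball, dist_zero_right]; linarith [hz.2]
  have hin : ∀ x ∈ Metric.ball (0 : ℂ) (‖z.2‖ / 4), ∀ r : ℝ,
      (clamp r : ℂ) * x ∈ Metric.ball (0 : ℂ) (‖z.2‖ / 4) := fun x hx r => by
    rw [Metric.mem_ball, dist_zero_right] at hx ⊢
    exact (norm_smul_le x r).trans_lt hx
  have heq : ∀ x ∈ Metric.ball (0 : ℂ) (‖z.2‖ / 4), h.thetaHat (x, z.2) = G x - G 0 := by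
    intro x hx
    have hd : ∀ r ∈ Set.uIcc (0 : ℝ) 1, HasDerivAt (fun r : ℝ => G ((r : ℂ) * x))
        (x * h.g ((clamp r : ℂ) * x, z.2)) r := fun r hr => by
      rw [Set.uIcc_of_le zero_le_one] at hr
      have hin' := hin x hx r
      rw [clamp_eq hr.1 hr.2] at hin' ⊢
      have h1 : HasDerivAt (fun r : ℂ => r * x) x (r : ℂ) := by
        simpa using (hasDerivAt_id (r : ℂ)).mul_const x
      have h2 := (HasDerivAt.comp (r : ℂ) (h := fun r : ℂ => r * x) (hG _ hin') h1).comp_ofReal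
      rw [mul_comm] at h2
      exact h2
    have hi := intervalIntegral.integral_eq_sub_of_hasDerivAt hd (by
      apply Continuous.intervalIntegrable
      have hc : Continuous clamp := continuous_clamp
      refine continuous_const.mul (h.g_cont.comp_continuous (by fun_prop) fun r =>
        hm _ (hin x hx r)))
    show (∫ r in (0 : ℝ)..1, x * h.g ((clamp r : ℂ) * x, z.2)) = _
    rw [hi]
    simp
  have := (hG z.1 hz0).sub_const (G 0)
  refine this.congr_of_eventuallyEq ?_
  filter_upwards [Metric.isOpen_ball.mem_nhds hz0] with x hx using heq x hx

lemma differentiableOn_thetaHat : DifferentiableOn ℂ h.thetaHat h.D2 := by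
  refine differentiableOn_of_sep h.isOpen_D2 h.thetaHat_cont
    (fun z hz => (h.hasDerivAt_thetaHat hz).differentiableAt) fun z hz => ?_
  have hc : Continuous clamp := continuous_clamp
  have hU : IsOpen ((fun y : ℂ => (z.1, y)) ⁻¹' h.D2) := h.isOpen_D2.preimage (by fun_prop)
  refine differentiableAt_integral_param
    (k := fun y r => z.1 * h.g ((clamp r : ℂ) * z.1, y)) hU ?_ ?_ 0 1 hz
  · refine ContinuousOn.mul (by fun_prop) (h.g_cont.comp (f := fun p : ℂ × ℝ =>
      ((clamp p.2 : ℂ) * z.1, p.1)) (by fun_prop) ?_)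
    rintro ⟨y, r⟩ hy
    exact h.smul_mem_D2 hy.1 (norm_smul_le _ _)
  · intro r y hy
    have := differentiableAt_slice_y (h.differentiableOn_g.differentiableAt
      (h.isOpen_D1.mem_nhds (h.D2_sub (h.smul_mem_D2 hy (norm_smul_le z.1 r)))))
    exact (this.const_mul _).differentiableWithinAt

lemma norm_thetaHat_sub {z : ℂ × ℂ} (hz : z ∈ h.D2) :
    ‖h.thetaHat z - z.1 * z.2‖ ≤ 16 * h.C * ‖z.1‖ := by
  have hc : Continuous clamp := continuous_clamp
  have h1 : z.1 * z.2 = ∫ r in (0 : ℝ)..1, z.1 * z.2 := by simp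
  rw [h1, thetaHat, ← intervalIntegral.integral_sub]
  · refine (intervalIntegral.norm_integral_le_of_norm_le_const (C := 16 * h.C * ‖z.1‖)
      fun r _ => ?_).trans (by simp)
    rw [← mul_sub, norm_mul, mul_comm]
    gcongr
    exact h.norm_g_sub (h.smul_mem_D2 hz (norm_smul_le z.1 r))
  · exact (continuous_const.mul (h.g_cont.comp_continuous (by fun_prop) fun r =>
      h.smul_mem_D2 hz (norm_smul_le z.1 r))).intervalIntegrable _ _
  · exact continuous_const.intervalIntegrable _ _

lemma norm_thetaHat {z : ℂ × ℂ} (hz : z ∈ h.D2) : ‖h.thetaHat z‖ ≤ 2 * ‖z.2‖ * ‖z.1‖ := by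
  have h1 := h.norm_thetaHat_sub hz
  have h2 := norm_le_norm_add_norm_sub' (h.thetaHat z) (z.1 * z.2)
  rw [norm_mul] at h2
  have h3 : 16 * h.C * ‖z.1‖ ≤ ‖z.2‖ * ‖z.1‖ := by
    gcongr
    linarith [hz.1, h.hR, h.hC]
  nlinarith

end HenonLike

lemma hasDerivAt_comp_pair {f : ℂ × ℂ → ℂ} {u v : ℂ → ℂ} {u' v' t : ℂ} {O : Set (ℂ × ℂ)}
    (hO : IsOpen O) (hf : DifferentiableOn ℂ f O) (hm : (u t, v t) ∈ O)
    (hu : HasDerivAt u u' t) (hv : HasDerivAt v v' t) :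
    HasDerivAt (fun s => f (u s, v s)) (dx f (u t, v t) * u' + dy f (u t, v t) * v') t := by
  have h1 := (hasStrictFDerivAt_of_diffOn hO hf hm).hasFDerivAt
  have h2 := HasFDerivAt.comp_hasDerivAt (f := fun s => (u s, v s)) t h1 (hu.prodMk hv)
  exact h2.congr_deriv (lform_apply _ _ _)

namespace HenonLike
variable (h : HenonLike)

/-- The domain of the transverse coordinate in `ℂ²`. -/
def V2 : Set (ℂ × ℂ) := {z | z ∈ h.V ∧ (z.1, h.b z) ∈ h.D2}

lemma isOpen_V2 : IsOpen h.V2 :=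
  ContinuousOn.isOpen_inter_preimage (continuousOn_fst.prodMk h.differentiableOn_b.continuousOn)
    h.isOpen_V h.isOpen_D2

/-- The transverse coordinate. -/
def theta (z : ℂ × ℂ) : ℂ := h.thetaHat (z.1, h.b z)

lemma differentiableOn_theta : DifferentiableOn ℂ h.theta h.V2 := by
  intro z hz
  have h1 : DifferentiableAt ℂ (fun w : ℂ × ℂ => (w.1, h.b w)) z :=
    differentiableAt_fst.prodMk (h.differentiableOn_b.differentiableAt (h.isOpen_V.mem_nhds hz.1))
  exact (DifferentiableAt.comp z (h.differentiableOn_thetaHat.differentiableAt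
    (h.isOpen_D2.mem_nhds hz.2)) h1).differentiableWithinAt

lemma norm_theta {z : ℂ × ℂ} (hz : z ∈ h.V2) : ‖h.theta z‖ ≤ 2 * ‖h.b z‖ * ‖z.1‖ :=
  h.norm_thetaHat hz.2

lemma norm_snd_le {z : ℂ × ℂ} (hz : z ∈ h.V) : ‖z.2‖ ≤ ‖h.b z‖ + 4 * h.C := by
  have h1 := h.norm_b_sub hz
  have h2 := norm_le_norm_add_norm_sub (h.b z) z.2
  linarith

lemma norm_b_le {z : ℂ × ℂ} (hz : z ∈ h.V) : ‖h.b z‖ ≤ ‖z.2‖ + 4 * h.C := by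
  have h1 := h.norm_b_sub hz
  have h2 := norm_le_norm_add_norm_sub' (h.b z) z.2
  linarith

lemma map_V2 {z : ℂ × ℂ} (hz : z ∈ h.V) : h.H z ∈ h.V2 := by
  have h0 := h.map_V hz
  refine ⟨h0, ?_⟩
  have h1 := h.le_snd hz
  have h2 := h.fst_le hz
  have h3 := h.norm_snd_le h0
  have := hz.1
  have := h.R_ge
  have := h.hC
  have := h.hR
  refine ⟨?_, ?_⟩
  · show 4 * h.R < ‖h.b (h.H z)‖
    linarith
  · show 4 * ‖(h.H z).1‖ < ‖h.b (h.H z)‖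
    linarith

lemma Y_mem_V2 {z : ℂ × ℂ} (hz : z ∈ h.D2) : (z.1, h.Y z) ∈ h.V2 :=
  ⟨h.Y_mem_V (h.D2_sub hz), by
    show (z.1, h.b (z.1, h.Y z)) ∈ h.D2
    rwa [h.b_Y (h.D2_sub hz)]⟩

lemma map_Y {z : ℂ × ℂ} (hz : z ∈ h.D2) :
    h.Y ((h.H (z.1, h.Y z)).1, z.2 ^ (h.e + 1)) = (h.H (z.1, h.Y z)).2 ∧
      ((h.H (z.1, h.Y z)).1, z.2 ^ (h.e + 1)) ∈ h.D2 := by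
  have hV := h.Y_mem_V (h.D2_sub hz)
  have h2 := h.map_V2 hV
  have hb : h.b (h.H (z.1, h.Y z)) = z.2 ^ (h.e + 1) := by rw [h.b_H hV, h.b_Y (h.D2_sub hz)]
  have h3 := h.Y_b h2.1 (h.D2_sub h2.2)
  rw [hb] at h3
  have h4 := h2.2
  rw [hb] at h4
  exact ⟨h3, h4⟩

/-- The multiplier of the transverse coordinate. -/
def lam : ℂ := ((h.e + 1 : ℕ) : ℂ) / h.a

lemma lam_ne : h.lam ≠ 0 := div_ne_zero (Nat.cast_ne_zero.2 (by omega)) h.ha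

lemma hasDerivAt_map_theta {z : ℂ × ℂ} (hz : z ∈ h.D2) :
    HasDerivAt (fun x => h.lam * h.thetaHat ((h.H (x, h.Y (x, z.2))).1, z.2 ^ (h.e + 1)))
      (h.g z) z.1 := by
  set A : ℂ × ℂ → ℂ := fun w => (h.H w).1 with hA
  set B : ℂ × ℂ → ℂ := fun w => (h.H w).2 with hB
  have hAd : DifferentiableOn ℂ A univ := (h.diff.fst).differentiableOn
  have hBd : DifferentiableOn ℂ B univ := (h.diff.snd).differentiableOn
  have hYd := h.differentiableOn_Y.differentiableAt (h.isOpen_D1.mem_nhds (h.D2_sub hz))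
  have hY1 := hasDerivAt_dx hYd
  have hY2 := hasDerivAt_dy hYd
  set w : ℂ × ℂ := (z.1, h.Y z) with hw
  have hm := h.map_Y hz
  have hAx : HasDerivAt (fun x => A (x, h.Y (x, z.2))) (dx A w + dy A w * dx h.Y z) z.1 := by
    have := hasDerivAt_comp_pair isOpen_univ hAd (mem_univ _) (hasDerivAt_id z.1) hY1
    simpa using this
  have hBx : HasDerivAt (fun x => B (x, h.Y (x, z.2))) (dx B w + dy B w * dx h.Y z) z.1 := by
    have := hasDerivAt_comp_pair isOpen_univ hBd (mem_univ _) (hasDerivAt_id z.1) hY1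
    simpa using this
  have hAy : HasDerivAt (fun y => A (z.1, h.Y (z.1, y))) (dy A w * dy h.Y z) z.2 := by
    have := hasDerivAt_comp_pair isOpen_univ hAd (mem_univ _) (hasDerivAt_const z.2 z.1) hY2
    simpa using this
  have hBy : HasDerivAt (fun y => B (z.1, h.Y (z.1, y))) (dy B w * dy h.Y z) z.2 := by
    have := hasDerivAt_comp_pair isOpen_univ hBd (mem_univ _) (hasDerivAt_const z.2 z.1) hY2
    simpa using this
  have hm1 : (A w, z.2 ^ (h.e + 1)) ∈ h.D1 := h.D2_sub hm.2
  set w' : ℂ × ℂ := (A w, z.2 ^ (h.e + 1)) with hw'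
  have hpow : HasDerivAt (fun y : ℂ => y ^ (h.e + 1)) (((h.e + 1 : ℕ) : ℂ) * z.2 ^ h.e) z.2 := by
    simpa using hasDerivAt_pow (h.e + 1) z.2
  have e1 : dx h.Y w' * (dx A w + dy A w * dx h.Y z) = dx B w + dy B w * dx h.Y z := by
    have := hasDerivAt_comp_pair h.isOpen_D1 h.differentiableOn_Y hm1 hAx
      (hasDerivAt_const z.1 (z.2 ^ (h.e + 1)))
    rw [mul_zero, add_zero] at this
    refine (this.congr_of_eventuallyEq ?_).unique hBx
    have hO : IsOpen ((fun x : ℂ => (x, z.2)) ⁻¹' h.D2) := h.isOpen_D2.preimage (by fun_prop)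
    filter_upwards [hO.mem_nhds hz] with x hx
    exact (h.map_Y (z := (x, z.2)) hx).1.symm
  have e2 : dx h.Y w' * (dy A w * dy h.Y z) + dy h.Y w' * (((h.e + 1 : ℕ) : ℂ) * z.2 ^ h.e) =
      dy B w * dy h.Y z := by
    have := hasDerivAt_comp_pair h.isOpen_D1 h.differentiableOn_Y hm1 hAy hpow
    refine (this.congr_of_eventuallyEq ?_).unique hBy
    have hO : IsOpen ((fun y : ℂ => (z.1, y)) ⁻¹' h.D2) := h.isOpen_D2.preimage (by fun_prop)
    filter_upwards [hO.mem_nhds hz] with y hy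
    exact (h.map_Y (z := (z.1, y)) hy).1.symm
  have hth := (h.hasDerivAt_thetaHat hm.2)
  have h1 := (HasDerivAt.comp z.1 (h := fun x => A (x, h.Y (x, z.2))) hth hAx).const_mul h.lam
  refine h1.congr_deriv ?_
  have hj := h.jac w
  have ha := h.ha
  change h.lam * (z.2 ^ (h.e + 1) * dy h.Y w' * (dx A w + dy A w * dx h.Y z)) = z.2 * dy h.Y z
  change dx A w * dy B w - dy A w * dx B w = h.a at hj
  rw [lam, div_mul_eq_mul_div, div_eq_iff ha, pow_succ, ← hj]
  linear_combination (z.2 * (dx A w + dy A w * dx h.Y z)) * e2 - z.2 * (dy A w * dy h.Y z) * e1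

/-- The cocycle of the transverse coordinate. -/
def Q (ζ : ℂ) : ℂ := h.lam * h.theta (h.H (0, h.Y (0, ζ)))

lemma theta_map_aux {z : ℂ × ℂ} (hz : z ∈ h.D2) :
    h.lam * h.thetaHat ((h.H (z.1, h.Y z)).1, z.2 ^ (h.e + 1)) = h.thetaHat z + h.Q z.2 := by
  have hR := h.R_ge
  have h4 := hz.1
  have hm : ∀ x ∈ Metric.ball (0 : ℂ) (‖z.2‖ / 4), (x, z.2) ∈ h.D2 := fun x hx => by
    rw [Metric.mem_ball, dist_zero_right] at hx
    exact ⟨hz.1, by show 4 * ‖x‖ < ‖z.2‖; linarith⟩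
  have hz0 : z.1 ∈ Metric.ball (0 : ℂ) (‖z.2‖ / 4) := by
    rw [Metric.mem_ball, dist_zero_right]; linarith [hz.2]
  have h0 : (0 : ℂ) ∈ Metric.ball (0 : ℂ) (‖z.2‖ / 4) := Metric.mem_ball_self (by linarith)
  have hd : ∀ x ∈ Metric.ball (0 : ℂ) (‖z.2‖ / 4), HasDerivAt (fun x =>
      h.lam * h.thetaHat ((h.H (x, h.Y (x, z.2))).1, z.2 ^ (h.e + 1)) - h.thetaHat (x, z.2)) 0 x :=
    fun x hx => by
      have := (h.hasDerivAt_map_theta (hm x hx)).sub (h.hasDerivAt_thetaHat (hm x hx))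
      rwa [sub_self] at this
  have := Metric.isOpen_ball.is_const_of_deriv_eq_zero
    (convex_ball (0 : ℂ) (‖z.2‖ / 4)).isPreconnected
    (fun x hx => (hd x hx).differentiableAt.differentiableWithinAt)
    (fun x hx => (hd x hx).deriv) hz0 h0
  have hth0 : h.thetaHat (0, z.2) = 0 := by simp [thetaHat]
  have hb : h.b (h.H (0, h.Y (0, z.2))) = z.2 ^ (h.e + 1) := by
    have h01 := h.D2_sub (hm 0 h0)
    rw [h.b_H (h.Y_mem_V h01), h.b_Y h01]
  rw [Q, theta, hb]
  simp only [hth0] at this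
  linear_combination this

lemma theta_map {z : ℂ × ℂ} (hz : z ∈ h.V2) :
    h.lam * h.theta (h.H z) = h.theta z + h.Q (h.b z) := by
  have := h.theta_map_aux hz.2
  rw [h.Y_b hz.1 (h.D2_sub hz.2)] at this
  rw [theta, h.b_H hz.1]
  exact this

lemma zero_mem_D2 {ζ : ℂ} (hζ : 4 * h.R < ‖ζ‖) : ((0 : ℂ), ζ) ∈ h.D2 :=
  ⟨hζ, by show 4 * ‖(0 : ℂ)‖ < ‖ζ‖; rw [norm_zero]; linarith [h.R_ge]⟩

lemma differentiableOn_Q : DifferentiableOn ℂ h.Q {ζ | 4 * h.R < ‖ζ‖} := by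
  intro ζ hζ
  have h0 := h.zero_mem_D2 hζ
  have h1 : DifferentiableAt ℂ (fun y => h.Y (0, y)) ζ :=
    differentiableAt_slice_y (z := (0, ζ)) (h.differentiableOn_Y.differentiableAt
      (h.isOpen_D1.mem_nhds (h.D2_sub h0)))
  have h2 : DifferentiableAt ℂ (fun y => ((0 : ℂ), h.Y (0, y))) ζ :=
    (differentiableAt_const _).prodMk h1
  have h3 : DifferentiableAt ℂ h.theta (h.H (0, h.Y (0, ζ))) :=
    h.differentiableOn_theta.differentiableAt
      (h.isOpen_V2.mem_nhds (h.map_V2 (h.Y_mem_V (h.D2_sub h0))))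
  have h4 : DifferentiableAt ℂ (fun y => h.H ((0 : ℂ), h.Y (0, y))) ζ :=
    DifferentiableAt.comp ζ (h.diff _) h2
  exact ((DifferentiableAt.comp ζ h3 h4).const_mul _).differentiableWithinAt

lemma norm_Q {ζ : ℂ} (hζ : 4 * h.R < ‖ζ‖) :
    ‖h.Q ζ‖ ≤ (‖h.lam‖ * (2 * h.C * 2 ^ h.e)) * ‖ζ‖ ^ (2 * h.e + 1) := by
  have h0 := h.D2_sub (h.zero_mem_D2 hζ)
  have hV := h.Y_mem_V h0
  have h1 := h.norm_theta (h.map_V2 hV)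
  rw [h.b_H hV, h.b_Y h0, norm_pow] at h1
  have h2 := h.fst_est _ hV.1.le hV.2.le
  have h3 : ‖h.Y (0, ζ)‖ ≤ 2 * ‖ζ‖ := by
    have h3 := h.norm_Y_sub h0
    have h4 := norm_le_norm_add_norm_sub' (h.Y (0, ζ)) ζ
    simp only at h3
    linarith [h.hR, h.R_ge]
  have h4 : ‖h.Y (0, ζ)‖ ^ h.e ≤ (2 * ‖ζ‖) ^ h.e := by gcongr
  have hC := h.hC
  rw [Q, norm_mul, mul_assoc]
  gcongr
  calc _ ≤ 2 * ‖ζ‖ ^ (h.e + 1) * (h.C * (2 * ‖ζ‖) ^ h.e) := by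
        refine h1.trans ?_
        gcongr
        exact h2.trans (by gcongr)
    _ = _ := by rw [mul_pow]; ring

/-- The constant in the bound for `Q`. -/
def CQ : ℝ := ‖h.lam‖ * (2 * h.C * 2 ^ h.e)

lemma CQ_nonneg : 0 ≤ h.CQ := by
  have := h.hC
  unfold CQ
  positivity

/-- Domain of the inverse chart. -/
def D3 : Set (ℂ × ℂ) := {u | 4 * h.R < ‖u.2‖ ∧ 16 * ‖u.1‖ < ‖u.2‖ ^ 2}

lemma isOpen_D3 : IsOpen h.D3 :=
  (isOpen_lt continuous_const continuous_snd.norm).inter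
    (isOpen_lt (continuous_const.mul continuous_fst.norm) (continuous_snd.norm.pow 2))

lemma D3_ne {u : ℂ × ℂ} (hu : u ∈ h.D3) : u.2 ≠ 0 :=
  norm_pos_iff.1 (by linarith [hu.1, h.R_ge])

lemma D3_div {u : ℂ × ℂ} (hu : u ∈ h.D3) : ‖u.1 / u.2‖ < ‖u.2‖ / 16 := by
  have := norm_pos_iff.2 (h.D3_ne hu)
  rw [norm_div, div_lt_iff₀ this]
  linarith [hu.2]

lemma ball_sub_D2 {u : ℂ × ℂ} (hu : u ∈ h.D3) {x : ℂ}
    (hx : x ∈ Metric.ball (u.1 / u.2) (6 * (4 * h.C))) : (x, u.2) ∈ h.D2 := by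
  have h1 := h.D3_div hu
  rw [Metric.mem_ball, dist_eq_norm] at hx
  have h2 := norm_le_norm_add_norm_sub' x (u.1 / u.2)
  refine ⟨hu.1, ?_⟩
  show 4 * ‖x‖ < ‖u.2‖
  linarith [hu.1, h.hR, h.R_ge]

lemma w2_bound {x ζ : ℂ} (hx : (x, ζ) ∈ h.D2) : ‖h.thetaHat (x, ζ) / ζ - x‖ ≤ 4 * h.C := by
  have h0 : 0 < ‖ζ‖ := by
    have := hx.1
    simp only at this
    linarith [h.R_ge]
  have h1 := h.norm_thetaHat_sub hx
  have h2 := hx.2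
  simp only at h1 h2
  rw [show h.thetaHat (x, ζ) / ζ - x = (h.thetaHat (x, ζ) - x * ζ) / ζ by
    have := norm_pos_iff.1 h0
    field_simp, norm_div, div_le_iff₀ h0]
  nlinarith [h.hC]

lemma w2_diff {u : ℂ × ℂ} (hu : u ∈ h.D3) :
    DifferentiableOn ℂ (fun x => h.thetaHat (x, u.2) / u.2 - x)
      (Metric.ball (u.1 / u.2) (6 * (4 * h.C))) := by
  intro x hx
  have := differentiableAt_slice_x (h.differentiableOn_thetaHat.differentiableAt
    (h.isOpen_D2.mem_nhds (h.ball_sub_D2 hu hx)))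
  exact ((this.div_const _).sub differentiableAt_id).differentiableWithinAt

lemma exists_X (u : ℂ × ℂ) : ∃ x, u ∈ h.D3 → x ∈ Metric.closedBall (u.1 / u.2) (4 * h.C) ∧
    h.thetaHat (x, u.2) = u.1 := by
  by_cases hu : u ∈ h.D3
  · obtain ⟨s, hs, e⟩ := exists_solve (by linarith [h.hC]) (h.w2_diff hu)
      (fun x hx => h.w2_bound (h.ball_sub_D2 hu hx))
    have := h.D3_ne hu
    refine ⟨s, fun _ => ⟨hs, ?_⟩⟩
    rw [add_sub_cancel, div_left_inj' this] at e
    exact e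
  · exact ⟨0, fun h' => absurd h' hu⟩

/-- The solution `x` of `θ̂ (x, ζ) = t`. -/
def X (u : ℂ × ℂ) : ℂ := (h.exists_X u).choose

lemma norm_X_sub {u : ℂ × ℂ} (hu : u ∈ h.D3) : ‖h.X u - u.1 / u.2‖ ≤ 4 * h.C := by
  have := ((h.exists_X u).choose_spec hu).1
  rwa [Metric.mem_closedBall, dist_eq_norm] at this

lemma thetaHat_X {u : ℂ × ℂ} (hu : u ∈ h.D3) : h.thetaHat (h.X u, u.2) = u.1 :=
  ((h.exists_X u).choose_spec hu).2

lemma X_mem {u : ℂ × ℂ} (hu : u ∈ h.D3) : (h.X u, u.2) ∈ h.D2 := by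
  refine h.ball_sub_D2 hu ?_
  rw [Metric.mem_ball, dist_eq_norm]
  linarith [h.norm_X_sub hu, h.hC]

lemma X_thetaHat {z : ℂ × ℂ} (hz : z ∈ h.D2) (hu : (h.thetaHat z, z.2) ∈ h.D3) :
    h.X (h.thetaHat z, z.2) = z.1 := by
  have h1 := h.norm_X_sub hu
  have h2 := h.thetaHat_X hu
  have h3 := h.w2_bound (x := z.1) hz
  simp only at h1 h2
  have h4 : h.X (h.thetaHat z, z.2) ∈ Metric.closedBall (h.thetaHat z / z.2) (4 * h.C) := by
    rwa [Metric.mem_closedBall, dist_eq_norm]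
  have h5 : z.1 ∈ Metric.closedBall (h.thetaHat z / z.2) (4 * h.C) := by
    rwa [Metric.mem_closedBall, dist_comm, dist_eq_norm]
  have h6 := fun x hx => h.w2_bound (h.ball_sub_D2 hu (x := x) hx)
  refine solve_unique (by linarith [h.hC]) (h.w2_diff hu) h6 h4 h5 ?_
  rw [add_sub_cancel, add_sub_cancel, h2]

lemma g_ne {z : ℂ × ℂ} (hz : z ∈ h.D2) : h.g z ≠ 0 := fun h0 => by
  have := h.norm_g_sub hz
  rw [h0, zero_sub, norm_neg] at this
  linarith [hz.1, h.hR, h.R_ge]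

lemma differentiableOn_X : DifferentiableOn ℂ h.X h.D3 := by
  intro u hu
  have hO : IsOpen (h.D2 ∩ (fun w : ℂ × ℂ => (h.thetaHat w, w.2)) ⁻¹' h.D3) :=
    ContinuousOn.isOpen_inter_preimage (h.thetaHat_cont.prodMk continuousOn_snd)
      h.isOpen_D2 h.isOpen_D3
  have hm : (h.X u, u.2) ∈ h.D2 ∩ (fun w : ℂ × ℂ => (h.thetaHat w, w.2)) ⁻¹' h.D3 :=
    ⟨h.X_mem hu, by show (h.thetaHat (h.X u, u.2), u.2) ∈ h.D3; rwa [h.thetaHat_X hu]⟩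
  have key := differentiableAt_of_leftInverse (f₁ := h.thetaHat) (f₂ := Prod.snd)
    (g := fun w => (h.X w, w.2)) hO (h.differentiableOn_thetaHat.mono inter_subset_left)
    differentiableOn_snd
    (fun w hw => Prod.ext (h.X_thetaHat hw.1 hw.2) rfl) hm (by
      have h1 : dx Prod.snd (h.X u, u.2) = 0 := by simp [dx]
      have h2 : dy Prod.snd (h.X u, u.2) = 1 := by simp [dy]
      have h3 : dx h.thetaHat (h.X u, u.2) = h.g (h.X u, u.2) :=
        (h.hasDerivAt_thetaHat (h.X_mem hu)).deriv
      rw [h1, h2, h3, mul_one, mul_zero, sub_zero]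
      exact h.g_ne (h.X_mem hu))
  simp only [h.thetaHat_X hu] at key
  exact key.fst.differentiableWithinAt

/-- The inverse of the chart `(θ, b)`. -/
def Lam (u : ℂ × ℂ) : ℂ × ℂ := (h.X u, h.Y (h.X u, u.2))

lemma Lam_mem {u : ℂ × ℂ} (hu : u ∈ h.D3) : h.Lam u ∈ h.V2 := h.Y_mem_V2 (h.X_mem hu)

lemma b_Lam {u : ℂ × ℂ} (hu : u ∈ h.D3) : h.b (h.Lam u) = u.2 := h.b_Y (h.D2_sub (h.X_mem hu))

lemma theta_Lam {u : ℂ × ℂ} (hu : u ∈ h.D3) : h.theta (h.Lam u) = u.1 := by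
  rw [theta, h.b_Lam hu]
  exact h.thetaHat_X hu

lemma Lam_theta {z : ℂ × ℂ} (hz : z ∈ h.V2) (hu : (h.theta z, h.b z) ∈ h.D3) :
    h.Lam (h.theta z, h.b z) = z := by
  have h1 : h.X (h.theta z, h.b z) = z.1 := h.X_thetaHat hz.2 hu
  rw [Lam, h1]
  exact Prod.ext rfl (h.Y_b hz.1 (h.D2_sub hz.2))

lemma differentiableOn_Lam : DifferentiableOn ℂ h.Lam h.D3 := by
  intro u hu
  have h1 := h.differentiableOn_X.differentiableAt (h.isOpen_D3.mem_nhds hu)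
  have h2 : DifferentiableAt ℂ (fun w : ℂ × ℂ => (h.X w, w.2)) u := h1.prodMk differentiableAt_snd
  have h3 := DifferentiableAt.comp u (f := fun w : ℂ × ℂ => (h.X w, w.2))
    (h.differentiableOn_Y.differentiableAt (h.isOpen_D1.mem_nhds (h.D2_sub (h.X_mem hu)))) h2
  exact (h1.prodMk h3).differentiableWithinAt

lemma norm_Lam_fst {u : ℂ × ℂ} (hu : u ∈ h.D3) : ‖(h.Lam u).1‖ ≤ ‖u.2‖ := by
  have := (h.X_mem hu).2
  simp only at this
  show ‖h.X u‖ ≤ _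
  linarith [norm_nonneg (h.X u)]

lemma norm_Lam_snd {u : ℂ × ℂ} (hu : u ∈ h.D3) : ‖(h.Lam u).2 - u.2‖ ≤ 4 * h.C :=
  h.norm_Y_sub (h.D2_sub (h.X_mem hu))

end HenonLike

namespace HenonLike
variable (h : HenonLike)

/-- Growth constant of the induced map on the chart. -/
def kap : ℝ := (1 + h.CQ) / ‖h.lam‖

lemma lam_pos : 0 < ‖h.lam‖ := norm_pos_iff.2 h.lam_ne

lemma kap_pos : 0 < h.kap := div_pos (by linarith [h.CQ_nonneg]) h.lam_pos

/-- Threshold for the Böttcher coordinate. -/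
def rho : ℝ := 32 * h.kap + 6 * h.R + 1

lemma rho_gt : 6 * h.R < h.rho := by unfold rho; linarith [h.kap_pos]
lemma rho_gt' : 32 * h.kap < h.rho := by unfold rho; linarith [h.R_ge]
lemma one_lt_rho : 1 < h.rho := by linarith [h.rho_gt, h.R_ge]

/-- The half-space of parameters. -/
def P : Set (ℂ × ℂ) := {u | h.rho < ‖u.2‖}

/-- The forward invariant domain of the chart. -/
def W : Set (ℂ × ℂ) := {u | h.rho < ‖u.2‖ ∧ 32 * ‖u.1‖ < ‖u.2‖ ^ 2}

/-- A forward invariant cone absorbing all escaping orbits. -/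
def U : Set (ℂ × ℂ) := {z | h.rho + h.R < ‖z.2‖ ∧ 128 * ‖z.1‖ < ‖z.2‖}

lemma isOpen_P : IsOpen h.P := isOpen_lt continuous_const continuous_snd.norm

lemma isOpen_W : IsOpen h.W :=
  (isOpen_lt continuous_const continuous_snd.norm).inter
    (isOpen_lt (continuous_const.mul continuous_fst.norm) (continuous_snd.norm.pow 2))

lemma isOpen_U : IsOpen h.U :=
  (isOpen_lt continuous_const continuous_snd.norm).inter
    (isOpen_lt (continuous_const.mul continuous_fst.norm) continuous_snd.norm)

lemma W_sub_D3 {u : ℂ × ℂ} (hu : u ∈ h.W) : u ∈ h.D3 :=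
  ⟨by linarith [hu.1, h.rho_gt, h.R_ge], by linarith [hu.2, norm_nonneg u.1]⟩

lemma U_sub_V {z : ℂ × ℂ} (hz : z ∈ h.U) : z ∈ h.V :=
  ⟨by linarith [hz.1, h.one_lt_rho], by linarith [hz.2, norm_nonneg z.1]⟩

lemma rho_lt_b {z : ℂ × ℂ} (hz : z ∈ h.U) : h.rho < ‖h.b z‖ := by
  have := h.norm_snd_le (h.U_sub_V hz)
  linarith [hz.1, h.hR, h.R_ge]

lemma U_sub_V2 {z : ℂ × ℂ} (hz : z ∈ h.U) : z ∈ h.V2 := by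
  have h0 := h.rho_lt_b hz
  have h1 := h.norm_snd_le (h.U_sub_V hz)
  refine ⟨h.U_sub_V hz, ?_, ?_⟩
  · show 4 * h.R < ‖h.b z‖
    linarith [h.rho_gt, h.R_ge]
  · show 4 * ‖z.1‖ < ‖h.b z‖
    linarith [hz.2, hz.1, h.hR, h.R_ge, h.rho_gt, norm_nonneg z.1]

/-- The chart. -/
def chart (z : ℂ × ℂ) : ℂ × ℂ := (h.theta z, h.b z)

lemma chart_mem_W {z : ℂ × ℂ} (hz : z ∈ h.U) : h.chart z ∈ h.W := by
  have h0 := h.rho_lt_b hz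
  have h1 := h.norm_snd_le (h.U_sub_V hz)
  have h2 := h.norm_theta (h.U_sub_V2 hz)
  refine ⟨h0, ?_⟩
  show 32 * ‖h.theta z‖ < ‖h.b z‖ ^ 2
  have h3 : 64 * ‖z.1‖ < ‖h.b z‖ := by
    linarith [hz.2, hz.1, h.hR, h.R_ge, h.rho_gt, norm_nonneg z.1]
  have h4 : 0 < ‖h.b z‖ := by linarith [h.one_lt_rho]
  nlinarith

lemma Lam_chart {z : ℂ × ℂ} (hz : z ∈ h.U) : h.Lam (h.chart z) = z :=
  h.Lam_theta (h.U_sub_V2 hz) (h.W_sub_D3 (h.chart_mem_W hz))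

lemma map_mem_U {z : ℂ × ℂ} (hz : z ∈ h.V) (hy : h.rho ≤ 2 * ‖z.2‖) : h.H z ∈ h.U := by
  have h1 := h.le_snd hz
  have h2 := h.pow_le_snd' hz
  have h3 := h.fst_est z hz.1.le hz.2.le
  refine ⟨?_, ?_⟩
  · linarith [h.rho_gt, h.one_lt_rho]
  · have h4 : 0 < ‖z.2‖ ^ h.e := pow_pos (norm_pos_iff.2 (h.snd_ne hz)) _
    rw [pow_succ] at h2
    have h5 : 192 * h.C ≤ ‖z.2‖ := by linarith [h.rho_gt, h.hR]
    nlinarith [h.hC]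

lemma map_U {z : ℂ × ℂ} (hz : z ∈ h.U) : h.H z ∈ h.U :=
  h.map_mem_U (h.U_sub_V hz) (by linarith [hz.1, h.R_ge, h.one_lt_rho])

lemma iter_U {z : ℂ × ℂ} (hz : z ∈ h.U) (n : ℕ) : h.H^[n] z ∈ h.U := by
  induction n with
  | zero => exact hz
  | succ n ih => rw [Function.iterate_succ_apply']; exact h.map_U ih

lemma not_mem_K_iff {z : ℂ × ℂ} : z ∉ h.K ↔ ∃ n, h.H^[n] z ∈ h.U := by
  constructor
  · intro hz
    obtain ⟨n, h1, h2⟩ := (h.hK (h.rho + h.R) (by linarith [h.one_lt_rho]) z).1 hz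
    refine ⟨n + 1, ?_⟩
    rw [Function.iterate_succ_apply']
    exact h.map_mem_U ⟨by linarith [h.one_lt_rho], h2⟩
      (by linarith [h.one_lt_rho, norm_nonneg (h.H^[n] z).2, h.R_ge])
  · rintro ⟨n, hn⟩
    exact (h.hK h.R le_rfl z).2 ⟨n, h.U_sub_V hn⟩

/-- The map induced on the chart. -/
def hat (u : ℂ × ℂ) : ℂ × ℂ := (h.lam⁻¹ * (u.1 + h.Q u.2), u.2 ^ (h.e + 1))

lemma chart_H {z : ℂ × ℂ} (hz : z ∈ h.V2) : h.chart (h.H z) = h.hat (h.chart z) := by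
  have h1 := h.theta_map hz
  refine Prod.ext ?_ (h.b_H hz.1)
  show h.theta (h.H z) = h.lam⁻¹ * (h.theta z + h.Q (h.b z))
  rw [← h1, inv_mul_cancel_left₀ h.lam_ne]

lemma hat_P {u : ℂ × ℂ} (hu : u ∈ h.P) : h.hat u ∈ h.P := by
  have hu : h.rho < ‖u.2‖ := hu
  show h.rho < ‖u.2 ^ (h.e + 1)‖
  rw [norm_pow]
  exact hu.trans_le (le_self_pow₀ (by linarith [h.one_lt_rho]) (by omega))

lemma hat_iter_P {u : ℂ × ℂ} (hu : u ∈ h.P) (n : ℕ) : h.hat^[n] u ∈ h.P := by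
  induction n with
  | zero => exact hu
  | succ n ih => rw [Function.iterate_succ_apply']; exact h.hat_P ih

lemma norm_hat_fst {u : ℂ × ℂ} (hu : u ∈ h.P) {k : ℕ} (hk : 2 * h.e + 1 ≤ k)
    (ht : ‖u.1‖ ≤ ‖u.2‖ ^ k) : ‖(h.hat u).1‖ ≤ h.kap * ‖u.2‖ ^ k := by
  have hu : h.rho < ‖u.2‖ := hu
  have h1 := h.norm_Q (ζ := u.2) (by linarith [h.rho_gt, h.R_ge])
  have h2 : ‖u.2‖ ^ (2 * h.e + 1) ≤ ‖u.2‖ ^ k :=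
    pow_le_pow_right₀ (by linarith [h.one_lt_rho]) hk
  change ‖h.Q u.2‖ ≤ h.CQ * _ at h1
  show ‖h.lam⁻¹ * (u.1 + h.Q u.2)‖ ≤ _
  rw [norm_mul, norm_inv, kap, div_mul_eq_mul_div, le_div_iff₀ h.lam_pos, mul_comm, ← mul_assoc,
    mul_inv_cancel₀ h.lam_pos.ne', one_mul]
  refine (norm_add_le _ _).trans ?_
  nlinarith [h.CQ_nonneg]

lemma hat_mem_W {u : ℂ × ℂ} (hu : u ∈ h.P) (ht : ‖u.1‖ ≤ ‖u.2‖ ^ 2) : h.hat u ∈ h.W := by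
  refine ⟨h.hat_P hu, ?_⟩
  have hu' : h.rho < ‖u.2‖ := hu
  have h1 : 1 ≤ ‖u.2‖ := by linarith [h.one_lt_rho]
  have he := h.he
  have h2 := h.norm_hat_fst hu le_rfl
    (ht.trans (pow_le_pow_right₀ h1 (by omega : 2 ≤ 2 * h.e + 1)))
  show _ < ‖u.2 ^ (h.e + 1)‖ ^ 2
  rw [norm_pow, ← pow_mul, show (h.e + 1) * 2 = 2 * h.e + 1 + 1 by ring, pow_succ]
  have h3 : 0 < ‖u.2‖ ^ (2 * h.e + 1) := by positivity
  nlinarith [h.rho_gt']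

lemma hat_W {u : ℂ × ℂ} (hu : u ∈ h.W) : h.hat u ∈ h.W :=
  h.hat_mem_W hu.1 (by linarith [hu.2, norm_nonneg u.1])

lemma hat_iter_W {u : ℂ × ℂ} (hu : u ∈ h.W) (n : ℕ) : h.hat^[n] u ∈ h.W := by
  induction n with
  | zero => exact hu
  | succ n ih => rw [Function.iterate_succ_apply']; exact h.hat_W ih

lemma hat_iter_W_of_le {u : ℂ × ℂ} {m n : ℕ} (hmn : m ≤ n) (hu : h.hat^[m] u ∈ h.W) :
    h.hat^[n] u ∈ h.W := by
  obtain ⟨k, rfl⟩ := Nat.exists_eq_add_of_le' hmn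
  rw [Function.iterate_add_apply]
  exact h.hat_iter_W hu k

lemma hat_iter_mem_W (n : ℕ) {u : ℂ × ℂ} (hu : u ∈ h.P) (ht : ‖u.1‖ ≤ ‖u.2‖ ^ (n + 2)) :
    h.hat^[n + 1] u ∈ h.W := by
  induction n generalizing u with
  | zero => exact h.hat_mem_W hu ht
  | succ n ih =>
    rw [Function.iterate_succ_apply]
    refine ih (h.hat_P hu) ?_
    have hu' : h.rho < ‖u.2‖ := hu
    have h1 : 1 ≤ ‖u.2‖ := by linarith [h.one_lt_rho]
    have he := h.he
    have h2 := h.norm_hat_fst hu (k := (h.e + 1) * (n + 2) - 1) (by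
      have : (h.e + 1) * 2 ≤ (h.e + 1) * (n + 2) := Nat.mul_le_mul_left _ (by omega)
      omega) (ht.trans (pow_le_pow_right₀ h1 (by
        have : 2 * (n + 2) ≤ (h.e + 1) * (n + 2) := Nat.mul_le_mul_right _ (by omega)
        omega)))
    show _ ≤ ‖u.2 ^ (h.e + 1)‖ ^ (n + 2)
    rw [norm_pow, ← pow_mul]
    refine h2.trans ?_
    have h4 : (h.e + 1) * (n + 2) = (h.e + 1) * (n + 2) - 1 + 1 := by
      have : 0 < (h.e + 1) * (n + 2) := by positivity
      omega
    conv_rhs => rw [h4, pow_succ']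
    gcongr
    linarith [h.rho_gt', h.kap_pos]

lemma exists_hat_iter {u : ℂ × ℂ} (hu : u ∈ h.P) : ∃ n, h.hat^[n] u ∈ h.W := by
  have hu' : h.rho < ‖u.2‖ := hu
  have h1 : 1 < ‖u.2‖ := by linarith [h.one_lt_rho]
  obtain ⟨n, hn⟩ := pow_unbounded_of_one_lt ‖u.1‖ h1
  exact ⟨n + 1, h.hat_iter_mem_W n hu (hn.le.trans (pow_le_pow_right₀ h1.le (by omega)))⟩

lemma H_Lam {u : ℂ × ℂ} (hu : u ∈ h.W) : h.H (h.Lam u) = h.Lam (h.hat u) := by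
  have h1 := h.Lam_mem (h.W_sub_D3 hu)
  have h2 := h.map_V2 h1.1
  have h3 : h.chart (h.Lam u) = u := Prod.ext (h.theta_Lam (h.W_sub_D3 hu)) (h.b_Lam (h.W_sub_D3 hu))
  have h4 := h.chart_H h1
  rw [h3] at h4
  have h5 := h.Lam_theta h2
  change h.chart _ ∈ h.D3 → h.Lam (h.chart _) = _ at h5
  rw [h4] at h5
  exact (h5 (h.W_sub_D3 (h.hat_W hu))).symm

lemma chart_Lam {u : ℂ × ℂ} (hu : u ∈ h.W) : h.chart (h.Lam u) = u :=
  Prod.ext (h.theta_Lam (h.W_sub_D3 hu)) (h.b_Lam (h.W_sub_D3 hu))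

lemma Lam_mem_U {u : ℂ × ℂ} (hu : u ∈ h.W) : h.Lam (h.hat u) ∈ h.U := by
  rw [← h.H_Lam hu]
  refine h.map_mem_U (h.Lam_mem (h.W_sub_D3 hu)).1 ?_
  have h1 := h.norm_Lam_snd (h.W_sub_D3 hu)
  have h2 := norm_le_norm_add_norm_sub (h.Lam u).2 u.2
  linarith [hu.1, h.rho_gt, h.hR, h.hC]

lemma H_iter_Lam {u : ℂ × ℂ} (hu : u ∈ h.W) (n : ℕ) :
    h.H^[n] (h.Lam u) = h.Lam (h.hat^[n] u) := by
  induction n with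
  | zero => rfl
  | succ n ih => rw [Function.iterate_succ_apply', Function.iterate_succ_apply', ih,
      h.H_Lam (h.hat_iter_W hu n)]

lemma Hi_iter_H_iter (n : ℕ) (z : ℂ × ℂ) : h.Hi^[n] (h.H^[n] z) = z :=
  Function.LeftInverse.iterate h.left n z

lemma H_iter_Hi_iter (n : ℕ) (z : ℂ × ℂ) : h.H^[n] (h.Hi^[n] z) = z :=
  Function.LeftInverse.iterate h.right n z

lemma H_iter_inj (n : ℕ) {z w : ℂ × ℂ} (hzw : h.H^[n] z = h.H^[n] w) : z = w := by
  rw [← h.Hi_iter_H_iter n z, hzw, h.Hi_iter_H_iter]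

open Classical in
/-- The uniformisation of the escaping set. -/
def E (u : ℂ × ℂ) : ℂ × ℂ :=
  if hu : u ∈ h.P then
    h.Hi^[(h.exists_hat_iter hu).choose] (h.Lam (h.hat^[(h.exists_hat_iter hu).choose] u))
  else 0

lemma H_iter_E_aux {u : ℂ × ℂ} (hu : u ∈ h.P) :
    ∃ n, h.hat^[n] u ∈ h.W ∧ h.H^[n] (h.E u) = h.Lam (h.hat^[n] u) := by
  refine ⟨_, (h.exists_hat_iter hu).choose_spec, ?_⟩
  rw [E, dif_pos hu, h.H_iter_Hi_iter]

lemma H_iter_E {u : ℂ × ℂ} (hu : u ∈ h.P) {m : ℕ} (hm : h.hat^[m] u ∈ h.W) :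
    h.H^[m] (h.E u) = h.Lam (h.hat^[m] u) := by
  obtain ⟨n, hn, e⟩ := h.H_iter_E_aux hu
  have h1 : h.H^[n] (h.H^[m] (h.E u)) = h.H^[n] (h.Lam (h.hat^[m] u)) := by
    rw [h.H_iter_Lam hm, ← Function.iterate_add_apply, ← Function.iterate_add_apply, add_comm,
      Function.iterate_add_apply, e, h.H_iter_Lam hn, ← Function.iterate_add_apply]
  exact h.H_iter_inj n h1

lemma E_eq {u : ℂ × ℂ} (hu : u ∈ h.P) {m : ℕ} (hm : h.hat^[m] u ∈ h.W) :
    h.E u = h.Hi^[m] (h.Lam (h.hat^[m] u)) := by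
  rw [← h.H_iter_E hu hm, h.Hi_iter_H_iter]

lemma E_spec {u : ℂ × ℂ} (hu : u ∈ h.P) : ∃ N, ∀ n, N ≤ n → h.hat^[n] u ∈ h.W ∧
    h.H^[n] (h.E u) ∈ h.U ∧ h.chart (h.H^[n] (h.E u)) = h.hat^[n] u := by
  obtain ⟨N, hN⟩ := h.exists_hat_iter hu
  refine ⟨N + 1, fun n hn => ?_⟩
  obtain ⟨k, rfl⟩ := Nat.exists_eq_add_of_le' hn
  have h1 : h.hat^[k + N] u ∈ h.W := h.hat_iter_W_of_le (by omega) hN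
  have h2 : h.hat^[k + (N + 1)] u ∈ h.W := h.hat_iter_W_of_le (by omega) hN
  refine ⟨h2, ?_, ?_⟩
  · rw [h.H_iter_E hu h2, ← add_assoc, Function.iterate_succ_apply']
    exact h.Lam_mem_U h1
  · rw [h.H_iter_E hu h2, h.chart_Lam h2]

lemma E_chart {z : ℂ × ℂ} (hz : z ∈ h.U) : h.E (h.chart z) = z := by
  have hw := h.chart_mem_W hz
  rw [h.E_eq (m := 0) hw.1 hw]
  exact h.Lam_chart hz

lemma E_hat {u : ℂ × ℂ} (hu : u ∈ h.P) : h.E (h.hat u) = h.H (h.E u) := by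
  obtain ⟨n, hn⟩ := h.exists_hat_iter hu
  have h1 : h.hat^[n + 1] u ∈ h.W := h.hat_iter_W_of_le (by omega) hn
  have h2 := h.H_iter_E hu h1
  rw [Function.iterate_succ_apply] at h1 h2
  rw [Function.iterate_succ_apply, ← h.H_iter_E (h.hat_P hu) h1] at h2
  exact (h.H_iter_inj n h2).symm

lemma E_hat_iter {u : ℂ × ℂ} (hu : u ∈ h.P) (n : ℕ) : h.E (h.hat^[n] u) = h.H^[n] (h.E u) := by
  induction n with
  | zero => rfl
  | succ n ih => rw [Function.iterate_succ_apply', h.E_hat (h.hat_iter_P hu n), ih,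
      Function.iterate_succ_apply']

lemma E_not_mem_K {u : ℂ × ℂ} (hu : u ∈ h.P) : h.E u ∉ h.K := by
  obtain ⟨N, hN⟩ := h.E_spec hu
  exact h.not_mem_K_iff.2 ⟨N, (hN N le_rfl).2.1⟩

lemma E_eq_of_hat_eq {u u' : ℂ × ℂ} (hu : u ∈ h.P) (hu' : u' ∈ h.P) {n : ℕ}
    (e : h.hat^[n] u = h.hat^[n] u') : h.E u = h.E u' := by
  apply h.H_iter_inj n
  rw [← h.E_hat_iter hu, ← h.E_hat_iter hu', e]

lemma hat_eq_of_E_eq {u u' : ℂ × ℂ} (hu : u ∈ h.P) (hu' : u' ∈ h.P) (e : h.E u = h.E u') :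
    ∃ N, ∀ n, N ≤ n → h.hat^[n] u = h.hat^[n] u' := by
  obtain ⟨N, hN⟩ := h.E_spec hu
  obtain ⟨N', hN'⟩ := h.E_spec hu'
  refine ⟨max N N', fun n hn => ?_⟩
  rw [← (hN n (le_of_max_le_left hn)).2.2, e, (hN' n (le_of_max_le_right hn)).2.2]

lemma E_eq_of_chart {u q : ℂ × ℂ} (hu : u ∈ h.P) {n : ℕ} (hq : h.H^[n] q ∈ h.U)
    (e : h.chart (h.H^[n] q) = h.hat^[n] u) : h.E u = q := by
  apply h.H_iter_inj n
  rw [← h.E_hat_iter hu, ← e, h.E_chart hq]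

lemma differentiableOn_hat : DifferentiableOn ℂ h.hat h.P := by
  intro u hu
  have hu' : h.rho < ‖u.2‖ := hu
  have h1 : DifferentiableAt ℂ h.Q u.2 := h.differentiableOn_Q.differentiableAt
    ((isOpen_lt continuous_const continuous_norm).mem_nhds (by
      show 4 * h.R < _
      linarith [h.rho_gt, h.R_ge]))
  have h2 : DifferentiableAt ℂ (fun w : ℂ × ℂ => h.Q w.2) u :=
    DifferentiableAt.comp (g := h.Q) u h1 differentiableAt_snd
  have h3 : DifferentiableAt ℂ (fun w : ℂ × ℂ => w.2 ^ (h.e + 1)) u := by fun_prop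
  exact (((differentiableAt_fst.add h2).const_mul _).prodMk h3).differentiableWithinAt

lemma differentiableOn_hat_iter (n : ℕ) : DifferentiableOn ℂ (h.hat^[n]) h.P :=
  h.differentiableOn_hat.iterate (fun _ hu => h.hat_P hu) n

lemma differentiableOn_E : DifferentiableOn ℂ h.E h.P := by
  intro u hu
  obtain ⟨n, hn⟩ := h.exists_hat_iter hu
  have h1 := (h.differentiableOn_hat_iter n).differentiableAt (h.isOpen_P.mem_nhds hu)
  have h2 := (h.differentiableOn_Lam.differentiableAt
    (h.isOpen_D3.mem_nhds (h.W_sub_D3 hn)))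
  have h3 : DifferentiableAt ℂ (fun w => h.Hi^[n] (h.Lam (h.hat^[n] w))) u :=
    DifferentiableAt.comp u (h.diffi.iterate n _) (DifferentiableAt.comp u h2 h1)
  refine (h3.congr_of_eventuallyEq ?_).differentiableWithinAt
  filter_upwards [h.isOpen_P.mem_nhds hu, h1.continuousAt.preimage_mem_nhds (h.isOpen_W.mem_nhds hn)]
    with w hw hw' using h.E_eq hw hw'

/-- The iterated cocycle. -/
def Qn (n : ℕ) (ζ : ℂ) : ℂ := ∑ i ∈ Finset.range n, h.lam ^ i * h.Q (ζ ^ (h.e + 1) ^ i)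

lemma hat_iter (n : ℕ) (u : ℂ × ℂ) :
    h.hat^[n] u = ((h.lam ^ n)⁻¹ * (u.1 + h.Qn n u.2), u.2 ^ (h.e + 1) ^ n) := by
  induction n with
  | zero => simp [Qn]
  | succ n ih =>
    have := h.lam_ne
    rw [Function.iterate_succ_apply', ih, hat]
    refine Prod.ext ?_ ?_
    · simp only [Qn, Finset.sum_range_succ]
      field_simp
      ring
    · simp only
      rw [← pow_mul, pow_succ]

lemma chart_H_iter {z : ℂ × ℂ} (hz : z ∈ h.U) (n : ℕ) :
    h.chart (h.H^[n] z) = h.hat^[n] (h.chart z) := by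
  induction n with
  | zero => rfl
  | succ n ih => rw [Function.iterate_succ_apply', Function.iterate_succ_apply',
      h.chart_H (h.U_sub_V2 (h.iter_U hz n)), ih]

lemma norm_Lam {u : ℂ × ℂ} (hu : u ∈ h.W) : ‖h.Lam u‖ ≤ 2 * ‖u.2‖ := by
  have h1 := h.norm_Lam_fst (h.W_sub_D3 hu)
  have h2 := h.norm_Lam_snd (h.W_sub_D3 hu)
  have h3 := norm_le_norm_add_norm_sub' (h.Lam u).2 u.2
  have h4 := hu.1
  rw [Prod.norm_def]
  refine max_le (by linarith [norm_nonneg u.2]) ?_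
  linarith [h.rho_gt, h.hR, h.R_ge]

end HenonLike

lemma eventually_one_of_norm_one {E : Type*} [NormedAddCommGroup E] [NormedSpace ℂ E] {f : E → ℂ}
    {c : E} (hd : ∀ᶠ z in 𝓝 c, DifferentiableAt ℂ f z) (h1 : ∀ᶠ z in 𝓝 c, ‖f z‖ = ‖f c‖) :
    ∀ᶠ z in 𝓝 c, f z = f c :=
  Complex.eventually_eq_of_isLocalMax_norm hd (h1.mono fun _ h => h.le)

lemma root_extension {X : Type*} [TopologicalSpace X] {Ω : Set X} (hΩ : IsPreconnected Ω)
    {O : ℕ → Set X} {F : ℕ → X → ℂ} {d : ℕ}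
    (hO : ∀ N, ∀ s ∈ O N, ∀ᶠ s' in 𝓝 s, s' ∈ O N ∧ F N s' = F N s)
    (hm : ∀ N, ∀ s ∈ O N, s ∈ O (N + 1) ∧ F (N + 1) s = F N s ^ d)
    (hc : ∀ s ∈ Ω, ∃ N, s ∈ O N) {s₀ : X} (hs₀ : s₀ ∈ Ω) {N₀ : ℕ} (h₀ : s₀ ∈ O N₀)
    (h₁ : F N₀ s₀ = 1) {s : X} (hs : s ∈ Ω) : ∃ N, s ∈ O N ∧ F N s = 1 := by
  have hmono : ∀ N N' : ℕ, N ≤ N' → ∀ s ∈ O N, s ∈ O N' := fun N N' hNN => by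
    induction hNN with
    | refl => exact fun s hs => hs
    | step _ ih => exact fun s hs => (hm _ s (ih s hs)).1
  have hone : ∀ N N' : ℕ, N ≤ N' → ∀ s ∈ O N, F N s = 1 → F N' s = 1 := fun N N' hNN => by
    induction hNN with
    | refl => exact fun s _ h => h
    | step hl ih =>
        intro s hs h
        rw [(hm _ s (hmono _ _ hl s hs)).2, ih s hs h, one_pow]
  set A : Set X := {s | ∃ N, s ∈ O N ∧ F N s = 1} with hA
  have hAo : IsOpen A := isOpen_iff_mem_nhds.2 fun s ⟨N, hN, e⟩ => by
    filter_upwards [hO N s hN] with s' hs'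
    exact ⟨N, hs'.1, hs'.2.trans e⟩
  refine hΩ.subset_of_closure_inter_subset hAo ⟨s₀, hs₀, N₀, h₀, h₁⟩ ?_ hs
  rintro s ⟨hcl, hsΩ⟩
  obtain ⟨N, hN⟩ := hc s hsΩ
  have hev : ∀ N' : ℕ, N ≤ N' → ∀ᶠ s' in 𝓝 s, F N' s' = F N' s := fun N' h =>
    (hO N' s (hmono N N' h s hN)).mono fun _ h => h.2
  obtain ⟨B, hB, hBo, hsB⟩ := mem_nhds_iff.1 (hO N s hN)
  have hB' : ∀ N' : ℕ, N ≤ N' → ∀ s' ∈ B, F N' s' = F N' s := fun N' h => by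
    induction h with
    | refl => exact fun s' hs' => (hB hs').2
    | step hl ih =>
        intro s' hs'
        rw [(hm _ s' (hmono _ _ hl s' (hB hs').1)).2, (hm _ s (hmono _ _ hl s hN)).2, ih s' hs']
  obtain ⟨s', hs'B, N', hN', e'⟩ := mem_closure_iff.1 hcl B hBo hsB
  refine ⟨max N N', hmono _ _ (le_max_left _ _) s hN, ?_⟩
  rw [← hB' _ (le_max_left _ _) s' hs'B]
  exact hone _ _ (le_max_right _ _) s' hN' e'

namespace HenonLike

section
variable (h k : HenonLike) (ψ : ℂ × ℂ → ℂ × ℂ)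

/-- Half-space of logarithmic parameters. -/
def Om : Set (ℂ × ℂ) := {p | Real.log h.rho < p.2.re}

lemma isOpen_Om : IsOpen h.Om :=
  isOpen_lt continuous_const (continuous_re.comp continuous_snd)

lemma mem_P_iff {p : ℂ × ℂ} : (p.1, cexp p.2) ∈ h.P ↔ p ∈ h.Om := by
  show h.rho < ‖cexp p.2‖ ↔ _
  rw [Complex.norm_exp, ← Real.log_lt_iff_lt_exp (by linarith [h.one_lt_rho])]
  rfl

/-- The orbit of the image of a point of the uniformisation. -/
def orb (N : ℕ) (p : ℂ × ℂ) : ℂ × ℂ := k.H^[N] (ψ (h.E (p.1, cexp p.2)))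

/-- Parameters whose image has reached the absorbing cone at time `N`. -/
def ON (N : ℕ) : Set (ℂ × ℂ) := {p | p ∈ h.Om ∧ h.orb k ψ N p ∈ k.U}

/-- The Böttcher coordinate at time `N`. -/
def fN (N : ℕ) (p : ℂ × ℂ) : ℂ := k.b (h.orb k ψ N p)

variable {h k ψ} (hψ : Differentiable ℂ ψ) (hK : ∀ z, z ∉ h.K → ψ z ∉ k.K)
include hψ

lemma orb_diff (N : ℕ) {p : ℂ × ℂ} (hp : p ∈ h.Om) : DifferentiableAt ℂ (h.orb k ψ N) p := by
  have h1 : DifferentiableAt ℂ (fun p : ℂ × ℂ => (p.1, cexp p.2)) p := by fun_prop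
  have h2 : DifferentiableAt ℂ h.E (p.1, cexp p.2) :=
    h.differentiableOn_E.differentiableAt (h.isOpen_P.mem_nhds (h.mem_P_iff.2 hp))
  have h3 : DifferentiableAt ℂ (fun p : ℂ × ℂ => h.E (p.1, cexp p.2)) p :=
    DifferentiableAt.comp (g := h.E) p h2 h1
  have h4 : DifferentiableAt ℂ (fun z => k.H^[N] (ψ z)) (h.E (p.1, cexp p.2)) :=
    ((k.differentiable_iter N).comp hψ) _
  exact DifferentiableAt.comp (g := fun z => k.H^[N] (ψ z)) p h4 h3

lemma isOpen_ON (N : ℕ) : IsOpen (h.ON k ψ N) :=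
  ContinuousOn.isOpen_inter_preimage
    (fun _ hp => (orb_diff hψ N hp).continuousAt.continuousWithinAt) h.isOpen_Om k.isOpen_U

lemma fN_diff {N : ℕ} {p : ℂ × ℂ} (hp : p ∈ h.ON k ψ N) : DifferentiableAt ℂ (h.fN k ψ N) p :=
  DifferentiableAt.comp p (k.differentiableOn_b.differentiableAt
    (k.isOpen_V.mem_nhds (k.U_sub_V hp.2))) (orb_diff hψ N hp.1)

omit hψ

lemma norm_fN {N : ℕ} {p : ℂ × ℂ} (hp : p ∈ h.ON k ψ N) : k.rho < ‖h.fN k ψ N p‖ :=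
  k.rho_lt_b hp.2

lemma fN_ne {N : ℕ} {p : ℂ × ℂ} (hp : p ∈ h.ON k ψ N) : h.fN k ψ N p ≠ 0 :=
  norm_pos_iff.1 (by linarith [norm_fN hp, k.one_lt_rho])

lemma ON_succ {N : ℕ} {p : ℂ × ℂ} (hp : p ∈ h.ON k ψ N) : p ∈ h.ON k ψ (N + 1) := by
  refine ⟨hp.1, ?_⟩
  rw [orb, Function.iterate_succ_apply']
  exact k.map_U hp.2

lemma fN_succ {N : ℕ} {p : ℂ × ℂ} (hp : p ∈ h.ON k ψ N) :
    h.fN k ψ (N + 1) p = h.fN k ψ N p ^ (k.e + 1) := by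
  rw [fN, orb, Function.iterate_succ_apply']
  exact k.b_H (k.U_sub_V hp.2)

lemma ON_mono {N N' : ℕ} (hN : N ≤ N') {p : ℂ × ℂ} (hp : p ∈ h.ON k ψ N) : p ∈ h.ON k ψ N' := by
  induction hN with
  | refl => exact hp
  | step _ ih => exact ON_succ ih

lemma fN_add {N : ℕ} {p : ℂ × ℂ} (hp : p ∈ h.ON k ψ N) (j : ℕ) :
    h.fN k ψ (N + j) p = h.fN k ψ N p ^ (k.e + 1) ^ j := by
  induction j with
  | zero => simp
  | succ j ih => rw [← add_assoc, fN_succ (ON_mono (Nat.le_add_right _ _) hp), ih, ← pow_mul, pow_succ]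

include hK in
lemma ON_cover {p : ℂ × ℂ} (hp : p ∈ h.Om) : ∃ N, p ∈ h.ON k ψ N := by
  obtain ⟨N, hN⟩ := k.not_mem_K_iff.1 (hK _ (h.E_not_mem_K (h.mem_P_iff.2 hp)))
  exact ⟨N, hp, hN⟩

variable (h k ψ) in
open Classical in
/-- The pulled back Green function. -/
def green (p : ℂ × ℂ) : ℝ :=
  if hp : ∃ N, p ∈ h.ON k ψ N then
    Real.log ‖h.fN k ψ hp.choose p‖ / (k.e + 1 : ℝ) ^ hp.choose else 0

lemma green_aux {N j : ℕ} {p : ℂ × ℂ} (hp : p ∈ h.ON k ψ N) :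
    Real.log ‖h.fN k ψ (N + j) p‖ / (k.e + 1 : ℝ) ^ (N + j) =
      Real.log ‖h.fN k ψ N p‖ / (k.e + 1 : ℝ) ^ N := by
  rw [fN_add hp, norm_pow, Real.log_pow, pow_add]
  have : (k.e + 1 : ℝ) ≠ 0 := by positivity
  push_cast
  field_simp

lemma green_eq {N : ℕ} {p : ℂ × ℂ} (hp : p ∈ h.ON k ψ N) :
    h.green k ψ p = Real.log ‖h.fN k ψ N p‖ / (k.e + 1 : ℝ) ^ N := by
  have hex : ∃ N, p ∈ h.ON k ψ N := ⟨N, hp⟩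
  rw [green, dif_pos hex]
  have h1 := hex.choose_spec
  set N' := hex.choose
  rcases le_total N N' with hl | hl
  · obtain ⟨j, hj⟩ := Nat.exists_eq_add_of_le hl
    rw [hj, green_aux hp]
  · obtain ⟨j, hj⟩ := Nat.exists_eq_add_of_le hl
    rw [hj, green_aux h1]

lemma log_norm_fN {N : ℕ} {p : ℂ × ℂ} (hp : p ∈ h.ON k ψ N) :
    Real.log ‖h.fN k ψ N p‖ = (k.e + 1 : ℝ) ^ N * h.green k ψ p := by
  have : (k.e + 1 : ℝ) ≠ 0 := by positivity
  rw [green_eq hp]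
  field_simp

lemma green_pos {N : ℕ} {p : ℂ × ℂ} (hp : p ∈ h.ON k ψ N) : 0 < h.green k ψ p := by
  rw [green_eq hp]
  have := Real.log_pos (k.one_lt_rho.trans (norm_fN hp))
  positivity

lemma green_congr {p p' : ℂ × ℂ} (hp : p ∈ h.Om) (hp' : p' ∈ h.Om)
    (e : h.E (p.1, cexp p.2) = h.E (p'.1, cexp p'.2)) : h.green k ψ p = h.green k ψ p' := by
  have h1 : ∀ N, p ∈ h.ON k ψ N ↔ p' ∈ h.ON k ψ N := fun N => by
    simp only [ON, mem_ofPred_eq, orb, e, hp, hp', true_and]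
  have h2 : ∀ N, h.fN k ψ N p = h.fN k ψ N p' := fun N => by simp only [fN, orb, e]
  by_cases hex : ∃ N, p ∈ h.ON k ψ N
  · obtain ⟨N, hN⟩ := hex
    rw [green_eq hN, green_eq ((h1 N).1 hN), h2]
  · have hex' : ¬ ∃ N, p' ∈ h.ON k ψ N := fun ⟨N, hN⟩ => hex ⟨N, (h1 N).2 hN⟩
    rw [green, green, dif_neg hex, dif_neg hex']

include hψ hK

lemma green_fst {s : ℂ} (hs : Real.log h.rho < s.re) (t t' : ℂ) :
    h.green k ψ (t, s) = h.green k ψ (t', s) := by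
  have hm : ∀ t, (t, s) ∈ h.Om := fun t => hs
  refine const_of_locally_log_norm (v := fun t => h.green k ψ (t, s)) (fun t => ?_)
    (fun t => ?_) t t'
  · obtain ⟨N, hN⟩ := ON_cover hK (hm t)
    exact (green_pos hN).le
  · obtain ⟨N, hN⟩ := ON_cover hK (hm t)
    have hO : IsOpen ((fun t : ℂ => (t, s)) ⁻¹' h.ON k ψ N) :=
      (isOpen_ON hψ N).preimage (by fun_prop)
    refine ⟨fun t => h.fN k ψ N (t, s), ((k.e + 1 : ℝ) ^ N)⁻¹, ?_, fN_ne hN, ?_⟩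
    · refine DifferentiableOn.analyticAt (s := (fun t : ℂ => (t, s)) ⁻¹' h.ON k ψ N) ?_
        (hO.mem_nhds hN)
      intro t' ht'
      exact (differentiableAt_slice_x (z := (t', s)) (fN_diff hψ ht')).differentiableWithinAt
    · filter_upwards [hO.mem_nhds hN] with t' ht'
      rw [green_eq ht', div_eq_inv_mul]

lemma green_deck {s s' : ℂ} (hs : Real.log h.rho < s.re) {n : ℕ} (hr : s'.re = s.re)
    (e : cexp s' ^ (h.e + 1) ^ n = cexp s ^ (h.e + 1) ^ n) (t t' : ℂ) :
    h.green k ψ (t', s') = h.green k ψ (t, s) := by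
  have hs' : Real.log h.rho < s'.re := by rwa [hr]
  rw [green_fst hψ hK hs' t' (t + h.Qn n (cexp s) - h.Qn n (cexp s'))]
  have hm : (t, s) ∈ h.Om := hs
  have hm' : (t + h.Qn n (cexp s) - h.Qn n (cexp s'), s') ∈ h.Om := hs'
  refine green_congr hm' hm ?_
  refine h.E_eq_of_hat_eq (h.mem_P_iff.2 hm') (h.mem_P_iff.2 hm) (n := n) ?_
  rw [hat_iter, hat_iter]
  simp only [e, sub_add_cancel]

end
end HenonLike

lemma deriv_eq_zero_of_im_eq_zero {w : ℂ → ℂ} {s : ℂ} (hw : ∀ᶠ z in 𝓝 s, DifferentiableAt ℂ w z)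
    (hi : ∀ᶠ z in 𝓝 s, (w z).im = 0) : deriv w s = 0 := by
  have h1 : ∀ᶠ z in 𝓝 s, ‖cexp (I * w z)‖ = ‖cexp (I * w s)‖ := by
    filter_upwards [hi] with z hz
    simp [Complex.norm_exp, hz, hi.self_of_nhds]
  have h2 := eventually_one_of_norm_one (f := fun z => cexp (I * w z))
    (hw.mono fun z hz => (hz.const_mul I).cexp) h1
  have h3 : HasDerivAt (fun z => cexp (I * w z)) (cexp (I * w s) * (I * deriv w s)) s :=
    (hw.self_of_nhds.hasDerivAt.const_mul I).cexp
  have h4 : HasDerivAt (fun z => cexp (I * w z)) 0 s :=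
    (hasDerivAt_const s (cexp (I * w s))).congr_of_eventuallyEq h2
  simpa using h3.unique h4

/-- If `‖f‖` takes the value `‖f s‖` along a sequence approaching `s` vertically, then the
logarithmic derivative of `f` at `s` is real. -/
lemma im_logDeriv_eq_zero {f : ℂ → ℂ} {f' s : ℂ} (hf : HasDerivAt f f' s)
    {y : ℕ → ℝ} (hy : Tendsto y atTop (𝓝 0)) (hy0 : ∀ n, y n ≠ 0)
    (he : ∀ᶠ n in atTop, ‖f (s + y n * I)‖ = ‖f s‖) : (f' / f s).im = 0 := by
  have h1 : HasDerivAt (fun t : ℝ => s + t * I) I 0 := by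
    simpa using ((Complex.ofRealCLM.hasDerivAt (x := (0 : ℝ))).mul_const I).const_add s
  have h2 : HasDerivAt (fun t : ℝ => f (s + t * I)) (f' * I) 0 := by
    have : HasDerivAt f f' (s + (0 : ℝ) * I) := by simpa using hf
    exact this.comp (0 : ℝ) h1
  have h3 := h2.norm_sq
  have h4 := h3.tendsto_slope.comp
    (tendsto_nhdsWithin_iff.2 ⟨hy, Eventually.of_forall fun n => hy0 n⟩)
  have h5 : Tendsto (slope (fun t : ℝ => ‖f (s + t * I)‖ ^ 2) 0 ∘ y) atTop (𝓝 0) := by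
    refine tendsto_const_nhds.congr' ?_
    filter_upwards [he] with n hn
    simp [slope_def_field, hn]
  have h6 := tendsto_nhds_unique h4 h5
  have h7 : (f' * starRingEnd ℂ (f s)).im = 0 := by
    simp [Complex.inner] at h6
    simp
    linarith
  rw [_root_.div_eq_mul_inv, Complex.inv_def, ← mul_assoc, Complex.im_mul_ofReal, h7, zero_mul]

namespace HenonLike

section
variable {h k : HenonLike} {ψ : ℂ × ℂ → ℂ × ℂ} (hψ : Differentiable ℂ ψ)
  (hK : ∀ z, z ∉ h.K → ψ z ∉ k.K)
include hψ

lemma fN_slice_diff {N : ℕ} {s : ℂ} (hp : ((0 : ℂ), s) ∈ h.ON k ψ N) :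
    DifferentiableAt ℂ (fun s => h.fN k ψ N (0, s)) s :=
  differentiableAt_slice_y (z := ((0 : ℂ), s)) (fN_diff hψ hp)

lemma slice_mem {N : ℕ} {s : ℂ} (hp : ((0 : ℂ), s) ∈ h.ON k ψ N) :
    ∀ᶠ s' in 𝓝 s, ((0 : ℂ), s') ∈ h.ON k ψ N :=
  (Continuous.prodMk_right (0 : ℂ)).continuousAt.eventually ((isOpen_ON hψ N).mem_nhds hp)

variable (h k ψ) in
/-- The logarithmic derivative at time `N`, normalised by the degree. -/
def wN (N : ℕ) (s : ℂ) : ℂ :=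
  deriv (fun s => h.fN k ψ N (0, s)) s / h.fN k ψ N (0, s) / (k.e + 1 : ℂ) ^ N

lemma wN_add {N : ℕ} {s : ℂ} (hp : ((0 : ℂ), s) ∈ h.ON k ψ N) (j : ℕ) :
    h.wN k ψ (N + j) s = h.wN k ψ N s := by
  have h1 : (fun s => h.fN k ψ (N + j) (0, s)) =ᶠ[𝓝 s]
      fun s => h.fN k ψ N (0, s) ^ (k.e + 1) ^ j := by
    filter_upwards [slice_mem hψ hp] with s' hs' using fN_add hs' j
  have h2 := ((fN_slice_diff hψ hp).hasDerivAt.fun_pow ((k.e + 1) ^ j)).deriv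
  rw [wN, wN, h1.deriv_eq, h2, fN_add hp]
  have h3 := fN_ne hp
  have h4 : (k.e + 1 : ℂ) ≠ 0 := by exact_mod_cast k.e.succ_ne_zero
  obtain ⟨l, hl⟩ := Nat.exists_eq_succ_of_ne_zero (pow_pos k.e.succ_pos j).ne'
  replace hl : (k.e + 1) ^ j = l + 1 := hl
  have h5 : (((k.e + 1) ^ j : ℕ) : ℂ) = (k.e + 1 : ℂ) ^ j := by push_cast; rfl
  rw [h5, hl, Nat.add_sub_cancel, pow_add, pow_add, pow_one]
  field_simp

lemma wN_eq {N N' : ℕ} {s : ℂ} (hp : ((0 : ℂ), s) ∈ h.ON k ψ N)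
    (hp' : ((0 : ℂ), s) ∈ h.ON k ψ N') : h.wN k ψ N s = h.wN k ψ N' s := by
  rcases le_total N N' with hl | hl
  · obtain ⟨j, rfl⟩ := Nat.exists_eq_add_of_le hl
    rw [wN_add hψ hp]
  · obtain ⟨j, rfl⟩ := Nat.exists_eq_add_of_le hl
    rw [wN_add hψ hp']

lemma wN_diff {N : ℕ} {s : ℂ} (hp : ((0 : ℂ), s) ∈ h.ON k ψ N) :
    DifferentiableAt ℂ (h.wN k ψ N) s := by
  have h1 : AnalyticAt ℂ (fun s => h.fN k ψ N (0, s)) s :=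
    Complex.analyticAt_iff_eventually_differentiableAt.2
      ((slice_mem hψ hp).mono fun s' hs' => fN_slice_diff hψ hs')
  exact ((h1.deriv.differentiableAt.div h1.differentiableAt (fN_ne hp)).div_const _)

include hK

lemma wN_im {N : ℕ} {s : ℂ} (hp : ((0 : ℂ), s) ∈ h.ON k ψ N) : (h.wN k ψ N s).im = 0 := by
  have hd1 : (1 : ℝ) < h.e + 1 := by
    have := h.he
    have : (1 : ℝ) ≤ h.e := by exact_mod_cast this
    linarith
  have h1 := im_logDeriv_eq_zero (fN_slice_diff hψ hp).hasDerivAt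
    (y := fun n => 2 * Real.pi * ((h.e + 1 : ℝ)⁻¹) ^ n) ?_ ?_ ?_
  · rw [wN]
    have : ((k.e + 1 : ℂ) ^ N) = (((k.e + 1 : ℝ) ^ N : ℝ) : ℂ) := by push_cast; rfl
    rw [this, Complex.div_ofReal_im, h1, zero_div]
  · simpa using (tendsto_pow_atTop_nhds_zero_of_lt_one (by positivity)
      (inv_lt_one_of_one_lt₀ hd1)).const_mul (2 * Real.pi)
  · intro n
    have := Real.pi_pos
    positivity
  · have hy : Tendsto (fun n : ℕ => s + ((2 * Real.pi * ((h.e + 1 : ℝ)⁻¹) ^ n : ℝ) : ℂ) * I)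
        atTop (𝓝 s) := by
      have : Tendsto (fun n : ℕ => (2 * Real.pi * ((h.e + 1 : ℝ)⁻¹) ^ n : ℝ)) atTop (𝓝 0) := by
        simpa using (tendsto_pow_atTop_nhds_zero_of_lt_one (by positivity)
          (inv_lt_one_of_one_lt₀ hd1)).const_mul (2 * Real.pi)
      have h2 := ((Complex.continuous_ofReal.tendsto 0).comp this).mul_const I |>.const_add s
      simpa using h2
    filter_upwards [hy.eventually (slice_mem hψ hp)] with n hn
    have hs : Real.log h.rho < s.re := hp.1
    have h3 := green_deck hψ hK (n := n)
      (s' := s + ((2 * Real.pi * ((h.e + 1 : ℝ)⁻¹) ^ n : ℝ) : ℂ) * I) hs (by rw [add_re, re_ofReal_mul]; simp) ?_ 0 0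
    · have h4 := log_norm_fN hn
      rw [h3, ← log_norm_fN hp] at h4
      exact Real.log_injOn_pos (norm_pos_iff.2 (fN_ne hn)) (norm_pos_iff.2 (fN_ne hp)) h4
    · have h5 : (h.e + 1 : ℂ) ≠ 0 := by exact_mod_cast h.e.succ_ne_zero
      rw [← Complex.exp_nat_mul, ← Complex.exp_nat_mul, Complex.exp_eq_exp_iff_exists_int]
      refine ⟨1, ?_⟩
      push_cast
      rw [inv_pow]
      field_simp

/-- The normalised logarithmic derivative is a real constant. -/
lemma exists_wN_const : ∃ m : ℝ, ∀ s N, ((0 : ℂ), s) ∈ h.ON k ψ N → h.wN k ψ N s = m := by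
  classical
  set S : Set ℂ := {s | Real.log h.rho < s.re} with hS
  have hSo : IsOpen S := isOpen_lt continuous_const continuous_re
  have hSc : IsPreconnected S := (convex_halfSpace_re_gt _).isPreconnected
  have hm : ∀ s ∈ S, ∃ N, ((0 : ℂ), s) ∈ h.ON k ψ N := fun s hs =>
    ON_cover (h := h) (p := ((0 : ℂ), s)) hK hs
  set w : ℂ → ℂ := fun s => if hs : ∃ N, ((0 : ℂ), s) ∈ h.ON k ψ N then h.wN k ψ hs.choose s else 0
    with hw
  have hwe : ∀ s N, ((0 : ℂ), s) ∈ h.ON k ψ N → w s = h.wN k ψ N s := fun s N hN => by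
    have hex : ∃ N, ((0 : ℂ), s) ∈ h.ON k ψ N := ⟨N, hN⟩
    simp only [hw]
    rw [dif_pos hex]
    exact wN_eq hψ hex.choose_spec hN
  have hwev : ∀ s N, ((0 : ℂ), s) ∈ h.ON k ψ N → w =ᶠ[𝓝 s] h.wN k ψ N := fun s N hN =>
    (slice_mem hψ hN).mono fun s' hs' => hwe s' N hs'
  have hwd : ∀ s ∈ S, DifferentiableAt ℂ w s := fun s hs => by
    obtain ⟨N, hN⟩ := hm s hs
    exact (wN_diff hψ hN).congr_of_eventuallyEq (hwev s N hN)
  have hwi : ∀ s ∈ S, (w s).im = 0 := fun s hs => by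
    obtain ⟨N, hN⟩ := hm s hs
    rw [hwe s N hN, wN_im hψ hK hN]
  have hwz : ∀ s ∈ S, deriv w s = 0 := fun s hs =>
    deriv_eq_zero_of_im_eq_zero ((hSo.mem_nhds hs |> fun h => mem_of_superset h hwd :
      ∀ᶠ z in 𝓝 s, DifferentiableAt ℂ w z)) (mem_of_superset (hSo.mem_nhds hs) hwi)
  have hconst : ∀ {x y : ℂ}, x ∈ S → y ∈ S → w x = w y := hSo.is_const_of_deriv_eq_zero hSc
    (fun s hs => (hwd s hs).differentiableWithinAt) hwz
  set s₀ : ℂ := ((Real.log h.rho + 1 : ℝ) : ℂ)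
  have hs₀ : s₀ ∈ S := by simp only [S, s₀, mem_ofPred_eq, ofReal_re]; linarith
  refine ⟨(w s₀).re, fun s N hN => ?_⟩
  rw [← hwe s N hN, hconst hN.1 hs₀]
  exact Complex.ext (by simp) (by simp [hwi _ hs₀])

omit hK in
lemma green_slice_local {m : ℝ}
    (hm : ∀ s N, ((0 : ℂ), s) ∈ h.ON k ψ N → h.wN k ψ N s = m) {N : ℕ} {s : ℂ}
    (hp : ((0 : ℂ), s) ∈ h.ON k ψ N) :
    ∀ᶠ s' in 𝓝 s, h.green k ψ (0, s') - m * s'.re = h.green k ψ (0, s) - m * s.re := by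
  obtain ⟨r, hr, hB⟩ := Metric.eventually_nhds_iff_ball.1 (slice_mem hψ hp)
  have hd0 : (0 : ℝ) < (k.e + 1 : ℝ) ^ N := by positivity
  have hd0' : (k.e + 1 : ℂ) ^ N ≠ 0 := pow_ne_zero _ (by exact_mod_cast k.e.succ_ne_zero)
  set G : ℂ → ℂ := fun s => h.fN k ψ N (0, s) * cexp (-((k.e + 1 : ℂ) ^ N * m * s)) with hG
  have hGd : ∀ z ∈ Metric.ball s r, HasDerivAt G 0 z := fun z hz => by
    have h1 := (fN_slice_diff hψ (hB z hz)).hasDerivAt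
    have h2 : HasDerivAt (fun s : ℂ => cexp (-((k.e + 1 : ℂ) ^ N * m * s)))
        (cexp (-((k.e + 1 : ℂ) ^ N * m * z)) * (-((k.e + 1 : ℂ) ^ N * m))) z := by
      simpa using (((hasDerivAt_id z).const_mul ((k.e + 1 : ℂ) ^ N * m)).fun_neg).cexp
    have h3 := h1.mul h2
    have h4 := hm z N (hB z hz)
    rw [wN, div_div, div_eq_iff (mul_ne_zero (fN_ne (hB z hz)) hd0')] at h4
    rw [h4] at h3
    exact h3.congr_deriv (by ring)
  have hGc : ∀ z ∈ Metric.ball s r, G z = G s := fun z hz =>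
    Metric.isOpen_ball.is_const_of_deriv_eq_zero (convex_ball s r).isPreconnected
      (fun z hz => (hGd z hz).differentiableAt.differentiableWithinAt)
      (fun z hz => (hGd z hz).deriv) hz (Metric.mem_ball_self hr)
  filter_upwards [Metric.ball_mem_nhds s hr] with s' hs'
  have h1 : ∀ z ∈ Metric.ball s r, Real.log ‖G z‖ =
      (k.e + 1 : ℝ) ^ N * (h.green k ψ (0, z) - m * z.re) := fun z hz => by
    have h2 : (-((k.e + 1 : ℂ) ^ N * m * z)).re = -((k.e + 1 : ℝ) ^ N * m * z.re) := by
      have : ((k.e + 1 : ℂ) ^ N) = (((k.e + 1 : ℝ) ^ N : ℝ) : ℂ) := by push_cast; rfl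
      rw [this, ← ofReal_mul, neg_re, re_ofReal_mul]
    simp only [hG]
    rw [norm_mul, Real.log_mul (norm_ne_zero_iff.2 (fN_ne (hB z hz)))
      (norm_ne_zero_iff.2 (exp_ne_zero _)), log_norm_fN (hB z hz), norm_exp, Real.log_exp, h2]
    ring
  have h3 := h1 s' hs'
  rw [hGc s' hs', h1 s (Metric.mem_ball_self hr)] at h3
  exact (mul_left_cancel₀ hd0.ne' h3).symm

lemma fN_local {m : ℝ}
    (hm : ∀ s N, ((0 : ℂ), s) ∈ h.ON k ψ N → h.wN k ψ N s = m) (c : ℂ) {N : ℕ} {p : ℂ × ℂ}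
    (hp : p ∈ h.ON k ψ N) :
    ∀ᶠ p' in 𝓝 p, p' ∈ h.ON k ψ N ∧
      h.fN k ψ N p' * cexp (-((k.e + 1 : ℂ) ^ N * (m * p'.2 + c))) =
      h.fN k ψ N p * cexp (-((k.e + 1 : ℂ) ^ N * (m * p.2 + c))) := by
  have hON := (isOpen_ON hψ N).mem_nhds hp
  obtain ⟨N', hN'⟩ := ON_cover (p := ((0 : ℂ), p.2)) hK hp.1
  have hg := continuous_snd.continuousAt.eventually (green_slice_local hψ hm hN')
  refine (eventually_mem_set.2 hON).and (eventually_one_of_norm_one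
    (f := fun p => h.fN k ψ N p * cexp (-((k.e + 1 : ℂ) ^ N * (m * p.2 + c)))) ?_ ?_)
  · filter_upwards [hON] with q hq
    exact (fN_diff hψ hq).mul (by fun_prop)
  · have h1 : ∀ q ∈ h.ON k ψ N, ‖h.fN k ψ N q * cexp (-((k.e + 1 : ℂ) ^ N * (m * q.2 + c)))‖ =
        Real.exp ((k.e + 1 : ℝ) ^ N * (h.green k ψ (0, q.2) - m * q.2.re - c.re)) := fun q hq => by
      have h2 : (-((k.e + 1 : ℂ) ^ N * (m * q.2 + c))).re =
          -((k.e + 1 : ℝ) ^ N * (m * q.2.re + c.re)) := by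
        have : ((k.e + 1 : ℂ) ^ N) = (((k.e + 1 : ℝ) ^ N : ℝ) : ℂ) := by push_cast; rfl
        rw [this, neg_re, re_ofReal_mul, add_re, re_ofReal_mul]
      rw [norm_mul, norm_exp, h2, ← Real.exp_log (norm_pos_iff.2 (fN_ne hq)), log_norm_fN hq,
        ← Real.exp_add, show h.green k ψ q = h.green k ψ (0, q.2) from green_fst hψ hK hq.1 q.1 0]
      ring_nf
    filter_upwards [hON, hg] with q hq hgq
    rw [h1 q hq, h1 p hp, hgq]

lemma exists_fN_eq : ∃ (m : ℝ) (c : ℂ), ∀ p ∈ h.Om, ∃ N, p ∈ h.ON k ψ N ∧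
    h.fN k ψ N p = cexp ((k.e + 1 : ℂ) ^ N * (m * p.2 + c)) := by
  obtain ⟨m, hm⟩ := exists_wN_const (h := h) (k := k) hψ hK
  have hconv : Convex ℝ h.Om :=
    (convex_halfSpace_re_gt (Real.log h.rho)).is_linear_preimage
      (f := fun p : ℂ × ℂ => p.2) ⟨fun _ _ => rfl, fun _ _ => rfl⟩
  set p₀ : ℂ × ℂ := (0, ((Real.log h.rho + 1 : ℝ) : ℂ))
  have hp₀ : p₀ ∈ h.Om := by
    show Real.log h.rho < (((Real.log h.rho + 1 : ℝ) : ℂ)).re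
    rw [ofReal_re]; linarith
  obtain ⟨N₀, hN₀⟩ := ON_cover hK hp₀
  have hd0 : ∀ N : ℕ, (k.e + 1 : ℂ) ^ N ≠ 0 := fun N =>
    pow_ne_zero _ (by exact_mod_cast k.e.succ_ne_zero)
  set c : ℂ := Complex.log (h.fN k ψ N₀ p₀) / (k.e + 1 : ℂ) ^ N₀ - m * p₀.2
  refine ⟨m, c, fun p hp => ?_⟩
  have h1 : h.fN k ψ N₀ p₀ * cexp (-((k.e + 1 : ℂ) ^ N₀ * (m * p₀.2 + c))) = 1 := by
    have : (k.e + 1 : ℂ) ^ N₀ * (m * p₀.2 + c) = Complex.log (h.fN k ψ N₀ p₀) := by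
      simp only [c]
      rw [add_sub_cancel, mul_div_cancel₀ _ (hd0 N₀)]
    rw [this, exp_neg, exp_log (fN_ne hN₀)]
    exact mul_inv_cancel₀ (fN_ne hN₀)
  obtain ⟨N, hN, e⟩ := root_extension hconv.isPreconnected (O := h.ON k ψ)
    (F := fun N p => h.fN k ψ N p * cexp (-((k.e + 1 : ℂ) ^ N * (m * p.2 + c)))) (d := k.e + 1)
    (fun N s hs => fN_local hψ hK hm c hs)
    (fun N s hs => ⟨ON_succ hs, by
      simp only [fN_succ hs, mul_pow, ← Complex.exp_nat_mul]
      push_cast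
      ring_nf⟩)
    (fun s hs => ON_cover hK hs) hp₀ hN₀ h1 hp
  refine ⟨N, hN, ?_⟩
  rw [exp_neg] at e
  exact (mul_inv_eq_one₀ (exp_ne_zero _)).1 e

end
end HenonLike

namespace HenonLike

section
variable {h k : HenonLike} {ψ : ℂ × ℂ → ℂ × ℂ}

lemma b_iter (k : HenonLike) {z : ℂ × ℂ} (hz : z ∈ k.U) (j : ℕ) :
    k.b (k.H^[j] z) = k.b z ^ (k.e + 1) ^ j := by
  induction j with
  | zero => simp
  | succ j ih =>
    rw [Function.iterate_succ_apply', k.b_H (k.U_sub_V (k.iter_U hz j)), ih, ← pow_mul, pow_succ]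

lemma fN_eq_add {m : ℝ} {c : ℂ} {N : ℕ} {p : ℂ × ℂ} (hN : p ∈ h.ON k ψ N)
    (e : h.fN k ψ N p = cexp ((k.e + 1 : ℂ) ^ N * (m * p.2 + c))) (j : ℕ) :
    h.fN k ψ (N + j) p = cexp ((k.e + 1 : ℂ) ^ (N + j) * (m * p.2 + c)) := by
  rw [fN_add hN, e, ← Complex.exp_nat_mul, pow_add]
  push_cast
  ring_nf

lemma exp_log_mem {u : ℂ × ℂ} (hu : u ∈ h.P) :
    (u.1, Complex.log u.2) ∈ h.Om ∧ cexp (Complex.log u.2) = u.2 := by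
  have h0 : u.2 ≠ 0 := norm_pos_iff.1 (lt_trans (by linarith [h.one_lt_rho]) hu)
  have h1 := exp_log h0
  refine ⟨h.mem_P_iff.1 ?_, h1⟩
  simpa only [h1] using hu

lemma exists_leaf_aux (hψ : Differentiable ℂ ψ) (hK : ∀ z, z ∉ h.K → ψ z ∉ k.K) :
    ∃ (N₀ : ℕ) (κ : ℂ) (M : ℕ), κ ≠ 0 ∧ ∀ u ∈ h.P, ∃ N, k.H^[N] (k.H^[N₀] (ψ (h.E u))) ∈ k.U ∧
      k.b (k.H^[N] (k.H^[N₀] (ψ (h.E u)))) = (κ * u.2 ^ M) ^ (k.e + 1) ^ N := by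
  obtain ⟨m, c, hmc⟩ := exists_fN_eq hψ hK
  set s₀ : ℂ := ((Real.log h.rho + 1 : ℝ) : ℂ) with hs₀
  have hp₀ : ((0 : ℂ), s₀) ∈ h.Om := by
    show Real.log h.rho < (((Real.log h.rho + 1 : ℝ) : ℂ)).re
    rw [ofReal_re]; linarith
  have hp₁ : ((0 : ℂ), s₀ + 2 * Real.pi * I) ∈ h.Om := by
    show Real.log h.rho < ((((Real.log h.rho + 1 : ℝ) : ℂ)) + 2 * Real.pi * I).re
    simp
  obtain ⟨N₁, hN₁, e₁⟩ := hmc _ hp₀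
  obtain ⟨N₂, hN₂, e₂⟩ := hmc _ hp₁
  set N₀ := N₁ + N₂ with hN₀
  have hexp : cexp (s₀ + 2 * Real.pi * I) = cexp s₀ := Complex.exp_periodic s₀
  have h1 := fN_eq_add hN₁ e₁ N₂
  have h2 := fN_eq_add hN₂ e₂ N₁
  rw [add_comm N₂ N₁] at h2
  have h3 : h.fN k ψ (N₁ + N₂) ((0 : ℂ), s₀ + 2 * Real.pi * I) =
      h.fN k ψ (N₁ + N₂) ((0 : ℂ), s₀) := by
    simp only [fN, orb, hexp]
  rw [h3, h1, Complex.exp_eq_exp_iff_exists_int] at h2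
  obtain ⟨n, hn⟩ := h2
  have hd0 : ∀ N : ℕ, (k.e + 1 : ℂ) ^ N ≠ 0 := fun N =>
    pow_ne_zero _ (by exact_mod_cast k.e.succ_ne_zero)
  have hn' : (k.e + 1 : ℂ) ^ N₀ * m = ((-n : ℤ) : ℂ) := by
    have h4 := Complex.two_pi_I_ne_zero
    refine mul_right_cancel₀ h4 ?_
    push_cast
    simp only [← hN₀] at hn
    linear_combination -hn
  have hm0 : 0 ≤ m := by
    by_contra hm
    push Not at hm
    set x : ℝ := max (Real.log h.rho + 1) (-c.re / m) with hx
    have hpx : ((0 : ℂ), (x : ℂ)) ∈ h.Om := by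
      show Real.log h.rho < (x : ℂ).re
      rw [ofReal_re]
      have := le_max_left (Real.log h.rho + 1) (-c.re / m)
      linarith
    obtain ⟨N, hN, e⟩ := hmc _ hpx
    have h5 := k.one_lt_rho.trans (norm_fN hN)
    have h6 : ((k.e + 1 : ℂ) ^ N) = (((k.e + 1 : ℝ) ^ N : ℝ) : ℂ) := by push_cast; rfl
    rw [e, norm_exp, h6, re_ofReal_mul, add_re, re_ofReal_mul, ofReal_re, Real.one_lt_exp_iff] at h5
    have h7 : m * x + c.re ≤ 0 := by
      have := mul_le_mul_of_nonpos_left (le_max_right (Real.log h.rho + 1) (-c.re / m)) hm.le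
      rw [mul_div_cancel₀ _ hm.ne] at this
      linarith
    have h8 : (0 : ℝ) < (k.e + 1 : ℝ) ^ N := by positivity
    nlinarith
  have hn0 : 0 ≤ -n := by
    have h5 : (k.e + 1 : ℝ) ^ N₀ * m = ((-n : ℤ) : ℝ) := by exact_mod_cast hn'
    have h6 : (0 : ℝ) ≤ ((-n : ℤ) : ℝ) := by rw [← h5]; positivity
    exact_mod_cast h6
  obtain ⟨M, hM⟩ := Int.eq_ofNat_of_zero_le hn0
  rw [hM] at hn'
  refine ⟨N₀, cexp ((k.e + 1 : ℂ) ^ N₀ * c), M, exp_ne_zero _, fun u hu => ?_⟩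
  obtain ⟨hu1, hu2⟩ := exp_log_mem hu
  obtain ⟨N, hN, e⟩ := hmc _ hu1
  have h7 := fN_eq_add hN e N₀
  have h8 := ON_mono (Nat.le_add_right N N₀) hN
  have h9 : h.orb k ψ (N + N₀) (u.1, Complex.log u.2) = k.H^[N] (k.H^[N₀] (ψ (h.E u))) := by
    rw [orb, Function.iterate_add_apply, hu2]
  refine ⟨N, h9 ▸ h8.2, ?_⟩
  rw [← h9]
  refine h7.trans ?_
  rw [← hu2, ← Complex.exp_nat_mul, ← Complex.exp_add, ← Complex.exp_nat_mul, hu2]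
  congr 1
  push_cast
  push_cast at hn'
  rw [← hn', pow_add]
  ring

/-- A holomorphic map sending escaping points to escaping points respects, after composition
with an iterate, the Böttcher coordinates. -/
lemma exists_leaf (hψ : Differentiable ℂ ψ) (hK : ∀ z, z ∉ h.K → ψ z ∉ k.K) :
    ∃ (N₀ : ℕ) (κ : ℂ) (M : ℕ), κ ≠ 0 ∧ (∀ ζ : ℂ, 2 * h.rho ≤ ‖ζ‖ → k.rho < ‖κ * ζ ^ M‖) ∧
      ∀ u ∈ h.P, ∃ N, k.H^[N] (k.H^[N₀] (ψ (h.E u))) ∈ k.U ∧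
      k.b (k.H^[N] (k.H^[N₀] (ψ (h.E u)))) = (κ * u.2 ^ M) ^ (k.e + 1) ^ N := by
  obtain ⟨N₀, κ, M, hκ, hg⟩ := exists_leaf_aux hψ hK
  have hr := h.one_lt_rho
  have hq : 1 < ‖κ‖ * (2 * h.rho) ^ M := by
    have hP : ((0 : ℂ), ((2 * h.rho : ℝ) : ℂ)) ∈ h.P := by
      show h.rho < ‖((2 * h.rho : ℝ) : ℂ)‖
      rw [norm_real, Real.norm_of_nonneg (by linarith)]
      linarith
    obtain ⟨N, hN, e⟩ := hg _ hP
    have h1 := k.one_lt_rho.trans (k.rho_lt_b hN)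
    rw [e, norm_pow, norm_mul, norm_pow, norm_real, Real.norm_of_nonneg (by linarith)] at h1
    by_contra hcon
    exact absurd (pow_le_one₀ (by positivity) (not_lt.1 hcon)) (not_le.2 h1)
  obtain ⟨j, hj⟩ := pow_unbounded_of_one_lt k.rho hq
  have hj' : k.rho < (‖κ‖ * (2 * h.rho) ^ M) ^ (k.e + 1) ^ j :=
    hj.trans_le (pow_le_pow_right₀ hq.le (Nat.lt_pow_self (by have := k.he; omega)).le)
  refine ⟨j + N₀, κ ^ (k.e + 1) ^ j, M * (k.e + 1) ^ j, pow_ne_zero _ hκ, fun ζ hζ => ?_,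
    fun u hu => ?_⟩
  · rw [pow_mul, ← mul_pow, norm_pow, norm_mul, norm_pow]
    refine hj'.trans_le (pow_le_pow_left₀ (by positivity) ?_ _)
    gcongr
  · obtain ⟨N, hN, e⟩ := hg u hu
    refine ⟨N, ?_, ?_⟩
    · rw [← Function.iterate_add_apply, show N + (j + N₀) = j + (N + N₀) by ring,
        Function.iterate_add_apply k.H j, Function.iterate_add_apply k.H N]
      exact k.iter_U hN j
    · rw [← Function.iterate_add_apply, show N + (j + N₀) = j + (N + N₀) by ring,
        Function.iterate_add_apply k.H j, Function.iterate_add_apply k.H N]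
      rw [k.b_iter hN j, e, pow_mul u.2, ← mul_pow, ← pow_mul, ← pow_mul, mul_comm ((k.e + 1) ^ N)]

end
end HenonLike

/-- An injective holomorphic map which, on the escaping set, acts on the Böttcher coordinate
as `ζ ↦ κ ζ ^ M`. -/
structure LeafMap (h k : HenonLike) where
  ψ : ℂ × ℂ → ℂ × ℂ
  diff : Differentiable ℂ ψ
  inj : Function.Injective ψ
  κ : ℂ
  M : ℕ
  hκ : κ ≠ 0
  big : ∀ ζ : ℂ, 2 * h.rho ≤ ‖ζ‖ → k.rho < ‖κ * ζ ^ M‖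
  leaf : ∀ u ∈ h.P, ∃ N, k.H^[N] (ψ (h.E u)) ∈ k.U ∧
      k.b (k.H^[N] (ψ (h.E u))) = (κ * u.2 ^ M) ^ (k.e + 1) ^ N

namespace LeafMap
variable {h k : HenonLike} (L : LeafMap h k)

/-- The action on the Böttcher coordinate. -/
def cov (ζ : ℂ) : ℂ := L.κ * ζ ^ L.M

/-- The time `N` suffices to straighten the image of the point with parameter `u`. -/
def Good (N : ℕ) (u : ℂ × ℂ) : Prop :=
  k.H^[N] (L.ψ (h.E u)) ∈ k.U ∧ k.b (k.H^[N] (L.ψ (h.E u))) = L.cov u.2 ^ (k.e + 1) ^ N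

lemma Good.add {N : ℕ} {u : ℂ × ℂ} (hg : L.Good N u) (j : ℕ) : L.Good (N + j) u := by
  rw [Good, add_comm, Function.iterate_add_apply]
  refine ⟨k.iter_U hg.1 j, ?_⟩
  rw [HenonLike.b_iter k hg.1, hg.2, ← pow_mul, ← pow_add, add_comm N j]

lemma exists_good {u : ℂ × ℂ} (hu : u ∈ h.P) : ∃ N, L.Good N u := L.leaf u hu

lemma image_diff (N : ℕ) {u : ℂ × ℂ} (hu : u ∈ h.P) :
    DifferentiableAt ℂ (fun u => k.H^[N] (L.ψ (h.E u))) u := by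
  have h4 : DifferentiableAt ℂ (fun z => k.H^[N] (L.ψ z)) (h.E u) :=
    ((k.differentiable_iter N).comp L.diff) _
  exact DifferentiableAt.comp (g := fun z => k.H^[N] (L.ψ z)) u h4
    (h.differentiableOn_E.differentiableAt (h.isOpen_P.mem_nhds hu))

lemma eventually_mem_U {N : ℕ} {u : ℂ × ℂ} (hu : u ∈ h.P) (hg : k.H^[N] (L.ψ (h.E u)) ∈ k.U) :
    ∀ᶠ u' in 𝓝 u, u' ∈ h.P ∧ k.H^[N] (L.ψ (h.E u')) ∈ k.U :=
  (eventually_mem_set.2 (h.isOpen_P.mem_nhds hu)).and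
    ((L.image_diff N hu).continuousAt.eventually (k.isOpen_U.mem_nhds hg))

lemma norm_b_eq {N : ℕ} {u : ℂ × ℂ} (hu : u ∈ h.P) (hg : k.H^[N] (L.ψ (h.E u)) ∈ k.U) :
    ‖k.b (k.H^[N] (L.ψ (h.E u)))‖ = ‖L.cov u.2 ^ (k.e + 1) ^ N‖ := by
  obtain ⟨j, hj⟩ := L.exists_good hu
  have h1 := (hj.add L N).2
  rw [add_comm j N, add_comm N j, Function.iterate_add_apply,
    HenonLike.b_iter k hg, pow_add, mul_comm, pow_mul] at h1
  have h2 := congrArg norm h1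
  rw [norm_pow _ ((k.e + 1) ^ j), norm_pow _ ((k.e + 1) ^ j)] at h2
  exact (pow_left_inj₀ (norm_nonneg _) (norm_nonneg _)
    (pow_pos k.e.succ_pos j).ne').1 h2

lemma eventually_good {N : ℕ} {u : ℂ × ℂ} (hu : u ∈ h.P) (hg : L.Good N u) :
    ∀ᶠ u' in 𝓝 u, u' ∈ h.P ∧ L.Good N u' := by
  have hU := L.eventually_mem_U hu hg.1
  have hne : ∀ u' ∈ h.P, k.H^[N] (L.ψ (h.E u')) ∈ k.U →
      L.cov u'.2 ^ (k.e + 1) ^ N ≠ 0 := fun u' h1 h2 => by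
    have h3 := k.rho_lt_b h2
    rw [L.norm_b_eq h1 h2] at h3
    exact norm_pos_iff.1 (by linarith [k.one_lt_rho])
  have hne' : ∀ u' ∈ h.P, k.H^[N] (L.ψ (h.E u')) ∈ k.U →
      k.b (k.H^[N] (L.ψ (h.E u'))) ≠ 0 := fun u' h1 h2 =>
    norm_pos_iff.1 (by linarith [k.one_lt_rho, k.rho_lt_b h2])
  have h1 := eventually_one_of_norm_one (c := u)
    (f := fun u => L.cov u.2 ^ (k.e + 1) ^ N * (k.b (k.H^[N] (L.ψ (h.E u))))⁻¹) ?_ ?_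
  · filter_upwards [h1, hU] with u' he hu'
    refine ⟨hu'.1, hu'.2, ?_⟩
    rw [hg.2, mul_inv_cancel₀ (hne u hu hg.1)] at he
    exact ((mul_inv_eq_one₀ (hne' u' hu'.1 hu'.2)).1 he).symm
  · filter_upwards [hU] with u' hu'
    have h2 : DifferentiableAt ℂ (fun u : ℂ × ℂ => L.cov u.2 ^ (k.e + 1) ^ N) u' := by
      unfold cov; fun_prop
    have h3 : DifferentiableAt ℂ (fun u => k.b (k.H^[N] (L.ψ (h.E u)))) u' :=
      DifferentiableAt.comp (g := k.b) u' (k.differentiableOn_b.differentiableAt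
        (k.isOpen_V.mem_nhds (k.U_sub_V hu'.2))) (L.image_diff N hu'.1)
    exact h2.mul (h3.inv (hne' u' hu'.1 hu'.2))
  · filter_upwards [hU] with u' hu'
    rw [norm_mul, norm_mul, norm_inv, norm_inv, L.norm_b_eq hu'.1 hu'.2, L.norm_b_eq hu hg.1,
      mul_inv_cancel₀ (norm_ne_zero_iff.2 (hne u' hu'.1 hu'.2)),
      mul_inv_cancel₀ (norm_ne_zero_iff.2 (hne u hu hg.1))]

/-- The leaf coordinate of the image, computed at time `N`. -/
def ThN (N : ℕ) (u : ℂ × ℂ) : ℂ :=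
  k.lam ^ N * k.theta (k.H^[N] (L.ψ (h.E u))) - k.Qn N (L.cov u.2)

lemma chart_eq {N : ℕ} {u : ℂ × ℂ} (hg : L.Good N u) :
    k.chart (k.H^[N] (L.ψ (h.E u))) = k.hat^[N] (L.ThN N u, L.cov u.2) := by
  rw [k.hat_iter, ← hg.2, HenonLike.chart, ThN]
  refine Prod.ext ?_ rfl
  have := k.lam_ne
  simp only [sub_add_cancel]
  rw [inv_mul_cancel_left₀ (pow_ne_zero _ k.lam_ne)]

lemma ThN_add {N : ℕ} {u : ℂ × ℂ} (hg : L.Good N u) (j : ℕ) : L.ThN (N + j) u = L.ThN N u := by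
  have h1 := L.chart_eq (hg.add L j)
  rw [add_comm N j, Function.iterate_add_apply, k.chart_H_iter hg.1, L.chart_eq hg,
    ← Function.iterate_add_apply, k.hat_iter, k.hat_iter, Prod.mk.injEq] at h1
  have h2 := mul_left_cancel₀ (inv_ne_zero (pow_ne_zero _ k.lam_ne)) h1.1
  rw [add_comm N j]
  exact (add_right_cancel h2).symm

lemma ThN_eq {N N' : ℕ} {u : ℂ × ℂ} (hg : L.Good N u) (hg' : L.Good N' u) :
    L.ThN N u = L.ThN N' u := by
  rcases le_total N N' with hl | hl
  · obtain ⟨j, rfl⟩ := Nat.exists_eq_add_of_le hl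
    rw [L.ThN_add hg]
  · obtain ⟨j, rfl⟩ := Nat.exists_eq_add_of_le hl
    rw [L.ThN_add hg']

open Classical in
/-- The leaf coordinate of the image. -/
def Th (u : ℂ × ℂ) : ℂ := if hu : ∃ N, L.Good N u then L.ThN hu.choose u else 0

lemma Th_eq {N : ℕ} {u : ℂ × ℂ} (hg : L.Good N u) : L.Th u = L.ThN N u := by
  have hex : ∃ N, L.Good N u := ⟨N, hg⟩
  rw [Th, dif_pos hex]
  exact L.ThN_eq hex.choose_spec hg

variable (h) in
/-- Parameters beyond twice the escape radius. -/
def P2 : Set (ℂ × ℂ) := {u | 2 * h.rho < ‖u.2‖}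

omit L in
lemma P2_sub : P2 h ⊆ h.P := fun u (hu : 2 * h.rho < ‖u.2‖) =>
  show h.rho < ‖u.2‖ by linarith [h.one_lt_rho]

lemma cov_mem {u : ℂ × ℂ} (hu : u ∈ P2 h) (t : ℂ) : (t, L.cov u.2) ∈ k.P :=
  L.big _ (le_of_lt hu)

lemma E_Th {u : ℂ × ℂ} (hu : u ∈ P2 h) : k.E (L.Th u, L.cov u.2) = L.ψ (h.E u) := by
  obtain ⟨N, hN⟩ := L.exists_good (P2_sub hu)
  rw [L.Th_eq hN]
  exact k.E_eq_of_chart (L.cov_mem hu _) hN.1 (L.chart_eq hN)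

lemma _root_.HenonRigidity.HenonLike.differentiableAt_Qn (k : HenonLike) (N : ℕ) {ζ : ℂ}
    (hζ : k.rho < ‖ζ‖) : DifferentiableAt ℂ (k.Qn N) ζ := by
  unfold HenonLike.Qn
  refine DifferentiableAt.fun_sum fun i _ => DifferentiableAt.const_mul ?_ _
  have h1 : DifferentiableAt ℂ (fun ζ : ℂ => ζ ^ (k.e + 1) ^ i) ζ := by fun_prop
  refine DifferentiableAt.comp (g := k.Q) ζ (k.differentiableOn_Q.differentiableAt
    ((isOpen_lt continuous_const continuous_norm).mem_nhds ?_)) h1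
  show 4 * k.R < ‖ζ ^ (k.e + 1) ^ i‖
  have h2 := k.rho_gt
  have h3 : ‖ζ‖ ≤ ‖ζ ^ (k.e + 1) ^ i‖ := by
    rw [norm_pow]
    exact le_self_pow₀ (by linarith [k.one_lt_rho]) (pow_pos k.e.succ_pos i).ne'
  have h4 : 0 < k.R := by linarith [k.hC, k.hR]
  linarith

lemma Th_diff {u : ℂ × ℂ} (hu : u ∈ P2 h) : DifferentiableAt ℂ L.Th u := by
  obtain ⟨N, hN⟩ := L.exists_good (P2_sub hu)
  have h1 : L.Th =ᶠ[𝓝 u] L.ThN N :=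
    (L.eventually_good (P2_sub hu) hN).mono fun u' hu' => L.Th_eq hu'.2
  refine DifferentiableAt.congr_of_eventuallyEq ?_ h1
  have h2 : DifferentiableAt ℂ (fun u => k.theta (k.H^[N] (L.ψ (h.E u)))) u :=
    DifferentiableAt.comp (g := k.theta) u (k.differentiableOn_theta.differentiableAt
      (k.isOpen_V2.mem_nhds (k.U_sub_V2 hN.1))) (L.image_diff N (P2_sub hu))
  have h3 : DifferentiableAt ℂ (fun u : ℂ × ℂ => L.cov u.2) u := by unfold cov; fun_prop
  have h4 : DifferentiableAt ℂ (fun u : ℂ × ℂ => k.Qn N (L.cov u.2)) u :=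
    DifferentiableAt.comp (g := k.Qn N) u (k.differentiableAt_Qn N (L.cov_mem hu 0)) h3
  exact (h2.const_mul _).sub h4

lemma hat_eq_of_Th_eq {u u' : ℂ × ℂ} (hu : u ∈ P2 h) (hu' : u' ∈ P2 h) (e : L.Th u = L.Th u')
    (ec : L.cov u.2 = L.cov u'.2) : ∃ n, h.hat^[n] u = h.hat^[n] u' := by
  have h1 : L.ψ (h.E u) = L.ψ (h.E u') := by rw [← L.E_Th hu, ← L.E_Th hu', e, ec]
  obtain ⟨N, hN⟩ := h.hat_eq_of_E_eq (P2_sub hu) (P2_sub hu') (L.inj h1)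
  exact ⟨N, hN N le_rfl⟩

/-- Translation part of the leaf coordinate. -/
def beta (ζ : ℂ) : ℂ := L.Th (0, ζ)

/-- Linear part of the leaf coordinate. -/
def alpha (ζ : ℂ) : ℂ := L.Th (1, ζ) - L.Th (0, ζ)

lemma Th_affine {ζ : ℂ} (hζ : 2 * h.rho < ‖ζ‖) :
    L.alpha ζ ≠ 0 ∧ ∀ t, L.Th (t, ζ) = L.alpha ζ * t + L.beta ζ := by
  have hm : ∀ t : ℂ, (t, ζ) ∈ P2 h := fun t => hζ
  obtain ⟨a, b, ha, hab⟩ := entire_injective_affine (f := fun t => L.Th (t, ζ))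
    (fun t => differentiableAt_slice_x (z := (t, ζ)) (L.Th_diff (hm t))) (fun t t' e => by
      obtain ⟨n, hn⟩ := L.hat_eq_of_Th_eq (hm t) (hm t') e rfl
      rw [h.hat_iter, h.hat_iter, Prod.mk.injEq] at hn
      exact add_right_cancel (mul_left_cancel₀ (inv_ne_zero (pow_ne_zero _ h.lam_ne)) hn.1))
  have h0 := hab 0
  have h1 := hab 1
  simp only [mul_zero, zero_add, mul_one] at h0 h1
  have e1 : L.beta ζ = b := h0
  have e2 : L.alpha ζ = a := by rw [alpha, h0, h1]; ring
  rw [e1, e2]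
  exact ⟨ha, hab⟩

lemma M_pos : 0 < L.M := by
  by_contra hM
  have hM0 : L.M = 0 := by omega
  have hr := h.one_lt_rho
  set ζ : ℂ := ((3 * h.rho : ℝ) : ℂ) with hζ
  have hn : ‖ζ‖ = 3 * h.rho := by rw [hζ, norm_real, Real.norm_of_nonneg (by linarith)]
  have h1 : 2 * h.rho < ‖ζ‖ := by linarith
  have h2 : 2 * h.rho < ‖2 * ζ‖ := by rw [norm_mul, hn, Complex.norm_two]; linarith
  obtain ⟨ha, hT⟩ := L.Th_affine h2
  obtain ⟨n, hn'⟩ := L.hat_eq_of_Th_eq (u := (0, ζ))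
    (u' := ((L.Th (0, ζ) - L.beta (2 * ζ)) / L.alpha (2 * ζ), 2 * ζ)) h1 h2
    (by rw [hT, mul_div_cancel₀ _ ha, sub_add_cancel]) (by simp [cov, hM0])
  rw [h.hat_iter, h.hat_iter, Prod.mk.injEq] at hn'
  have h3 := congrArg norm hn'.2
  simp only [norm_pow, norm_mul, Complex.norm_two] at h3
  have h4 := (pow_left_inj₀ (norm_nonneg _) (by positivity) (pow_pos h.e.succ_pos n).ne').1 h3
  linarith

lemma alpha_diff {ζ : ℂ} (hζ : 2 * h.rho < ‖ζ‖) : DifferentiableAt ℂ L.alpha ζ :=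
  (differentiableAt_slice_y (z := ((1 : ℂ), ζ)) (L.Th_diff (show ((1 : ℂ), ζ) ∈ P2 h from hζ))).sub
    (differentiableAt_slice_y (z := ((0 : ℂ), ζ)) (L.Th_diff (show ((0 : ℂ), ζ) ∈ P2 h from hζ)))

lemma beta_diff {ζ : ℂ} (hζ : 2 * h.rho < ‖ζ‖) : DifferentiableAt ℂ L.beta ζ :=
  differentiableAt_slice_y (z := ((0 : ℂ), ζ)) (L.Th_diff (show ((0 : ℂ), ζ) ∈ P2 h from hζ))

lemma deck_aux {ζ ω : ℂ} {n : ℕ} (hζ : 2 * h.rho < ‖ζ‖) (hω : ω ^ (h.e + 1) ^ n = 1) (t : ℂ) :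
    ∃ N, ∀ m, N ≤ m → (L.cov ζ) ^ (k.e + 1) ^ m = (L.cov (ω * ζ)) ^ (k.e + 1) ^ m ∧
      L.alpha ζ * t + L.beta ζ + k.Qn m (L.cov ζ) =
      L.alpha (ω * ζ) * (t + h.Qn n ζ - h.Qn n (ω * ζ)) + L.beta (ω * ζ) +
        k.Qn m (L.cov (ω * ζ)) := by
  have hω1 : ‖ω‖ = 1 := norm_eq_one_of_pow_eq_one hω (pow_pos h.e.succ_pos n).ne'
  have hζ' : 2 * h.rho < ‖ω * ζ‖ := by rwa [norm_mul, hω1, one_mul]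
  have hu : (t, ζ) ∈ P2 h := hζ
  have hu' : (t + h.Qn n ζ - h.Qn n (ω * ζ), ω * ζ) ∈ P2 h := hζ'
  have h1 : h.E (t, ζ) = h.E (t + h.Qn n ζ - h.Qn n (ω * ζ), ω * ζ) := by
    refine h.E_eq_of_hat_eq (P2_sub hu) (P2_sub hu') (n := n) ?_
    rw [h.hat_iter, h.hat_iter]
    simp only [sub_add_cancel, mul_pow, hω, one_mul]
  have h2 : k.E (L.Th (t, ζ), L.cov ζ) =
      k.E (L.Th (t + h.Qn n ζ - h.Qn n (ω * ζ), ω * ζ), L.cov (ω * ζ)) := by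
    have e1 := L.E_Th hu
    have e2 := L.E_Th hu'
    rw [e1, e2, h1]
  obtain ⟨N, hN⟩ := k.hat_eq_of_E_eq (L.cov_mem hu _) (L.cov_mem hu' _) h2
  refine ⟨N, fun m hm => ?_⟩
  have h3 := hN m hm
  rw [k.hat_iter, k.hat_iter, Prod.mk.injEq] at h3
  refine ⟨h3.2, ?_⟩
  have h4 := mul_left_cancel₀ (inv_ne_zero (pow_ne_zero _ k.lam_ne)) h3.1
  simp only [(L.Th_affine hζ).2, (L.Th_affine hζ').2] at h4
  exact h4

lemma alpha_rot {ζ ω : ℂ} {n : ℕ} (hζ : 2 * h.rho < ‖ζ‖) (hω : ω ^ (h.e + 1) ^ n = 1) :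
    L.alpha (ω * ζ) = L.alpha ζ := by
  obtain ⟨N, hN⟩ := L.deck_aux hζ hω 0
  obtain ⟨N', hN'⟩ := L.deck_aux hζ hω 1
  have h1 := (hN _ (le_max_left N N')).2
  have h2 := (hN' _ (le_max_right N N')).2
  linear_combination h1 - h2

lemma beta_rot {ζ ω : ℂ} {n : ℕ} (hζ : 2 * h.rho < ‖ζ‖) (hω : ω ^ (h.e + 1) ^ n = 1) :
    ∃ N, ∀ m, N ≤ m → L.beta ζ - L.beta (ω * ζ) = L.alpha ζ * (h.Qn n ζ - h.Qn n (ω * ζ)) +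
      k.Qn m (L.cov (ω * ζ)) - k.Qn m (L.cov ζ) := by
  obtain ⟨N, hN⟩ := L.deck_aux hζ hω 0
  refine ⟨N, fun m hm => ?_⟩
  have h1 := (hN m hm).2
  rw [L.alpha_rot hζ hω] at h1
  linear_combination h1

lemma exists_pow_rot {ω : ℂ} {n : ℕ} (hω : ω ^ (h.e + 1) ^ n = 1) :
    ∃ N, (ω ^ L.M) ^ (k.e + 1) ^ N = 1 := by
  have hr := h.one_lt_rho
  have hn : ‖((3 * h.rho : ℝ) : ℂ)‖ = 3 * h.rho := by
    rw [norm_real, Real.norm_of_nonneg (by linarith)]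
  have h1 : 2 * h.rho < ‖((3 * h.rho : ℝ) : ℂ)‖ := by linarith
  obtain ⟨N, hN⟩ := L.deck_aux h1 hω 0
  refine ⟨N, ?_⟩
  have h2 := (hN N le_rfl).1
  have h3 : L.cov (ω * ((3 * h.rho : ℝ) : ℂ)) = ω ^ L.M * L.cov ((3 * h.rho : ℝ) : ℂ) := by
    simp only [cov]; ring
  rw [h3, mul_pow] at h2
  have h4 : L.cov ((3 * h.rho : ℝ) : ℂ) ^ (k.e + 1) ^ N ≠ 0 :=
    pow_ne_zero _ (norm_pos_iff.1 (lt_trans (by linarith [k.one_lt_rho]) (L.big _ h1.le)))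
  exact (mul_eq_right₀ h4).1 h2.symm

/-- The functional equation of the translation part, with a uniform time. -/
lemma beta_rot_uniform {ω : ℂ} {n : ℕ} (hω : ω ^ (h.e + 1) ^ n = 1) :
    ∃ N, ∀ m, N ≤ m → ∀ ζ : ℂ, 2 * h.rho < ‖ζ‖ →
      L.beta ζ - L.beta (ω * ζ) = L.alpha ζ * (h.Qn n ζ - h.Qn n (ω * ζ)) +
      k.Qn m (L.cov (ω * ζ)) - k.Qn m (L.cov ζ) := by
  obtain ⟨N, hN⟩ := L.exists_pow_rot hω
  refine ⟨N, fun m hm ζ hζ => ?_⟩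
  obtain ⟨N', hN'⟩ := L.beta_rot hζ hω
  have h1 := hN' _ (le_max_right m N')
  have h2 : ∀ m', m ≤ m' → k.Qn m' (L.cov (ω * ζ)) - k.Qn m' (L.cov ζ) =
      k.Qn m (L.cov (ω * ζ)) - k.Qn m (L.cov ζ) := fun m' hm' => by
    induction hm' with
    | refl => rfl
    | @step m' hm' ih =>
      have h3 : L.cov (ω * ζ) ^ (k.e + 1) ^ m' = L.cov ζ ^ (k.e + 1) ^ m' := by
        have h4 : L.cov (ω * ζ) = ω ^ L.M * L.cov ζ := by simp only [cov]; ring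
        obtain ⟨j, rfl⟩ := Nat.exists_eq_add_of_le (hm.trans hm')
        rw [h4, mul_pow, pow_add, pow_mul (ω ^ L.M), hN, one_pow, one_mul]
      have h5 : ∀ x, k.Qn (m' + 1) x = k.Qn m' x + k.lam ^ m' * k.Q (x ^ (k.e + 1) ^ m') :=
        fun x => by rw [HenonLike.Qn, Finset.sum_range_succ]; rfl
      rw [Nat.succ_eq_add_one, h5, h5, h3]
      linear_combination ih
  linear_combination h1 + h2 _ (le_max_left m N')

end LeafMap

section Laurent

variable {f : ℂ → ℂ} {r : ℝ}

/-- The Cauchy transform of `f` over a circle about the origin. -/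
def cauchyT (f : ℂ → ℂ) (R : ℝ) (z : ℂ) : ℂ :=
  (2 * Real.pi * I)⁻¹ • ∮ w in C((0 : ℂ), R), (w - z)⁻¹ • f w

lemma cauchyT_eq (hr : 0 ≤ r) (hf : ∀ ζ, r < ‖ζ‖ → DifferentiableAt ℂ f ζ) {R R' : ℝ} {z : ℂ}
    (h1 : r < R) (h2 : R ≤ R') (hz : ‖z‖ < R) : cauchyT f R' z = cauchyT f R z := by
  have hd : ∀ w : ℂ, R ≤ ‖w‖ → DifferentiableAt ℂ (fun w => (w - z)⁻¹ • f w) w := fun w hw =>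
    ((differentiableAt_id.sub_const z).inv (sub_ne_zero.2 (by
      rintro rfl; exact absurd hz (not_lt.2 hw)))).smul (hf w (h1.trans_le hw))
  rw [cauchyT, cauchyT, Complex.circleIntegral_eq_of_differentiable_on_annulus_off_countable
    (by linarith) h2 countable_empty]
  · intro w hw
    exact (hd w (by simpa using hw.2)).continuousAt.continuousWithinAt
  · intro w hw
    exact hd w (by simpa using (le_of_lt (not_le.1 (fun h => hw.1.2 (by simpa using h)))))

lemma cauchyT_diff (hf : ∀ ζ, r < ‖ζ‖ → DifferentiableAt ℂ f ζ) {R : ℝ} {z : ℂ}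
    (h0 : 0 ≤ r) (h1 : r < R) (hz : ‖z‖ < R) : DifferentiableAt ℂ (cauchyT f R) z := by
  lift R to NNReal using (h0.trans h1.le)
  have hc : CircleIntegrable f 0 R := ContinuousOn.circleIntegrable R.2 fun w hw => by
    have : ‖w‖ = R := by simpa using hw
    exact (hf w (by rwa [this])).continuousAt.continuousWithinAt
  have h3 := hasFPowerSeriesOn_cauchy_integral hc
    (by exact_mod_cast (h0.trans_lt h1))
  exact h3.differentiableOn.differentiableAt (Metric.isOpen_eball.mem_nhds (by
    rw [Metric.mem_eball, edist_zero_right]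
    have : ‖z‖₊ < R := by exact_mod_cast hz
    exact_mod_cast this))

lemma cauchyT_sub (hr : 0 ≤ r) (hf : ∀ ζ, r < ‖ζ‖ → DifferentiableAt ℂ f ζ) {R R' : ℝ} {z : ℂ}
    (h1 : r < R) (h2 : R < ‖z‖) (h3 : ‖z‖ < R') : f z = cauchyT f R' z - cauchyT f R z := by
  have hfz : DifferentiableAt ℂ f z := hf z (h1.trans h2)
  have hdsl : ∮ w in C((0 : ℂ), R'), dslope f z w = ∮ w in C((0 : ℂ), R), dslope f z w := by
    refine Complex.circleIntegral_eq_of_differentiable_on_annulus_off_countable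
      (by linarith) (h2.trans h3).le (countable_singleton z) ?_ ?_
    · intro w hw
      have hw' : R ≤ ‖w‖ := by simpa using hw.2
      have h4 : DifferentiableAt ℂ f w := hf w (h1.trans_le hw')
      rcases eq_or_ne w z with rfl | hne
      · exact (continuousAt_dslope_same.2 h4).continuousWithinAt
      · exact ((continuousAt_dslope_of_ne hne).2 h4.continuousAt).continuousWithinAt
    · intro w hw
      have hw' : R < ‖w‖ := not_le.1 (fun h => hw.1.2 (by simpa using h))
      exact (differentiableAt_dslope_of_ne hw.2).2 (hf w (h1.trans hw'))
  have key : ∀ ρ : ℝ, r < ρ → 0 ≤ ρ → ρ ≠ ‖z‖ → ∮ w in C((0 : ℂ), ρ), dslope f z w =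
      (∮ w in C((0 : ℂ), ρ), (w - z)⁻¹ • f w) - f z * ∮ w in C((0 : ℂ), ρ), (w - z)⁻¹ := by
    intro ρ hρ hρ0 hρz
    have hne : ∀ w ∈ Metric.sphere (0 : ℂ) ρ, w ≠ z := by
      rintro w hw rfl
      exact hρz (by simpa using hw.symm)
    have hci : ContinuousOn (fun w : ℂ => (w - z)⁻¹) (Metric.sphere (0 : ℂ) ρ) := fun w hw =>
      ((continuousAt_id.sub continuousAt_const).inv₀
        (sub_ne_zero.2 (hne w hw))).continuousWithinAt
    have hcf : ContinuousOn f (Metric.sphere (0 : ℂ) ρ) := fun w hw => by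
      have : ‖w‖ = ρ := by simpa using hw
      exact (hf w (by rwa [this])).continuousAt.continuousWithinAt
    have hs := circleIntegral.integral_sub (f := fun w => (w - z)⁻¹ • f w)
      (g := fun w => f z * (w - z)⁻¹) (c := 0) (R := ρ)
      (ContinuousOn.circleIntegrable hρ0 (hci.smul hcf))
      (ContinuousOn.circleIntegrable hρ0 (continuousOn_const.mul hci))
    rw [← circleIntegral.integral_const_mul, ← hs]
    refine circleIntegral.integral_congr hρ0 fun w hw => ?_
    simp only [dslope_of_ne f (hne w hw), slope_def_field, smul_eq_mul]
    have := sub_ne_zero.2 (hne w hw)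
    field_simp
  have hpi := Complex.two_pi_I_ne_zero
  have h5 : ∮ w in C((0 : ℂ), R), (w - z)⁻¹ = 0 := by
    have hne : ∀ w ∈ Metric.closedBall (0 : ℂ) R, w - z ≠ 0 := fun w hw => sub_ne_zero.2 (by
      rintro rfl
      exact absurd h2 (not_lt.2 (by simpa using hw)))
    refine Complex.circleIntegral_eq_zero_of_differentiable_on_off_countable (by linarith)
      countable_empty (fun w hw => ?_) (fun w hw => ?_)
    · exact ((continuousAt_id.sub continuousAt_const).inv₀ (hne w hw)).continuousWithinAt
    · exact (differentiableAt_id.sub_const z).inv (hne w (Metric.ball_subset_closedBall hw.1))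
  have h6 : ∮ w in C((0 : ℂ), R'), (w - z)⁻¹ = 2 * Real.pi * I :=
    circleIntegral.integral_sub_inv_of_mem_ball (by simpa using h3)
  rw [key R' (h1.trans (h2.trans h3)) (by linarith) h3.ne', key R h1 (by linarith) h2.ne, h5, h6,
    mul_zero, sub_zero, sub_eq_iff_eq_add] at hdsl
  rw [cauchyT, cauchyT, hdsl, smul_add, add_sub_cancel_left, smul_eq_mul]
  field_simp

/-- Laurent decomposition near infinity: entire part plus a part vanishing at infinity. -/
lemma exists_laurent (hr : 0 ≤ r) (hf : ∀ ζ, r < ‖ζ‖ → DifferentiableAt ℂ f ζ) :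
    ∃ p : ℂ → ℂ, Differentiable ℂ p ∧ Tendsto (fun z => f z - p z) (cocompact ℂ) (𝓝 0) := by
  refine ⟨fun z => cauchyT f (‖z‖ + r + 1) z, fun z => ?_, ?_⟩
  · have h1 : DifferentiableAt ℂ (cauchyT f (‖z‖ + r + 2)) z :=
      cauchyT_diff hf hr (by linarith [norm_nonneg z]) (by linarith)
    refine h1.congr_of_eventuallyEq ?_
    have h2 : ∀ᶠ w : ℂ in 𝓝 z, ‖w‖ < ‖z‖ + 1 :=
      continuous_norm.continuousAt.eventually (gt_mem_nhds (lt_add_one _))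
    filter_upwards [h2] with w hw
    exact (cauchyT_eq hr hf (by linarith [norm_nonneg w]) (by linarith) (by linarith)).symm
  · obtain ⟨B, hB⟩ := (isCompact_sphere (0 : ℂ) (r + 1)).exists_bound_of_continuousOn
      (f := f) fun w hw => by
        have : ‖w‖ = r + 1 := by simpa using hw
        exact (hf w (by linarith)).continuousAt.continuousWithinAt
    have hB0 : 0 ≤ B := (norm_nonneg _).trans (hB ((r + 1 : ℝ) : ℂ) (by
      rw [mem_sphere_zero_iff_norm, norm_real, Real.norm_of_nonneg (by linarith)]))
    have hlim : Tendsto (fun z : ℂ => (r + 1) * B / (‖z‖ - (r + 1))) (cocompact ℂ) (𝓝 0) :=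
      Tendsto.div_atTop tendsto_const_nhds
        (tendsto_atTop_add_const_right _ _ tendsto_norm_cocompact_atTop)
    refine squeeze_zero_norm' ?_ hlim
    filter_upwards [tendsto_norm_cocompact_atTop.eventually_gt_atTop (r + 1)] with z hz
    have h1 := cauchyT_sub hr hf (R := r + 1) (R' := ‖z‖ + r + 1) (z := z) (by linarith) hz
      (by linarith)
    have hz' : 0 < ‖z‖ - (r + 1) := by linarith
    rw [h1, sub_sub_cancel_left, norm_neg, cauchyT, norm_smul, norm_inv]
    have h2 : ‖∮ w in C((0 : ℂ), r + 1), (w - z)⁻¹ • f w‖ ≤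
        2 * Real.pi * (r + 1) * ((‖z‖ - (r + 1))⁻¹ * B) := by
      refine circleIntegral.norm_integral_le_of_norm_le_const (by linarith) fun w hw => ?_
      have hw' : ‖w‖ = r + 1 := by simpa using hw
      rw [norm_smul, norm_inv]
      have h3 : ‖z‖ - (r + 1) ≤ ‖w - z‖ := by
        rw [← hw', norm_sub_rev]; exact norm_sub_norm_le _ _
      have := hB w hw
      gcongr
    have h4 : ‖(2 * Real.pi * I : ℂ)‖ = 2 * Real.pi := by
      simp [abs_of_pos Real.pi_pos]
    rw [h4]
    have hpi := Real.pi_pos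
    calc _ ≤ (2 * Real.pi)⁻¹ * (2 * Real.pi * (r + 1) * ((‖z‖ - (r + 1))⁻¹ * B)) := by gcongr
      _ = _ := by field_simp

lemma entire_eq_zero {p : ℂ → ℂ} (hp : Differentiable ℂ p)
    (ht : Tendsto p (cocompact ℂ) (𝓝 0)) (z : ℂ) : p z = 0 :=
  hp.apply_eq_of_tendsto_cocompact z ht

end Laurent

lemma deriv_eq_zero_of_seq {f : ℂ → ℂ} {f' s : ℂ} (hf : HasDerivAt f f' s) {y : ℕ → ℂ}
    (hy : Tendsto y atTop (𝓝 0)) (hy0 : ∀ n, y n ≠ 0) (he : ∀ n, f (s + y n) = f s) : f' = 0 := by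
  have h4 := (hasDerivAt_iff_tendsto_slope_zero.1 hf).comp
    (tendsto_nhdsWithin_iff.2 ⟨hy, Eventually.of_forall fun n => hy0 n⟩)
  refine tendsto_nhds_unique h4 (tendsto_const_nhds.congr fun n => ?_)
  simp [he]

namespace LeafMap
variable {h k : HenonLike} (L : LeafMap h k)

lemma exists_alpha_const : ∃ a : ℂ, a ≠ 0 ∧ ∀ ζ, 2 * h.rho < ‖ζ‖ → L.alpha ζ = a := by
  have hr := h.one_lt_rho
  have hd1 : (1 : ℝ) < h.e + 1 := by
    have : (1 : ℝ) ≤ h.e := by exact_mod_cast h.he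
    linarith
  set S : Set ℂ := {s | Real.log (2 * h.rho) < s.re} with hS
  have hSo : IsOpen S := isOpen_lt continuous_const continuous_re
  have hSc : IsPreconnected S := (convex_halfSpace_re_gt _).isPreconnected
  have hSn : ∀ s ∈ S, 2 * h.rho < ‖cexp s‖ := fun s hs => by
    rw [norm_exp, ← Real.log_lt_iff_lt_exp (by linarith)]; exact hs
  set g : ℂ → ℂ := fun s => L.alpha (cexp s) with hg
  have hgd : ∀ s ∈ S, DifferentiableAt ℂ g s := fun s hs =>
    DifferentiableAt.comp (g := L.alpha) s (L.alpha_diff (hSn s hs)) differentiableAt_exp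
  have h0 : (h.e + 1 : ℂ) ≠ 0 := by exact_mod_cast h.e.succ_ne_zero
  have hgz : ∀ s ∈ S, deriv g s = 0 := fun s hs => by
    refine deriv_eq_zero_of_seq (hgd s hs).hasDerivAt
      (y := fun n => 2 * Real.pi * I * ((h.e + 1 : ℂ)⁻¹) ^ n) ?_ ?_ ?_
    · have : ‖(h.e + 1 : ℂ)⁻¹‖ < 1 := by
        rw [norm_inv, show (h.e + 1 : ℂ) = ((h.e + 1 : ℝ) : ℂ) by push_cast; rfl, norm_real,
          Real.norm_of_nonneg (by linarith)]
        exact inv_lt_one_of_one_lt₀ hd1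
      simpa using (tendsto_pow_atTop_nhds_zero_of_norm_lt_one this).const_mul (2 * Real.pi * I)
    · intro n
      exact mul_ne_zero Complex.two_pi_I_ne_zero (pow_ne_zero _ (inv_ne_zero h0))
    · intro n
      simp only [hg]
      rw [add_comm, Complex.exp_add]
      refine L.alpha_rot (n := n) (hSn s hs) ?_
      rw [← Complex.exp_nat_mul, Complex.exp_eq_one_iff]
      refine ⟨1, ?_⟩
      push_cast
      rw [inv_pow]
      field_simp
  have hconst : ∀ {x y : ℂ}, x ∈ S → y ∈ S → g x = g y := hSo.is_const_of_deriv_eq_zero hSc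
    (fun s hs => (hgd s hs).differentiableWithinAt) hgz
  have hlog : ∀ ζ : ℂ, 2 * h.rho < ‖ζ‖ → Complex.log ζ ∈ S ∧ g (Complex.log ζ) = L.alpha ζ :=
    fun ζ hζ => by
      have h0 : ζ ≠ 0 := norm_pos_iff.1 (by linarith)
      refine ⟨?_, by simp only [hg]; rw [exp_log h0]⟩
      show Real.log (2 * h.rho) < (Complex.log ζ).re
      rw [Complex.log_re]
      exact Real.log_lt_log (by linarith) hζ
  have hn : ‖((3 * h.rho : ℝ) : ℂ)‖ = 3 * h.rho := by
    rw [norm_real, Real.norm_of_nonneg (by linarith)]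
  have h1 : 2 * h.rho < ‖((3 * h.rho : ℝ) : ℂ)‖ := by linarith
  refine ⟨L.alpha ((3 * h.rho : ℝ) : ℂ), (L.Th_affine h1).1, fun ζ hζ => ?_⟩
  rw [← (hlog ζ hζ).2, ← (hlog _ h1).2]
  exact hconst (hlog ζ hζ).1 (hlog _ h1).1

end LeafMap

section Arithmetic

lemma eventually_one_of_pow_rec {e : ℕ → ℂ} {p : ℕ} (hp : 1 ≤ p)
    (hrec : ∀ n, e (n + 1) = e n ^ (p + 1)) (ht : Tendsto e atTop (𝓝 1)) :
    ∃ n₀, ∀ n, n₀ ≤ n → e n = 1 := by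
  have h1 : Tendsto (fun n => ‖∑ i ∈ Finset.range (p + 1), e n ^ i‖) atTop
      (𝓝 ‖∑ i ∈ Finset.range (p + 1), (1 : ℂ) ^ i‖) :=
    (tendsto_finsetSum _ fun i _ => ht.pow i).norm
  have h2 : (1 : ℝ) < ‖∑ i ∈ Finset.range (p + 1), (1 : ℂ) ^ i‖ := by
    simp only [one_pow, Finset.sum_const, Finset.card_range, nsmul_eq_mul, mul_one, norm_natCast]
    exact_mod_cast Nat.lt_succ_of_le hp
  obtain ⟨n₀, h3⟩ := eventually_atTop.1 (h1.eventually (lt_mem_nhds h2))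
  have hmul : ∀ n, e (n + 1) - 1 = (∑ i ∈ Finset.range (p + 1), e n ^ i) * (e n - 1) := fun n => by
    rw [hrec, geom_sum_mul]
  by_cases hall : e n₀ = 1
  · refine ⟨n₀, fun n hn => ?_⟩
    induction hn with
    | refl => exact hall
    | step _ ih => rw [Nat.succ_eq_add_one, hrec, ih, one_pow]
  · exfalso
    have h4 : ∀ n, n₀ ≤ n → ‖e n₀ - 1‖ ≤ ‖e n - 1‖ := fun n hn => by
      induction hn with
      | refl => exact le_rfl
      | @step m hm ih =>
        rw [Nat.succ_eq_add_one, hmul, norm_mul]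
        have h5 := h3 m hm
        nlinarith [norm_nonneg (e m - 1)]
    have h6 : Tendsto (fun n => ‖e n - 1‖) atTop (𝓝 0) := by
      simpa using (ht.sub_const 1).norm
    exact hall (sub_eq_zero.1 (norm_le_zero_iff.1
      (ge_of_tendsto h6 (eventually_atTop.2 ⟨n₀, h4⟩))))

lemma eventually_eq_of_ratio {A C x y K : ℂ} {p : ℕ} (hp : 1 ≤ p) (hA : A ≠ 0) (hC : C ≠ 0)
    (hx : x ≠ 0) (hy : y ≠ 0) (hK : K ≠ 0)
    (ht : Tendsto (fun n : ℕ => C * y ^ n * K ^ (p + 1) ^ n / (A * x ^ n)) atTop (𝓝 1)) :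
    ∃ n₀, ∀ n, n₀ ≤ n → A * x ^ n = C * y ^ n * K ^ (p + 1) ^ n := by
  set e : ℕ → ℂ := fun n => C * y ^ n * K ^ (p + 1) ^ n / (A * x ^ n) with he
  set z := y / x with hz
  set c := C / A with hc
  have hz0 : z ≠ 0 := div_ne_zero hy hx
  have hc0 : c ≠ 0 := div_ne_zero hC hA
  have heq : ∀ n, e n = c * z ^ n * K ^ (p + 1) ^ n := fun n => by
    simp only [he, hc, hz, div_pow]; field_simp
  have he0 : ∀ n, e n ≠ 0 := fun n => by
    rw [heq]; exact mul_ne_zero (mul_ne_zero hc0 (pow_ne_zero _ hz0)) (pow_ne_zero _ hK)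
  have hT : ∀ n, c ^ p * (z ^ p) ^ n = z * e n ^ (p + 1) / e (n + 1) := fun n => by
    rw [eq_div_iff (he0 _), heq, heq]
    rw [pow_succ (p + 1) n, pow_mul K]
    generalize K ^ (p + 1) ^ n = w
    ring
  have h1 : Tendsto (fun n => c ^ p * (z ^ p) ^ n) atTop (𝓝 z) := by
    have := ((ht.pow (p + 1)).const_mul z).div (ht.comp (tendsto_add_atTop_nat 1)) one_ne_zero
    simp only [one_pow, mul_one, div_one] at this
    exact this.congr fun n => (hT n).symm
  have h2 : z ^ p = 1 := by
    have h3 := h1.const_mul (z ^ p)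
    have h4 := h1.comp (tendsto_add_atTop_nat 1)
    have h5 := tendsto_nhds_unique h4 (h3.congr fun n => by simp only [Function.comp]; ring)
    exact mul_right_cancel₀ hz0 (by rw [one_mul]; exact h5.symm)
  have h3 : c ^ p = z := by
    simp only [h2, one_pow, mul_one] at h1
    exact tendsto_nhds_unique tendsto_const_nhds h1
  have hrec : ∀ n, e (n + 1) = e n ^ (p + 1) := fun n => by
    have h4 := hT n
    rw [h2, h3, one_pow, mul_one, eq_div_iff (he0 _)] at h4
    exact mul_left_cancel₀ hz0 h4
  obtain ⟨n₀, hn⟩ := eventually_one_of_pow_rec hp hrec ht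
  refine ⟨n₀, fun n h => ?_⟩
  have h5 := hn n h
  rw [he, div_eq_one_iff_eq (mul_ne_zero hA (pow_ne_zero _ hx))] at h5
  exact h5.symm

/-- Coefficient sequences produced by a linear Mahler-type recursion `c (d j) = μ c j`, with
`c` supported on multiples of `d` beyond `D`. -/
structure MahlerRec (d D : ℕ) (l : ℂ) (c : ℕ → ℂ) : Prop where
  two_le : 2 ≤ d
  ne_zero : l ≠ 0
  dvd : ∀ j, D < j → c j ≠ 0 → d ∣ j
  mul : ∀ j, D < d * j → c (d * j) = l * c j

namespace MahlerRec
variable {d D : ℕ} {l : ℂ} {c : ℕ → ℂ} (h : MahlerRec d D l c)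
include h

lemma exists_root {j : ℕ} (hj : 1 ≤ j) (hc : c j ≠ 0) :
    ∃ j₀ v, j₀ ∈ Finset.Icc 1 D ∧ j = j₀ * d ^ v := by
  induction j using Nat.strong_induction_on with
  | _ j ih =>
    rcases le_or_gt j D with hD | hD
    · exact ⟨j, 0, Finset.mem_Icc.2 ⟨hj, hD⟩, by simp⟩
    · obtain ⟨i, rfl⟩ := h.dvd j hD hc
      have hi : 1 ≤ i := by rcases i with _ | i <;> simp_all
      rw [h.mul i hD] at hc
      obtain ⟨j₀, v, h1, h2⟩ := ih i (by nlinarith [h.two_le]) hi (right_ne_zero_of_mul hc)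
      exact ⟨j₀, v + 1, h1, by rw [h2]; ring⟩

lemma mul_pow {j : ℕ} (hj : D < j) (v : ℕ) : c (j * d ^ v) = l ^ v * c j := by
  induction v with
  | zero => simp
  | succ v ih =>
    have h1 : 1 ≤ d ^ (v + 1) := Nat.one_le_pow _ _ (by linarith [h.two_le])
    rw [show j * d ^ (v + 1) = d * (j * d ^ v) by ring, h.mul _ (by
      rw [show d * (j * d ^ v) = j * d ^ (v + 1) by ring]; nlinarith), ih]
    ring

lemma lower_bound : ∃ C μ : ℝ, 0 < C ∧ 0 < μ ∧ μ ≤ 1 ∧ ∀ j, 1 ≤ j → c j ≠ 0 → C * μ ^ j ≤ ‖c j‖ := by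
  obtain ⟨C, hC0, hC⟩ : ∃ C : ℝ, 0 < C ∧ ∀ j ∈ Finset.range (D + 1), c j ≠ 0 → C ≤ ‖c j‖ := by
    generalize Finset.range (D + 1) = s
    induction s using Finset.induction_on with
    | empty => exact ⟨1, one_pos, by simp⟩
    | insert a s ha ih =>
      obtain ⟨C, hC0, hC⟩ := ih
      by_cases h0 : c a = 0
      · refine ⟨C, hC0, fun j hj hcj => ?_⟩
        rcases Finset.mem_insert.1 hj with rfl | hj
        · exact absurd h0 hcj
        · exact hC j hj hcj
      · refine ⟨min C ‖c a‖, lt_min hC0 (norm_pos_iff.2 h0), fun j hj hcj => ?_⟩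
        rcases Finset.mem_insert.1 hj with rfl | hj
        · exact min_le_right _ _
        · exact (min_le_left _ _).trans (hC j hj hcj)
  have hl := norm_pos_iff.2 h.ne_zero
  have hm0 : 0 < min 1 ‖l‖ := lt_min one_pos hl
  refine ⟨C, min 1 ‖l‖, hC0, hm0, min_le_left _ _, fun j hj hc => ?_⟩
  induction j using Nat.strong_induction_on with
  | _ j ih =>
    rcases le_or_gt j D with hD | hD
    · have h1 := hC j (Finset.mem_range.2 (by omega)) hc
      have h2 : (min 1 ‖l‖) ^ j ≤ 1 := pow_le_one₀ hm0.le (min_le_left _ _)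
      nlinarith
    · obtain ⟨i, rfl⟩ := h.dvd j hD hc
      have hi : 1 ≤ i := by rcases i with _ | i <;> simp_all
      rw [h.mul i hD] at hc ⊢
      have hlt : i + 1 ≤ d * i := by nlinarith [h.two_le]
      have h3 := ih i (by omega) hi (right_ne_zero_of_mul hc)
      have h4 : (min 1 ‖l‖) ^ (d * i) ≤ (min 1 ‖l‖) ^ (i + 1) :=
        pow_le_pow_of_le_one hm0.le (min_le_left _ _) hlt
      rw [norm_mul]
      calc C * (min 1 ‖l‖) ^ (d * i) ≤ C * (min 1 ‖l‖) ^ (i + 1) := by gcongr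
        _ = min 1 ‖l‖ * (C * (min 1 ‖l‖) ^ i) := by ring
        _ ≤ ‖l‖ * ‖c i‖ := mul_le_mul (min_le_right _ _) h3 (by positivity) hl.le

end MahlerRec

end Arithmetic

section Arithmetic

namespace MahlerRec
variable {d D d' D' : ℕ} {l l' : ℂ} {c c' : ℕ → ℂ}

lemma twist_lower (h : MahlerRec d D l c) {κ : ℂ} (hκ : κ ≠ 0) {M : ℕ} (hM : 0 < M) :
    ∃ C μ : ℝ, 0 < C ∧ 0 < μ ∧ ∀ i, 1 ≤ i → c i ≠ 0 → C * μ ^ (M * i) ≤ ‖κ ^ i * c i‖ := by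
  obtain ⟨C, μ, hC, hμ, hμ1, hlow⟩ := h.lower_bound
  have hν : 0 < min 1 ‖κ‖ := lt_min one_pos (norm_pos_iff.2 hκ)
  have hm : 0 < min 1 ‖κ‖ * μ := mul_pos hν hμ
  have hm1 : min 1 ‖κ‖ * μ ≤ 1 := mul_le_one₀ (min_le_left _ _) hμ.le hμ1
  refine ⟨C, min 1 ‖κ‖ * μ, hC, hm, fun i hi hci => ?_⟩
  have h1 := hlow i hi hci
  have h2 : (min 1 ‖κ‖ * μ) ^ (M * i) ≤ (min 1 ‖κ‖ * μ) ^ i :=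
    pow_le_pow_of_le_one hm.le hm1 (Nat.le_mul_of_pos_left i hM)
  rw [norm_mul, norm_pow]
  calc C * (min 1 ‖κ‖ * μ) ^ (M * i) ≤ C * (min 1 ‖κ‖ * μ) ^ i := by gcongr
    _ = (min 1 ‖κ‖) ^ i * (C * μ ^ i) := by rw [_root_.mul_pow]; ring
    _ ≤ ‖κ‖ ^ i * ‖c i‖ := by
      have : min 1 ‖κ‖ ≤ ‖κ‖ := min_le_right _ _
      gcongr

lemma eventually_not_lower {b : ℕ → ℂ} (ht : ∀ R : ℝ, Tendsto (fun j => ‖b j‖ * R ^ j) atTop (𝓝 0))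
    {C μ : ℝ} (hC : 0 < C) (hμ : 0 < μ) : ∀ᶠ j in atTop, ‖b j‖ < C * μ ^ j := by
  filter_upwards [(ht μ⁻¹).eventually (gt_mem_nhds hC)] with j hj
  rwa [inv_pow, ← div_eq_mul_inv, div_lt_iff₀ (pow_pos hμ j)] at hj

lemma finite_resonant (h : MahlerRec d D l c) (h' : MahlerRec d' D' l' c') {a κ : ℂ} (ha : a ≠ 0)
    (hκ : κ ≠ 0) {M : ℕ} (hM : 0 < M) {b : ℕ → ℂ}
    (hb : ∀ i, 1 ≤ i → b (M * i) = a * c (M * i) - κ ^ i * c' i)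
    (ht : ∀ R : ℝ, Tendsto (fun j => ‖b j‖ * R ^ j) atTop (𝓝 0)) :
    {j | 1 ≤ j ∧ b j ≠ 0 ∧ c j ≠ 0 ∧ ∃ i, j = M * i ∧ c' i ≠ 0}.Finite := by
  set S := {j | 1 ≤ j ∧ b j ≠ 0 ∧ c j ≠ 0 ∧ ∃ i, j = M * i ∧ c' i ≠ 0} with hS
  by_contra hinf
  have hd := h.two_le
  have hd' := h'.two_le
  obtain ⟨j₀, i₀, hinf1⟩ : ∃ j₀ i₀, ¬ {j ∈ S | ∃ v w, j = j₀ * d ^ v ∧ j = M * (i₀ * d' ^ w)}.Finite := by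
    by_contra! hcon
    refine hinf (((Finset.Icc 1 D).finite_toSet.biUnion fun j₀ _ =>
      (Finset.Icc 1 D').finite_toSet.biUnion fun i₀ _ => hcon j₀ i₀).subset fun j hj => ?_)
    obtain ⟨h1, h2, h3, i, rfl, h4⟩ := hj
    obtain ⟨j₀, v, hj₀, hv⟩ := h.exists_root h1 h3
    obtain ⟨i₀, w, hi₀, hw⟩ := h'.exists_root (Nat.pos_of_mul_pos_left h1) h4
    simp only [mem_iUnion]
    exact ⟨j₀, hj₀, i₀, hi₀, ⟨h1, h2, h3, i, rfl, h4⟩, v, w, hv, by rw [← hw]⟩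
  obtain ⟨j₁, ⟨hj₁, v₁, w₁, hv₁, hw₁⟩⟩ := (Set.Infinite.nonempty hinf1)
  obtain ⟨j₂, ⟨hj₂, v₂, w₂, hv₂, hw₂⟩, hlt⟩ := Set.Infinite.exists_gt hinf1 j₁
  have hj1pos : 0 < j₁ := hj₁.1
  have hj₀ : 0 < j₀ := by rcases Nat.eq_zero_or_pos j₀ with rfl | h; · simp at hv₁; omega
                          · exact h
  have hi₀ : 0 < i₀ := by rcases Nat.eq_zero_or_pos i₀ with rfl | h; · simp at hw₁; omega
                          · exact h
  have hv12 : v₁ < v₂ := by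
    rw [hv₁, hv₂] at hlt
    exact (Nat.pow_lt_pow_iff_right hd).1 (lt_of_mul_lt_mul_left hlt hj₀.le)
  have hw12 : w₁ < w₂ := by
    rw [hw₁, hw₂] at hlt
    exact (Nat.pow_lt_pow_iff_right hd').1 (lt_of_mul_lt_mul_left
      (lt_of_mul_lt_mul_left hlt hM.le) hi₀.le)
  obtain ⟨s, rfl⟩ := Nat.exists_eq_add_of_lt hv12
  obtain ⟨t, rfl⟩ := Nat.exists_eq_add_of_lt hw12
  have hδ : d ^ (s + 1) = d' ^ (t + 1) := by
    refine Nat.eq_of_mul_eq_mul_left hj1pos ?_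
    calc j₁ * d ^ (s + 1) = j₂ := by rw [hv₁, hv₂]; ring
      _ = j₁ * d' ^ (t + 1) := by rw [hw₁, hw₂]; ring
  set δ := d ^ (s + 1) with hδ0
  have hδ2 : 2 ≤ δ := hd.trans (Nat.le_self_pow (by omega) d)
  obtain ⟨r, hinf2⟩ : ∃ r, ¬ {j ∈ S | ∃ u w, j = j₀ * d ^ (r + (s + 1) * u) ∧
      j = M * (i₀ * d' ^ w)}.Finite := by
    by_contra! hcon
    refine hinf1 (((Finset.range (s + 1)).finite_toSet.biUnion fun r _ => hcon r).subset ?_)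
    rintro j ⟨hj, v, w, hv, hw⟩
    simp only [mem_iUnion]
    refine ⟨v % (s + 1), Finset.mem_coe.2 (Finset.mem_range.2 (Nat.mod_lt _ s.succ_pos)), hj,
      v / (s + 1), w, by rw [Nat.mod_add_div]; exact hv, hw⟩
  obtain ⟨J, ⟨hJ, u₀, w₀, hu₀, hw₀⟩, hJgt⟩ := Set.Infinite.exists_gt hinf2 (max D (M * D'))
  set I := i₀ * d' ^ w₀ with hI
  have hDJ : D < J := (le_max_left _ _).trans_lt hJgt
  have hDI : D' < I := by
    have := (le_max_right _ _).trans_lt hJgt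
    rw [hw₀] at this
    exact lt_of_mul_lt_mul_left this hM.le
  obtain ⟨hJ1, -, hcJ, I', hI', hcI⟩ := hJ
  have hII : I' = I := Nat.eq_of_mul_eq_mul_left hM (hI'.symm.trans hw₀)
  rw [hII] at hcI
  have hJn : ∀ n, J * δ ^ n = M * (I * δ ^ n) := fun n => by rw [hw₀]; ring
  have hbn : ∀ n, b (J * δ ^ n) = a * c J * (l ^ (s + 1)) ^ n -
      c' I * (l' ^ (t + 1)) ^ n * (κ ^ I) ^ δ ^ n := fun n => by
    have h1 : c (M * (I * δ ^ n)) = (l ^ (s + 1)) ^ n * c J := by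
      rw [← hJn, hδ0, ← pow_mul, h.mul_pow hDJ, pow_mul]
    have h2 : c' (I * δ ^ n) = (l' ^ (t + 1)) ^ n * c' I := by
      rw [hδ, ← pow_mul, h'.mul_pow hDI, pow_mul]
    rw [hJn, hb _ (Nat.mul_pos (by omega) (by positivity)), h1, h2, pow_mul κ]
    ring
  have hA : a * c J ≠ 0 := mul_ne_zero ha hcJ
  have hl : l ^ (s + 1) ≠ 0 := pow_ne_zero _ h.ne_zero
  have hl' : l' ^ (t + 1) ≠ 0 := pow_ne_zero _ h'.ne_zero
  obtain ⟨p, hp⟩ : ∃ p, δ = p + 1 := ⟨δ - 1, by omega⟩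
  have hlim : Tendsto (fun n : ℕ => c' I * (l' ^ (t + 1)) ^ n * (κ ^ I) ^ δ ^ n /
      (a * c J * (l ^ (s + 1)) ^ n)) atTop (𝓝 1) := by
    have hinj : Tendsto (fun n => J * δ ^ n) atTop atTop :=
      tendsto_atTop_mono (fun n => ((Nat.lt_pow_self hδ2).le).trans
        (Nat.le_mul_of_pos_left _ hJ1)) tendsto_id
    set R : ℝ := max 1 ‖l ^ (s + 1)‖⁻¹ with hR
    have h1 := ((ht R).comp hinj).const_mul ‖a * c J‖⁻¹
    rw [mul_zero] at h1
    rw [tendsto_iff_norm_sub_tendsto_zero]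
    refine squeeze_zero (fun _ => norm_nonneg _) (fun n => ?_) h1
    have h2 : c' I * (l' ^ (t + 1)) ^ n * (κ ^ I) ^ δ ^ n / (a * c J * (l ^ (s + 1)) ^ n) - 1 =
        -(b (J * δ ^ n) / (a * c J * (l ^ (s + 1)) ^ n)) := by
      rw [hbn]
      have := pow_ne_zero n hl
      field_simp
      ring
    rw [h2, norm_neg, norm_div, norm_mul, norm_pow ( l ^ (s + 1)), div_eq_mul_inv, mul_inv,
      ← inv_pow]
    have h3 : ‖l ^ (s + 1)‖⁻¹ ^ n ≤ R ^ (J * δ ^ n) :=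
      (pow_le_pow_left₀ (by positivity) (le_max_right _ _) n).trans
        (pow_le_pow_right₀ (le_max_left _ _) (((Nat.lt_pow_self hδ2).le).trans
        (Nat.le_mul_of_pos_left _ hJ1)))
    simp only [Function.comp]
    calc _ = ‖a * c J‖⁻¹ * (‖b (J * δ ^ n)‖ * ‖l ^ (s + 1)‖⁻¹ ^ n) := by ring
      _ ≤ _ := by gcongr
  rw [hp] at hlim
  obtain ⟨n₀, hn₀⟩ := eventually_eq_of_ratio (by omega) hA hcI hl hl' (pow_ne_zero _ hκ) hlim
  refine hinf2 ((Set.finite_lt_nat (J * δ ^ n₀)).subset ?_)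
  rintro j ⟨hj, u, w, hu, hw⟩
  by_contra hge
  have hge : J * δ ^ n₀ ≤ j := not_lt.1 hge
  have huu : u₀ ≤ u := by
    by_contra! hlt
    have h1 : j < J := by
      rw [hu, hu₀]
      have : (s + 1) * u < (s + 1) * u₀ := by nlinarith
      exact Nat.mul_lt_mul_of_pos_left (Nat.pow_lt_pow_right hd (by omega)) hj₀
    have h2 : J ≤ J * δ ^ n₀ := Nat.le_mul_of_pos_right _ (by positivity)
    omega
  obtain ⟨n, rfl⟩ := Nat.exists_eq_add_of_le huu
  have hjn : j = J * δ ^ n := by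
    rw [hu, hu₀, hδ0, ← pow_mul, mul_assoc, ← pow_add]; ring_nf
  have hnn : n₀ ≤ n := by
    rw [hjn] at hge
    exact (Nat.pow_le_pow_iff_right hδ2).1 (le_of_mul_le_mul_left hge hJ1)
  refine hj.2.1 ?_
  rw [hjn, hbn, hn₀ n hnn, ← hp, sub_self]

/-- An entire function whose Taylor coefficients are a combination of two sequences of Mahler type
is a polynomial. -/
lemma eventually_zero (h : MahlerRec d D l c) (h' : MahlerRec d' D' l' c') {a κ : ℂ} (ha : a ≠ 0)
    (hκ : κ ≠ 0) {M : ℕ} (hM : 0 < M) {b : ℕ → ℂ}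
    (hb : ∀ i, 1 ≤ i → b (M * i) = a * c (M * i) - κ ^ i * c' i)
    (hb' : ∀ j, 1 ≤ j → ¬ M ∣ j → b j = a * c j)
    (ht : ∀ R : ℝ, Tendsto (fun j => ‖b j‖ * R ^ j) atTop (𝓝 0)) :
    ∀ᶠ j in atTop, b j = 0 := by
  have hfin := finite_resonant h h' ha hκ hM hb ht
  obtain ⟨N, hN⟩ := hfin.bddAbove
  obtain ⟨C, μ, hC, hμ, -, hlow⟩ := h.lower_bound
  obtain ⟨C', μ', hC', hμ', hlow'⟩ := h'.twist_lower hκ hM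
  filter_upwards [eventually_gt_atTop N, eventually_ge_atTop 1,
    eventually_not_lower ht (mul_pos (norm_pos_iff.2 ha) hC) hμ,
    eventually_not_lower ht hC' hμ'] with j h1 h2 h3 h4
  by_contra hbj
  have key : b j = a * c j → False := fun he => by
    have hc : c j ≠ 0 := fun h0 => hbj (by rw [he, h0, mul_zero])
    have h5 := hlow j h2 hc
    rw [he, norm_mul, mul_assoc] at h3
    exact absurd (lt_of_mul_lt_mul_left h3 (norm_nonneg _)) (not_lt.2 h5)
  by_cases hMj : M ∣ j
  · obtain ⟨i, rfl⟩ := hMj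
    have hi : 1 ≤ i := Nat.pos_of_mul_pos_left h2
    by_cases hci : c' i = 0
    · exact key (by rw [hb i hi, hci]; ring)
    · by_cases hcj : c (M * i) = 0
      · rw [hb i hi, hcj, mul_zero, zero_sub, norm_neg] at h4
        exact absurd h4 (not_lt.2 (hlow' i hi hci))
      · exact absurd (hN ⟨h2, hbj, hcj, i, rfl, hci⟩) (not_le.2 h1)
  · exact key (hb' j h2 hMj)

end MahlerRec

end Arithmetic

lemma tendsto_cocompact_of_norm {f : ℂ → ℂ}
    (h : Tendsto (fun z => ‖f z‖) (cocompact ℂ) atTop) : Tendsto f (cocompact ℂ) (cocompact ℂ) := by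
  rw [← Metric.cobounded_eq_cocompact] at h ⊢
  exact tendsto_norm_atTop_iff_cobounded.1 h

lemma tendsto_mul_pow_cocompact {κ : ℂ} (hκ : κ ≠ 0) {n : ℕ} (hn : n ≠ 0) :
    Tendsto (fun z : ℂ => κ * z ^ n) (cocompact ℂ) (cocompact ℂ) := by
  refine tendsto_cocompact_of_norm ?_
  simp only [norm_mul, norm_pow]
  exact ((tendsto_pow_atTop hn).comp tendsto_norm_cocompact_atTop).const_mul_atTop
    (norm_pos_iff.2 hκ)

/-- An entire function of polynomial growth near infinity is a polynomial. -/
lemma exists_polynomial_of_eventually {f : ℂ → ℂ} (hf : Differentiable ℂ f) {n : ℕ} {C : ℝ}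
    (h : ∀ᶠ z in cocompact ℂ, ‖f z‖ ≤ C * (1 + ‖z‖) ^ n) :
    ∃ P : Polynomial ℂ, ∀ z, f z = P.eval z := by
  obtain ⟨K, hK, hKs⟩ := mem_cocompact.1 h
  obtain ⟨B, hB⟩ := hK.exists_bound_of_continuousOn hf.continuous.continuousOn
  obtain ⟨P, -, hP⟩ := exists_polynomial_of_growth n hf (C := max C (max B 0)) (fun z => by
    have h1 : (1 : ℝ) ≤ (1 + ‖z‖) ^ n := one_le_pow₀ (by linarith [norm_nonneg z])
    by_cases hz : z ∈ K
    · calc ‖f z‖ ≤ B := hB z hz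
        _ ≤ max C (max B 0) := (le_max_left _ _).trans (le_max_right _ _)
        _ ≤ _ := le_mul_of_one_le_right ((le_max_right _ _).trans (le_max_right _ _)) h1
    · refine le_trans (hKs hz) ?_
      gcongr
      exact le_max_left _ _)
  exact ⟨P, hP⟩

section MahlerSum

open Polynomial

/-- The truncated Mahler sum `∑_{i<n} l^i q(X^(d^i))`. -/
def mahlerSum (q : ℂ[X]) (l : ℂ) (d n : ℕ) : ℂ[X] :=
  ∑ i ∈ Finset.range n, C (l ^ i) * expand ℂ (d ^ i) q

variable {q : ℂ[X]} {l : ℂ} {d : ℕ}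

lemma mahlerSum_succ (n : ℕ) :
    mahlerSum q l d (n + 1) = q + C l * expand ℂ d (mahlerSum q l d n) := by
  rw [mahlerSum, Finset.sum_range_succ', mahlerSum, map_sum, Finset.mul_sum, add_comm]
  simp only [pow_zero, C_1, one_mul, expand_one, map_mul, expand_C, expand_expand]
  congr 1
  refine Finset.sum_congr rfl fun i _ => ?_
  rw [← pow_succ' d, pow_succ' l, C_mul, mul_assoc]

lemma coeff_mahlerSum_succ (hd : 2 ≤ d) (n j : ℕ) : (mahlerSum q l d (n + 1)).coeff j =
    q.coeff j + l * if d ∣ j then (mahlerSum q l d n).coeff (j / d) else 0 := by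
  rw [mahlerSum_succ, coeff_add, coeff_C_mul, coeff_expand (by omega)]

lemma coeff_mahlerSum_stable (hd : 2 ≤ d) {j n : ℕ} (hj : 1 ≤ j) (hn : j ≤ n) :
    (mahlerSum q l d n).coeff j = (mahlerSum q l d j).coeff j := by
  induction hn with
  | refl => rfl
  | @step m hm ih =>
    rw [← ih, Nat.succ_eq_add_one, mahlerSum, Finset.sum_range_succ, coeff_add, coeff_C_mul,
      coeff_expand (by positivity), if_neg, mul_zero, add_zero]
    · rfl
    · intro h
      have h1 := Nat.le_of_dvd hj h
      have h2 : m < d ^ m := Nat.lt_pow_self hd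
      have h3 : j ≤ m := hm
      omega

lemma mahlerRec_coeff (hd : 2 ≤ d) (hl : l ≠ 0) :
    MahlerRec d q.natDegree l (fun j => (mahlerSum q l d j).coeff j) where
  two_le := hd
  ne_zero := hl
  dvd j hj hc := by
    obtain ⟨n, rfl⟩ : ∃ n, j = n + 1 := ⟨j - 1, by omega⟩
    by_contra hcon
    refine hc ?_
    rw [coeff_mahlerSum_succ hd, if_neg hcon, coeff_eq_zero_of_natDegree_lt hj]
    simp
  mul j hj := by
    have hj1 : 1 ≤ j := by rcases j with _ | j <;> simp_all
    have h1 : j ≤ d * j := Nat.le_mul_of_pos_left j (by omega)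
    rw [← coeff_mahlerSum_stable hd (hj1.trans h1) (Nat.le_succ _), Nat.succ_eq_add_one,
      coeff_mahlerSum_succ hd, if_pos (dvd_mul_right _ _), Nat.mul_div_cancel_left _ (by omega),
      coeff_eq_zero_of_natDegree_lt hj, zero_add, coeff_mahlerSum_stable hd hj1 h1]

end MahlerSum

section Taylor

lemma iteratedDeriv_eq_zero_of_rot {f : ℂ → ℂ} (hf : Differentiable ℂ f) {ω : ℂ}
    (h : ∀ z, f z = f (ω * z)) {j : ℕ} (hj : ω ^ j ≠ 1) : iteratedDeriv j f 0 = 0 := by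
  have h1 : iteratedDeriv j f 0 = ω ^ j * iteratedDeriv j f 0 := by
    have h2 := congrFun (iteratedDeriv_comp_const_mul (n := j) hf.contDiff ω) 0
    rw [← funext h] at h2
    simpa using h2
  have h3 : (1 - ω ^ j) * iteratedDeriv j f 0 = 0 := by linear_combination h1
  exact (mul_eq_zero.1 h3).resolve_left (sub_ne_zero.2 hj.symm)

lemma iteratedDeriv_polynomial (P : Polynomial ℂ) (j : ℕ) :
    iteratedDeriv j (fun z => P.eval z) 0 = j.factorial * P.coeff j := by
  have h1 : ∀ (j : ℕ) (P : Polynomial ℂ), deriv^[j] (fun z => P.eval z) =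
      fun z => (Polynomial.derivative^[j] P).eval z := fun j => by
    induction j with
    | zero => exact fun P => rfl
    | succ j ih =>
      intro P
      rw [Function.iterate_succ_apply, Function.iterate_succ_apply, ← ih]
      congr 1
      ext z
      exact P.deriv
  rw [iteratedDeriv_eq_iterate, h1]
  simp only
  rw [← Polynomial.coeff_zero_eq_eval_zero, Polynomial.coeff_iterate_derivative, zero_add,
    Nat.descFactorial_self, nsmul_eq_mul]

lemma tendsto_taylor {f : ℂ → ℂ} (hf : Differentiable ℂ f) (R : ℝ) :
    Tendsto (fun j : ℕ => ‖(j.factorial : ℂ)⁻¹ * iteratedDeriv j f 0‖ * R ^ j) atTop (𝓝 0) := by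
  have h1 := (Complex.hasSum_taylorSeries_of_entire hf 0 R).summable.tendsto_atTop_zero.norm
  rw [tendsto_zero_iff_norm_tendsto_zero]
  rw [norm_zero] at h1
  refine h1.congr fun j => ?_
  simp only [sub_zero, smul_eq_mul, norm_mul, norm_pow, norm_norm, norm_real]
  ring

lemma polynomial_of_taylor {f : ℂ → ℂ} (hf : Differentiable ℂ f)
    (h : ∀ᶠ j : ℕ in atTop, (j.factorial : ℂ)⁻¹ * iteratedDeriv j f 0 = 0) :
    ∃ P : Polynomial ℂ, ∀ z, f z = P.eval z := by
  obtain ⟨N, hN⟩ := eventually_atTop.1 h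
  refine ⟨∑ j ∈ Finset.range N, Polynomial.monomial j ((j.factorial : ℂ)⁻¹ * iteratedDeriv j f 0),
    fun z => ?_⟩
  have h1 := Complex.hasSum_taylorSeries_of_entire hf 0 z
  have h2 := hasSum_sum_of_ne_finset_zero (L := SummationFilter.unconditional ℕ) (s := Finset.range N)
    (f := fun n : ℕ => ((n.factorial : ℂ)⁻¹ • (z - 0) ^ n • iteratedDeriv n f 0)) (fun j hj => by
      have h3 := hN j (not_lt.1 fun h => hj (Finset.mem_range.2 h))
      simp only [smul_eq_mul]
      linear_combination (z - 0) ^ j * h3)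
  rw [h1.unique h2, Polynomial.eval_finsetSum]
  refine Finset.sum_congr rfl fun j _ => ?_
  rw [Polynomial.eval_monomial, smul_eq_mul, smul_eq_mul, sub_zero]
  ring

end Taylor

namespace HenonLike

lemma exists_Q_polynomial (h : HenonLike) : ∃ q : Polynomial ℂ,
    Tendsto (fun z => h.Q z - q.eval z) (cocompact ℂ) (𝓝 0) := by
  have hR : (0 : ℝ) ≤ 4 * h.R := by linarith [h.hC, h.hR]
  have ho : IsOpen {ζ : ℂ | 4 * h.R < ‖ζ‖} := isOpen_lt continuous_const continuous_norm
  obtain ⟨p, hp, hpt⟩ := exists_laurent hR (fun ζ hζ =>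
    h.differentiableOn_Q.differentiableAt (ho.mem_nhds hζ))
  obtain ⟨q, hq⟩ := exists_polynomial_of_eventually hp (n := 2 * h.e + 1) (C := h.CQ + 1) (by
    filter_upwards [tendsto_norm_cocompact_atTop.eventually_gt_atTop (4 * h.R),
      hpt.norm.eventually (gt_mem_nhds (show ‖(0 : ℂ)‖ < 1 by simp))] with z h1 h2
    have h3 : ‖h.Q z‖ ≤ h.CQ * ‖z‖ ^ (2 * h.e + 1) := h.norm_Q h1
    have h4 : (1 : ℝ) ≤ (1 + ‖z‖) ^ (2 * h.e + 1) := one_le_pow₀ (by linarith [norm_nonneg z])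
    have h5 : ‖z‖ ^ (2 * h.e + 1) ≤ (1 + ‖z‖) ^ (2 * h.e + 1) := by gcongr; linarith
    have h6 : ‖p z‖ ≤ ‖h.Q z‖ + ‖h.Q z - p z‖ := by
      have := norm_sub_le (h.Q z) (h.Q z - p z)
      rwa [sub_sub_cancel] at this
    nlinarith [mul_le_mul_of_nonneg_left h5 h.CQ_nonneg])
  exact ⟨q, hpt.congr fun z => by rw [hq]⟩

lemma tendsto_Qn (h : HenonLike) {q : Polynomial ℂ}
    (hq : Tendsto (fun z => h.Q z - q.eval z) (cocompact ℂ) (𝓝 0)) (n : ℕ) :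
    Tendsto (fun z => h.Qn n z - (mahlerSum q h.lam (h.e + 1) n).eval z) (cocompact ℂ) (𝓝 0) := by
  have h1 := tendsto_finsetSum (Finset.range n) fun i _ =>
    ((hq.comp (tendsto_mul_pow_cocompact one_ne_zero
      (pow_ne_zero i (Nat.succ_ne_zero h.e)))).const_mul (h.lam ^ i))
  simp only [mul_zero, Finset.sum_const_zero] at h1
  refine h1.congr fun z => ?_
  rw [Qn, mahlerSum, Polynomial.eval_finsetSum, ← Finset.sum_sub_distrib]
  refine Finset.sum_congr rfl fun i _ => ?_
  simp [mul_sub]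

end HenonLike

namespace LeafMap
variable {h k : HenonLike} (L : LeafMap h k)

open Polynomial in
/-- The entire part of the translation component is a polynomial. -/
lemma exists_beta_polynomial : ∃ P : ℂ[X],
    Tendsto (fun z => L.beta z - P.eval z) (cocompact ℂ) (𝓝 0) := by
  have hr := h.one_lt_rho
  obtain ⟨B, hB, hBt⟩ := exists_laurent (show (0 : ℝ) ≤ 2 * h.rho by linarith)
    (fun ζ hζ => L.beta_diff hζ)
  obtain ⟨a, ha, haζ⟩ := L.exists_alpha_const
  obtain ⟨q, hq⟩ := h.exists_Q_polynomial
  obtain ⟨q', hq'⟩ := k.exists_Q_polynomial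
  have hd : 2 ≤ h.e + 1 := by have := h.he; omega
  have hd' : 2 ≤ k.e + 1 := by have := k.he; omega
  have hM := L.M_pos
  set S := mahlerSum q h.lam (h.e + 1) with hS
  set S' := mahlerSum q' k.lam (k.e + 1) with hS'
  set T : ℕ → ℕ → ℂ[X] := fun n m =>
    C a * S n - expand ℂ L.M ((S' m).comp (C L.κ * X)) with hT
  have hTe : ∀ n m z, (T n m).eval z = a * (S n).eval z - (S' m).eval (L.cov z) := fun n m z => by
    simp [hT, expand_eval, LeafMap.cov]
  have hcov : Tendsto L.cov (cocompact ℂ) (cocompact ℂ) :=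
    tendsto_mul_pow_cocompact L.hκ hM.ne'
  have hcoeff : ∀ j, 1 ≤ j → ∃ m, j ≤ m ∧
      ((j.factorial : ℂ)⁻¹ * iteratedDeriv j B 0 = (T j m).coeff j) := fun j hj => by
    have hj0 : (h.e + 1) ^ j ≠ 0 := by positivity
    set ω := cexp (2 * Real.pi * I / ((h.e + 1) ^ j : ℕ)) with hω
    have hprim : IsPrimitiveRoot ω ((h.e + 1) ^ j) := Complex.isPrimitiveRoot_exp _ hj0
    have hω0 : ω ≠ 0 := Complex.exp_ne_zero _
    have hωn : ‖ω‖ = 1 := Complex.norm_eq_one_of_pow_eq_one hprim.pow_eq_one hj0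
    obtain ⟨N, hN⟩ := L.beta_rot_uniform hprim.pow_eq_one
    set m := max N j with hm
    refine ⟨m, le_max_right _ _, ?_⟩
    have hrot : Tendsto (fun z : ℂ => ω * z) (cocompact ℂ) (cocompact ℂ) := by
      simpa using tendsto_mul_pow_cocompact hω0 one_ne_zero
    set E : ℂ → ℂ := fun z => B z - (T j m).eval z with hE
    have hEd : Differentiable ℂ E := hB.sub (T j m).differentiable
    have hE0 : ∀ z, E z = E (ω * z) := fun z => by
      rw [← sub_eq_zero]
      refine entire_eq_zero (p := fun z => E z - E (ω * z))
        (hEd.sub (hEd.comp (differentiable_id.const_mul ω))) ?_ z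
      have t1 := h.tendsto_Qn hq j
      have t2 := (k.tendsto_Qn hq' m).comp hcov
      have t3 := ((hBt.sub (t1.const_mul a)).add t2)
      have t4 := (t3.comp hrot).sub t3
      simp only [mul_zero, sub_zero, add_zero] at t4
      refine t4.congr' ?_
      filter_upwards [tendsto_norm_cocompact_atTop.eventually_gt_atTop (2 * h.rho)] with z hz
      have h2 := hN m (le_max_left _ _) z hz
      rw [haζ z hz] at h2
      simp only [hE, hTe, Function.comp]
      linear_combination -h2
    have h3 := iteratedDeriv_eq_zero_of_rot hEd hE0 (j := j)
      (hprim.pow_ne_one_of_pos_of_lt (by omega) (Nat.lt_pow_self hd))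
    rw [hE, iteratedDeriv_fun_sub hB.contDiff.contDiffAt
      (T j m).differentiable.contDiff.contDiffAt, iteratedDeriv_polynomial, sub_eq_zero] at h3
    rw [h3, inv_mul_cancel_left₀ (Nat.cast_ne_zero.2 j.factorial_ne_zero)]
  have hb : ∀ i, 1 ≤ i → ((L.M * i).factorial : ℂ)⁻¹ * iteratedDeriv (L.M * i) B 0 =
      a * (S (L.M * i)).coeff (L.M * i) - L.κ ^ i * (S' i).coeff i := fun i hi => by
    obtain ⟨m, hm, he⟩ := hcoeff (L.M * i) (Nat.mul_pos hM hi)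
    rw [he]
    simp only [hT, coeff_sub, coeff_C_mul, coeff_expand hM, dvd_mul_right, if_true,
      Nat.mul_div_cancel_left _ hM, comp_C_mul_X_coeff]
    rw [hS', coeff_mahlerSum_stable hd' hi ((Nat.le_mul_of_pos_left i hM).trans hm)]
    ring
  have hb' : ∀ j, 1 ≤ j → ¬ L.M ∣ j → (j.factorial : ℂ)⁻¹ * iteratedDeriv j B 0 =
      a * (S j).coeff j := fun j hj hMj => by
    obtain ⟨m, hm, he⟩ := hcoeff j hj
    rw [he]
    simp only [hT, coeff_sub, coeff_C_mul, coeff_expand hM, hMj, if_false, sub_zero]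
  obtain ⟨P, hP⟩ := polynomial_of_taylor hB (MahlerRec.eventually_zero
    (mahlerRec_coeff (q := q) hd h.lam_ne) (mahlerRec_coeff (q := q') hd' k.lam_ne) ha L.hκ hM
    hb hb' (tendsto_taylor hB))
  exact ⟨P, hBt.congr fun z => by rw [hP]⟩

end LeafMap

/-- `f` is polynomially bounded on `s`. -/
def PolyBdd (s : Set (ℂ × ℂ)) (f : ℂ × ℂ → ℂ × ℂ) : Prop :=
  ∃ (n : ℕ) (c : ℝ), ∀ z ∈ s, ‖f z‖ ≤ c * (1 + ‖z‖) ^ n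

lemma PolyBdd.comp {s : Set (ℂ × ℂ)} {f g : ℂ × ℂ → ℂ × ℂ} (hg : PolyBdd univ g)
    (hf : PolyBdd s f) : PolyBdd s (fun z => g (f z)) := by
  obtain ⟨n, c, hc⟩ := hf
  obtain ⟨m, c', hc'⟩ := hg
  have h0 : 0 ≤ c' := by simpa using (norm_nonneg _).trans (hc' 0 trivial)
  refine ⟨n * m, c' * (1 + |c|) ^ m, fun z hz => (hc' _ trivial).trans ?_⟩
  have h1 : (1 : ℝ) ≤ (1 + ‖z‖) ^ n := one_le_pow₀ (by linarith [norm_nonneg z])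
  have h2 : 1 + ‖f z‖ ≤ (1 + |c|) * (1 + ‖z‖) ^ n := by
    have := hc z hz
    nlinarith [le_abs_self c]
  calc c' * (1 + ‖f z‖) ^ m ≤ c' * ((1 + |c|) * (1 + ‖z‖) ^ n) ^ m := by gcongr
    _ = _ := by rw [mul_pow, ← pow_mul]; ring

lemma PolyBdd.iterate {g : ℂ × ℂ → ℂ × ℂ} (hg : PolyBdd univ g) (m : ℕ) :
    PolyBdd univ (g^[m]) := by
  induction m with
  | zero => exact ⟨1, 1, fun z _ => by simp⟩
  | succ m ih =>
    rw [Function.iterate_succ']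
    exact hg.comp ih

lemma norm_eval_le (P : Polynomial ℂ) :
    ∃ C : ℝ, 0 ≤ C ∧ ∀ z, ‖P.eval z‖ ≤ C * (1 + ‖z‖) ^ P.natDegree := by
  refine ⟨∑ i ∈ Finset.range (P.natDegree + 1), ‖P.coeff i‖,
    Finset.sum_nonneg fun _ _ => norm_nonneg _, fun z => ?_⟩
  rw [Polynomial.eval_eq_sum_range, Finset.sum_mul]
  refine (norm_sum_le _ _).trans (Finset.sum_le_sum fun i hi => ?_)
  rw [norm_mul, norm_pow]
  have h1 : ‖z‖ ^ i ≤ (1 + ‖z‖) ^ i := by gcongr; linarith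
  have h2 : (1 + ‖z‖) ^ i ≤ (1 + ‖z‖) ^ P.natDegree :=
    pow_le_pow_right₀ (by linarith [norm_nonneg z]) (Nat.lt_succ_iff.1 (Finset.mem_range.1 hi))
  gcongr
  exact h1.trans h2

lemma isPolyMap_of_polyBdd {f : ℂ × ℂ → ℂ × ℂ} (hf : Differentiable ℂ f) (h : PolyBdd univ f) :
    IsPolyMap f := by
  obtain ⟨n, c, hc⟩ := h
  obtain ⟨P, hP⟩ := exists_mvPolynomial_of_growth (f := fun z => (f z).1)
    (fun z => (hf z).fst) n (C := c) (fun z => (norm_fst_le _).trans (hc z trivial))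
  obtain ⟨Q, hQ⟩ := exists_mvPolynomial_of_growth (f := fun z => (f z).2)
    (fun z => (hf z).snd) n (C := c) (fun z => (norm_snd_le _).trans (hc z trivial))
  exact ⟨P, Q, fun z => Prod.ext (hP z) (hQ z)⟩

/-- The maximum principle on vertical discs propagates polynomial bounds from a vertical cone to
the whole plane. -/
lemma norm_le_of_cone {f : ℂ × ℂ → ℂ × ℂ} (hf : Differentiable ℂ f) {A B : ℝ} (hA : 1 ≤ A)
    (hB : 0 ≤ B) (h : PolyBdd {z | B < ‖z.2‖ ∧ A * ‖z.1‖ < ‖z.2‖} f) : PolyBdd univ f := by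
  obtain ⟨n, c, hc⟩ := h
  have h00 : 0 ≤ c := by
    have h1 := (norm_nonneg _).trans (hc (0, ((B + 1 : ℝ) : ℂ)) ⟨by
      rw [norm_real, Real.norm_of_nonneg (by linarith)]; linarith, by
      rw [norm_real, Real.norm_of_nonneg (by linarith)]; simp; linarith⟩)
    exact nonneg_of_mul_nonneg_left h1 (by positivity)
  refine ⟨n, c * (A + B + 2) ^ n, fun z _ => ?_⟩
  set r : ℝ := A * ‖z.1‖ + ‖z.2‖ + B + 1 with hr
  have hn1 := norm_fst_le z
  have hn2 := norm_snd_le z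
  have hz1 := norm_nonneg z.1
  have hz2 := norm_nonneg z.2
  have hAz : 0 ≤ A * ‖z.1‖ := by positivity
  have hr0 : 0 < r := by linarith
  have h1 : ∀ w ∈ frontier (Metric.ball (0 : ℂ) r), ‖f (z.1, w)‖ ≤ c * (1 + r) ^ n := by
    intro w hw
    rw [frontier_ball _ hr0.ne', mem_sphere_zero_iff_norm] at hw
    refine (hc (z.1, w) ⟨by simp only [hw]; linarith, by simp only [hw]; linarith⟩).trans ?_
    have : ‖(z.1, w)‖ = r := by
      rw [Prod.norm_mk, hw, max_eq_right]
      nlinarith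
    rw [this]
  have h2 : ‖f (z.1, z.2)‖ ≤ c * (1 + r) ^ n := by
    refine Complex.norm_le_of_forall_mem_frontier_norm_le Metric.isBounded_ball
      (f := fun w => f (z.1, w)) ?_ h1 (subset_closure ?_)
    · exact (hf.comp ((differentiable_const _).prodMk differentiable_id)).diffContOnCl
    · rw [mem_ball_zero_iff]; linarith
  refine h2.trans ?_
  rw [mul_assoc, ← mul_pow]
  have h3 : 1 + r ≤ (A + B + 2) * (1 + ‖z‖) := by
    have : A * ‖z.1‖ ≤ A * ‖z‖ := by gcongr
    nlinarith [norm_nonneg z]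
  gcongr

namespace LeafMap
variable {h k : HenonLike} (L : LeafMap h k)

lemma exists_beta_bound : ∃ (D : ℕ) (C ρ : ℝ), 0 ≤ C ∧
    ∀ ζ, ρ < ‖ζ‖ → ‖L.beta ζ‖ ≤ C * (1 + ‖ζ‖) ^ D := by
  obtain ⟨P, hP⟩ := L.exists_beta_polynomial
  obtain ⟨C, hC0, hC⟩ := norm_eval_le P
  have h1 := hP.norm.eventually (gt_mem_nhds (show ‖(0 : ℂ)‖ < 1 by simp))
  obtain ⟨K, hK, hKs⟩ := mem_cocompact.1 h1
  obtain ⟨ρ, hρ⟩ := hK.isBounded.subset_closedBall 0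
  refine ⟨P.natDegree, C + 1, ρ, by linarith, fun ζ hζ => ?_⟩
  have h2 : ‖L.beta ζ - P.eval ζ‖ < 1 := hKs fun hcon => by
    have := hρ hcon
    rw [mem_closedBall_zero_iff] at this
    linarith
  have h3 : (1 : ℝ) ≤ (1 + ‖ζ‖) ^ P.natDegree := one_le_pow₀ (by linarith [norm_nonneg ζ])
  have h4 := norm_le_norm_add_norm_sub' (L.beta ζ) (P.eval ζ)
  have h5 := hC ζ
  linarith

lemma polyBdd_cone : ∃ B : ℝ, 0 ≤ B ∧ PolyBdd {z | B < ‖z.2‖ ∧ 128 * ‖z.1‖ < ‖z.2‖} L.ψ := by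
  obtain ⟨D, C, ρ, hC0, hβ⟩ := L.exists_beta_bound
  obtain ⟨a, ha, haζ⟩ := L.exists_alpha_const
  have hM := L.M_pos
  have hκ := norm_pos_iff.2 L.hκ
  have hr := h.one_lt_rho
  have hCh := h.hC
  have hRh := h.R_ge
  set A : ℝ := 2 * ‖a‖ + 2 ^ D * C with hA
  have hA0 : 0 ≤ A := by positivity
  set B : ℝ := 2 * h.rho + h.R + 4 * h.C + |ρ| + A + (‖L.κ‖ ^ 2)⁻¹ + 1 with hB
  have hκi : 0 < (‖L.κ‖ ^ 2)⁻¹ := by positivity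
  have hρ0 := abs_nonneg ρ
  have hρ1 := le_abs_self ρ
  set m := 2 * D + 5 with hm
  set d := (k.e + 1) ^ m with hd
  have hlam : PolyBdd {z | B < ‖z.2‖ ∧ 128 * ‖z.1‖ < ‖z.2‖} (fun z => k.H^[m] (L.ψ z)) := by
    refine ⟨L.M * d, 2 * ‖L.κ‖ ^ d * 2 ^ (L.M * d), fun z hz => ?_⟩
    obtain ⟨hz1, hz2⟩ := hz
    have hzU : z ∈ h.U := ⟨by linarith, hz2⟩
    have hzV := h.U_sub_V hzU
    set ζ := h.b z with hζ
    set s := ‖ζ‖ with hs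
    have hs1 := h.norm_snd_le hzV
    have hs2 := h.norm_b_le hzV
    have hs1' : s > 1 := by linarith
    have hsρ : 2 * h.rho < s := by linarith
    have hu2 : h.chart z ∈ P2 h := hsρ
    have hcov : ‖L.cov ζ‖ = ‖L.κ‖ * s ^ L.M := by rw [LeafMap.cov, norm_mul, norm_pow]
    have hfst : ‖z.1‖ ≤ s := by linarith [norm_nonneg z.1, h.hR]
    have hth : ‖h.theta z‖ ≤ 2 * s * s := by
      refine (h.norm_theta (h.U_sub_V2 hzU)).trans ?_
      gcongr
    have hTh : ‖L.Th (h.chart z)‖ ≤ s ^ (D + 3) := by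
      have e1 : L.Th (h.chart z) = a * h.theta z + L.beta ζ := by
        rw [← haζ ζ hsρ]; exact (L.Th_affine hsρ).2 _
      have e2 : ‖L.beta ζ‖ ≤ C * (1 + s) ^ D := hβ ζ (by linarith)
      have e3 : (1 + s) ^ D ≤ 2 ^ D * s ^ D := by
        rw [← mul_pow]; gcongr; linarith
      have e4 : s ^ D ≤ s ^ (D + 2) := pow_le_pow_right₀ hs1'.le (by omega)
      have e5 : s ^ 2 ≤ s ^ (D + 2) := pow_le_pow_right₀ hs1'.le (by omega)
      calc ‖L.Th (h.chart z)‖ ≤ ‖a‖ * ‖h.theta z‖ + ‖L.beta ζ‖ := by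
            rw [e1, ← norm_mul]; exact norm_add_le _ _
        _ ≤ ‖a‖ * (2 * s * s) + C * (2 ^ D * s ^ D) := by
            gcongr
            exact e2.trans (by gcongr)
        _ = 2 * ‖a‖ * s ^ 2 + 2 ^ D * C * s ^ D := by ring
        _ ≤ 2 * ‖a‖ * s ^ (D + 2) + 2 ^ D * C * s ^ (D + 2) := by gcongr
        _ = A * s ^ (D + 2) := by rw [hA]; ring
        _ ≤ s * s ^ (D + 2) := by gcongr; linarith
        _ = s ^ (D + 3) := by ring
    have hsc : s ≤ ‖L.cov ζ‖ ^ 2 := by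
      have e1 : s ≤ s ^ L.M := le_self_pow₀ hs1'.le hM.ne'
      have e2 : 1 ≤ ‖L.κ‖ ^ 2 * s := by
        have e3 : (‖L.κ‖ ^ 2)⁻¹ ≤ s := by linarith
        calc (1 : ℝ) = ‖L.κ‖ ^ 2 * (‖L.κ‖ ^ 2)⁻¹ := by field_simp
          _ ≤ _ := by gcongr
      calc s = 1 * s := (one_mul s).symm
        _ ≤ ‖L.κ‖ ^ 2 * s * s := by gcongr
        _ = (‖L.κ‖ * s) ^ 2 := by ring
        _ ≤ ‖L.cov ζ‖ ^ 2 := by rw [hcov]; gcongr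
    have hmem : k.hat^[m] (L.Th (h.chart z), L.cov ζ) ∈ k.W := by
      refine k.hat_iter_mem_W (2 * D + 4) (L.cov_mem hu2 _) ?_
      calc ‖L.Th (h.chart z)‖ ≤ s ^ (D + 3) := hTh
        _ ≤ (‖L.cov ζ‖ ^ 2) ^ (D + 3) := by gcongr
        _ = _ := by rw [← pow_mul]; congr 1
    have hE : L.ψ z = k.E (L.Th (h.chart z), L.cov ζ) := by
      have := L.E_Th hu2
      rw [h.E_chart hzU] at this
      exact this.symm
    show ‖k.H^[m] (L.ψ z)‖ ≤ _
    rw [hE, k.H_iter_E (u := (L.Th (h.chart z), L.cov ζ)) (L.cov_mem hu2 _) hmem]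
    refine (k.norm_Lam hmem).trans ?_
    have hsnd : (k.hat^[m] (L.Th (h.chart z), L.cov ζ)).2 = L.cov ζ ^ d := by rw [k.hat_iter]
    have hs3 : s ≤ 2 * (1 + ‖z‖) := by
      have := norm_snd_le z
      linarith
    rw [hsnd, norm_pow, hcov]
    calc 2 * (‖L.κ‖ * s ^ L.M) ^ d = 2 * ‖L.κ‖ ^ d * s ^ (L.M * d) := by
          rw [mul_pow, ← pow_mul]; ring
      _ ≤ 2 * ‖L.κ‖ ^ d * (2 * (1 + ‖z‖)) ^ (L.M * d) := by gcongr
      _ = _ := by rw [mul_pow]; ring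
  refine ⟨B, by positivity, ?_⟩
  obtain ⟨n, c, hc⟩ := k.growthi
  have hi : PolyBdd univ k.Hi := ⟨n, c, fun z _ => hc z⟩
  have := (hi.iterate m).comp hlam
  simpa only [k.Hi_iter_H_iter] using this

end LeafMap

/-- An injective holomorphic map respecting the escaping sets is polynomially bounded. -/
theorem polyBdd_of_escaping {h k : HenonLike} {ψ : ℂ × ℂ → ℂ × ℂ} (hψ : Differentiable ℂ ψ)
    (hinj : Function.Injective ψ) (hK : ∀ z, z ∉ h.K → ψ z ∉ k.K) : PolyBdd univ ψ := by
  obtain ⟨N₀, κ, M, hκ, hbig, hleaf⟩ := HenonLike.exists_leaf hψ hK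
  let L : LeafMap h k :=
    { ψ := fun z => k.H^[N₀] (ψ z)
      diff := (k.differentiable_iter N₀).comp hψ
      inj := fun x y e => hinj (k.H_iter_inj N₀ e)
      κ := κ
      M := M
      hκ := hκ
      big := hbig
      leaf := hleaf }
  obtain ⟨B, hB, hb⟩ := L.polyBdd_cone
  have h1 : PolyBdd univ L.ψ := norm_le_of_cone L.diff (by norm_num) hB hb
  obtain ⟨n, c, hc⟩ := k.growthi
  have hi : PolyBdd univ k.Hi := ⟨n, c, fun z _ => hc z⟩
  have h2 := (hi.iterate N₀).comp h1
  have h3 : ∀ z, k.Hi^[N₀] (L.ψ z) = ψ z := fun z => k.Hi_iter_H_iter N₀ (ψ z)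
  simpa only [h3] using h2

lemma norm_leadingCoeff_mul_le (p : Polynomial ℂ) {f : ℂ → ℂ} (hf : Differentiable ℂ f) {B : ℝ}
    (hB : ∀ s, ‖s‖ = 1 → ‖p.eval s * f s‖ ≤ B) : ‖p.leadingCoeff * f 0‖ ≤ B := by
  set r := (p.map (starRingEnd ℂ)).reverse with hr
  have h1 : ∀ s : ℂ, ‖s‖ = 1 → ‖r.eval s‖ = ‖p.eval s‖ := by
    intro s hs
    have hs0 : s ≠ 0 := by rintro rfl; simp at hs
    have hinv : s⁻¹ = starRingEnd ℂ s := by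
      rw [Complex.inv_def, Complex.normSq_eq_norm_sq, hs]; simp
    let _ : Invertible s⁻¹ := invertibleOfNonzero (inv_ne_zero hs0)
    have h2 := Polynomial.eval₂_reverse_mul_pow (RingHom.id ℂ) (s⁻¹)
      (p.map (starRingEnd ℂ))
    rw [invOf_eq_inv, inv_inv, ← hr] at h2
    have h3 := congrArg norm h2
    simp only [norm_mul, norm_pow, norm_inv, hs, inv_one, one_pow, mul_one] at h3
    rw [show r.eval s = Polynomial.eval₂ (RingHom.id ℂ) s r by simp [Polynomial.eval₂_id], h3,
      Polynomial.eval₂_id, hinv, Polynomial.eval_map, Polynomial.eval₂_at_apply]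
    exact RCLike.norm_conj _
  have h4 : ‖r.eval 0‖ = ‖p.leadingCoeff‖ := by
    rw [← Polynomial.coeff_zero_eq_eval_zero, hr, Polynomial.coeff_zero_reverse,
      Polynomial.leadingCoeff_map]
    exact RCLike.norm_conj _
  have h5 := Complex.norm_le_of_forall_mem_frontier_norm_le (f := fun s => r.eval s * f s)
    (U := Metric.ball (0 : ℂ) 1) Metric.isBounded_ball
    (r.differentiable.mul hf).diffContOnCl (C := B) (z := 0) ?_
    (subset_closure (Metric.mem_ball_self one_pos))
  · rwa [norm_mul, h4, ← norm_mul] at h5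
  · intro s hs
    rw [frontier_ball _ one_ne_zero, mem_sphere_zero_iff_norm] at hs
    rw [norm_mul, h1 s hs, ← norm_mul]
    exact hB s hs

/-- A polynomial cannot be uniformly small on a unit polydisc, even after division by a holomorphic
function. -/
lemma exists_division_bound (n : ℕ) : ∀ q : MvPolynomial (Fin n) ℂ, q ≠ 0 → ∃ c : ℝ, 0 < c ∧
    ∀ f : (Fin n → ℂ) → ℂ, Differentiable ℂ f → ∀ (w : Fin n → ℂ) (B : ℝ),
      (∀ s, (∀ i, ‖s i‖ ≤ 1) → ‖MvPolynomial.eval (w + s) q * f (w + s)‖ ≤ B) →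
        c * ‖f w‖ ≤ B := by
  induction n with
  | zero =>
    intro q hq
    have h1 := MvPolynomial.eq_C_of_isEmpty q
    refine ⟨‖q.coeff 0‖, ?_, fun f _ w B hB => ?_⟩
    · rw [norm_pos_iff]
      intro h
      rw [h, map_zero] at h1
      exact hq h1
    · have h2 := hB 0 (fun i => by simp)
      rw [h1, MvPolynomial.eval_C, add_zero, norm_mul] at h2
      exact h2
  | succ n ih =>
    intro q hq
    set P := MvPolynomial.finSuccEquiv ℂ n q with hP
    have hP0 : P ≠ 0 := by
      rw [hP]; simpa using hq
    obtain ⟨c, hc, h⟩ := ih P.leadingCoeff (by simpa using hP0)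
    refine ⟨c, hc, fun f hf w B hB => ?_⟩
    have hw : w = Fin.cons (w 0) (Fin.tail w) := (Fin.cons_self_tail w).symm
    have hd1 : Differentiable ℂ (fun v : Fin n → ℂ => (Fin.cons (w 0) v : Fin (n + 1) → ℂ)) := by
      rw [differentiable_pi]
      intro i
      refine Fin.cases ?_ (fun j => ?_) i
      · simp only [Fin.cons_zero]; fun_prop
      · simp only [Fin.cons_succ]; fun_prop
    have h1 := h (fun v => f (Fin.cons (w 0) v)) (hf.comp hd1) (Fin.tail w) B ?_
    · rwa [← hw] at h1
    intro s hs
    set v := Fin.tail w + s with hv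
    have hd2 : Differentiable ℂ (fun t : ℂ => (Fin.cons (w 0 + t) v : Fin (n + 1) → ℂ)) := by
      rw [differentiable_pi]
      intro i
      refine Fin.cases ?_ (fun j => ?_) i
      · simp only [Fin.cons_zero]; fun_prop
      · simp only [Fin.cons_succ]; fun_prop
    have key := norm_leadingCoeff_mul_le
      (Polynomial.taylor (w 0) (P.map (MvPolynomial.eval v))) (hf.comp hd2) (B := B) ?_
    · rw [Polynomial.leadingCoeff_taylor] at key
      simp only [Function.comp, add_zero] at key
      by_cases h0 : MvPolynomial.eval v P.leadingCoeff = 0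
      · rw [h0, zero_mul, norm_zero]
        exact (norm_nonneg _).trans key
      · rwa [Polynomial.leadingCoeff_map_of_leadingCoeff_ne_zero _ h0] at key
    · intro t ht
      have h2 := hB (Fin.cons t s) (fun i => by
        refine Fin.cases ?_ (fun j => ?_) i
        · simp [ht]
        · simpa using hs j)
      have h3 : w + Fin.cons t s = Fin.cons (w 0 + t) v := by
        ext i
        refine Fin.cases ?_ (fun j => ?_) i
        · simp
        · simp [hv, Fin.tail]
      rw [h3, MvPolynomial.eval_eq_eval_mv_eval'] at h2
      rw [Polynomial.taylor_eval, add_comm t]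
      exact h2

/-- `u` grows at most polynomially. -/
def PolyGrowth {X : Type*} [Norm X] (u : X → ℝ) : Prop :=
  ∃ (n : ℕ) (c : ℝ), 0 ≤ c ∧ ∀ w, u w ≤ c * (1 + ‖w‖) ^ n

lemma PolyGrowth.add {X : Type*} [SeminormedAddGroup X] {u v : X → ℝ} (hu : PolyGrowth u)
    (hv : PolyGrowth v) : PolyGrowth (fun w => u w + v w) := by
  obtain ⟨n, c, hc, h⟩ := hu
  obtain ⟨m, d, hd, h'⟩ := hv
  refine ⟨n + m, c + d, by positivity, fun w => ?_⟩
  have h1 : (1 : ℝ) ≤ 1 + ‖w‖ := by linarith [norm_nonneg w]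
  have h2 : (1 + ‖w‖) ^ n ≤ (1 + ‖w‖) ^ (n + m) := pow_le_pow_right₀ h1 (by omega)
  have h3 : (1 + ‖w‖) ^ m ≤ (1 + ‖w‖) ^ (n + m) := pow_le_pow_right₀ h1 (by omega)
  nlinarith [h w, h' w, mul_le_mul_of_nonneg_left h2 hc, mul_le_mul_of_nonneg_left h3 hd]

lemma PolyGrowth.sum {X ι : Type*} [SeminormedAddGroup X] (s : Finset ι) {u : ι → X → ℝ}
    (hu : ∀ i, PolyGrowth (u i)) : PolyGrowth (fun w => ∑ i ∈ s, u i w) := by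
  classical
  induction s using Finset.induction_on with
  | empty => exact ⟨0, 0, le_rfl, fun w => by simp⟩
  | insert i s hi ih =>
    simp only [Finset.sum_insert hi]
    exact (hu i).add ih

lemma PolyGrowth.eval {n : ℕ} (p : MvPolynomial (Fin n) ℂ) :
    PolyGrowth (fun w : Fin n → ℂ => ‖MvPolynomial.eval w p‖) := by
  induction p using MvPolynomial.induction_on with
  | C a => exact ⟨0, ‖a‖, norm_nonneg _, fun w => by simp⟩
  | add p q hp hq =>
    obtain ⟨m, c, hc, h⟩ := hp.add hq
    refine ⟨m, c, hc, fun w => ?_⟩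
    beta_reduce
    rw [map_add]
    exact (norm_add_le _ _).trans (h w)
  | mul_X p i hp =>
    obtain ⟨m, c, hc, h⟩ := hp
    refine ⟨m + 1, c, hc, fun w => ?_⟩
    beta_reduce
    rw [map_mul, MvPolynomial.eval_X, norm_mul, pow_succ, ← mul_assoc]
    have := norm_le_pi_norm w i
    gcongr
    · exact h w
    · linarith

lemma exists_algebraic_relation (g : Fin 3 → MvPolynomial (Fin 2) ℂ) :
    ∃ r : MvPolynomial (Fin 3) ℂ, r ≠ 0 ∧ MvPolynomial.aeval g r = 0 := by
  by_contra! h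
  have h1 : AlgebraicIndependent ℂ g :=
    algebraicIndependent_iff.2 fun p hp => by_contra fun h0 => h p h0 hp
  have h2 := h1.lift_cardinalMk_le_trdeg
  rw [MvPolynomial.trdeg_of_isDomain] at h2
  simp at h2
  exact absurd h2 (by norm_cast)

lemma norm_leading_mul_le (p : Polynomial ℂ) (k : ℕ) (hk : p.natDegree ≤ k) {y : ℂ}
    (h : p.eval y = 0) : ‖p.coeff k * y‖ ≤ ∑ i ∈ Finset.range (k + 1), ‖p.coeff i‖ := by
  rw [Polynomial.eval_eq_sum_range' (Nat.lt_succ_of_le hk)] at h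
  rcases le_or_gt ‖y‖ 1 with hy | hy
  · calc ‖p.coeff k * y‖ ≤ ‖p.coeff k‖ := by
          rw [norm_mul]; exact mul_le_of_le_one_right (norm_nonneg _) hy
      _ ≤ _ := Finset.single_le_sum (f := fun i => ‖p.coeff i‖) (fun i _ => norm_nonneg _)
        (Finset.self_mem_range_succ k)
  · rw [Finset.sum_range_succ, add_comm, add_eq_zero_iff_eq_neg] at h
    rcases k with _ | k
    · simp at h
      simp [h]
    · have h1 : ‖p.coeff (k + 1) * y‖ * ‖y‖ ^ k ≤
          (∑ i ∈ Finset.range (k + 1), ‖p.coeff i‖) * ‖y‖ ^ k := by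
        rw [← norm_pow, ← norm_mul, mul_assoc, ← pow_succ', h, norm_neg, Finset.sum_mul]
        refine (norm_sum_le _ _).trans (Finset.sum_le_sum fun i hi => ?_)
        rw [norm_mul, norm_pow, norm_pow]
        have : i ≤ k := by simpa [Nat.lt_succ_iff] using hi
        gcongr
        exact hy.le
      have h2 := le_of_mul_le_mul_right h1 (by positivity)
      rw [Finset.sum_range_succ]
      linarith [norm_nonneg (p.coeff (k + 1))]

lemma norm_vecCons (z : ℂ × ℂ) : ‖(![z.1, z.2] : Fin 2 → ℂ)‖ = ‖z‖ := by
  apply le_antisymm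
  · rw [pi_norm_le_iff_of_nonneg (norm_nonneg _)]
    intro i
    fin_cases i
    · exact norm_fst_le z
    · exact norm_snd_le z
  · exact max_le (norm_le_pi_norm (![z.1, z.2] : Fin 2 → ℂ) 0)
      (norm_le_pi_norm (![z.1, z.2] : Fin 2 → ℂ) 1)

lemma polyGrowth_eval_comp {ψ φ : ℂ × ℂ → ℂ × ℂ} (hψ : IsPolyMap ψ)
    (h : ∀ z, ψ (φ z) = z) (A : MvPolynomial (Fin 2) ℂ) {f : ℂ × ℂ → ℂ} (hf : Differentiable ℂ f)
    (hfA : ∀ z, f z = MvPolynomial.eval ![(φ z).1, (φ z).2] A) :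
    PolyGrowth (fun z => ‖f z‖) := by
  obtain ⟨P, Q, hPQ⟩ := hψ
  obtain ⟨r, hr, hr0⟩ := exists_algebraic_relation ![A, P, Q]
  set S := MvPolynomial.finSuccEquiv ℂ 2 r with hS
  have hS0 : S ≠ 0 := by
    rw [hS]; simpa using hr
  obtain ⟨c, hc, hdiv⟩ := exists_division_bound 2 S.leadingCoeff (by simpa using hS0)
  obtain ⟨n, C, hC, hgr⟩ := PolyGrowth.sum (Finset.range (S.natDegree + 1))
    (fun i => PolyGrowth.eval (S.coeff i))
  have hrel : ∀ w : Fin 2 → ℂ,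
      (S.map (MvPolynomial.eval w)).eval (f (w 0, w 1)) = 0 := by
    intro w
    rw [hS, ← MvPolynomial.eval_eq_eval_mv_eval']
    set z : ℂ × ℂ := (w 0, w 1) with hz
    have h1 := congrArg (MvPolynomial.eval ![(φ z).1, (φ z).2]) hr0
    have hC : (MvPolynomial.eval ![(φ z).1, (φ z).2]).comp
        (algebraMap ℂ (MvPolynomial (Fin 2) ℂ)) = RingHom.id ℂ := by
      ext x
      simp [MvPolynomial.algebraMap_eq]
    have hv : (fun i => MvPolynomial.eval ![(φ z).1, (φ z).2]
        ((![A, P, Q] : Fin 3 → MvPolynomial (Fin 2) ℂ) i)) = Fin.cons (f z) w := by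
      have h2 := (hPQ (φ z)).symm.trans (h z)
      ext i
      fin_cases i
      · exact (hfA z).symm
      · exact congrArg Prod.fst h2
      · exact congrArg Prod.snd h2
    rw [map_zero, MvPolynomial.map_aeval, hC, hv] at h1
    exact h1
  have hbound : ∀ w : Fin 2 → ℂ, ‖MvPolynomial.eval w S.leadingCoeff * f (w 0, w 1)‖ ≤
      C * (1 + ‖w‖) ^ n := by
    intro w
    have h1 := norm_leading_mul_le _ S.natDegree Polynomial.natDegree_map_le (hrel w)
    simp only [Polynomial.coeff_map] at h1
    exact h1.trans (hgr w)
  refine ⟨n, c⁻¹ * (C * 2 ^ n), by positivity, fun z => ?_⟩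
  have h1 := hdiv (fun w => f (w 0, w 1)) (by fun_prop) ![z.1, z.2] (C * 2 ^ n * (1 + ‖z‖) ^ n) ?_
  · rw [mul_assoc, inv_mul_eq_div, le_div_iff₀' hc]
    exact h1
  · intro s hs
    refine (hbound _).trans ?_
    rw [mul_assoc, ← mul_pow]
    have h2 : ‖s‖ ≤ 1 := (pi_norm_le_iff_of_nonneg zero_le_one).2 hs
    have h3 := norm_add_le (![z.1, z.2] : Fin 2 → ℂ) s
    rw [norm_vecCons] at h3
    gcongr
    linarith [norm_nonneg z]

theorem isPolyMap_of_leftInverse {ψ φ : ℂ × ℂ → ℂ × ℂ} (hψ : IsPolyMap ψ)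
    (hφ : Differentiable ℂ φ) (h : ∀ z, ψ (φ z) = z) : IsPolyMap φ := by
  obtain ⟨n, c, hc, h1⟩ := polyGrowth_eval_comp hψ h (MvPolynomial.X 0)
    (f := fun z => (φ z).1) (by fun_prop) (by simp)
  obtain ⟨m, d, hd, h2⟩ := polyGrowth_eval_comp hψ h (MvPolynomial.X 1)
    (f := fun z => (φ z).2) (by fun_prop) (by simp)
  obtain ⟨k, b, hb, h3⟩ := PolyGrowth.add ⟨n, c, hc, h1⟩ ⟨m, d, hd, h2⟩
  refine isPolyMap_of_polyBdd hφ ⟨k, b, fun z _ => (max_le ?_ ?_).trans (h3 z)⟩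
  · linarith [norm_nonneg (φ z).2]
  · linarith [norm_nonneg (φ z).1]

lemma norm_pow_sub_pow_le {u v : ℂ} {M : ℝ} (hu : ‖u‖ ≤ M) (hv : ‖v‖ ≤ M) (n : ℕ) :
    ‖u ^ (n + 1) - v ^ (n + 1)‖ ≤ (n + 1) * M ^ n * ‖u - v‖ := by
  have hM : 0 ≤ M := (norm_nonneg u).trans hu
  induction n with
  | zero => simp
  | succ n ih =>
    have h1 : u ^ (n + 1 + 1) - v ^ (n + 1 + 1) =
        u * (u ^ (n + 1) - v ^ (n + 1)) + (u - v) * v ^ (n + 1) := by ring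
    rw [h1]
    refine (norm_add_le _ _).trans ?_
    rw [norm_mul, norm_mul, norm_pow]
    calc ‖u‖ * ‖u ^ (n + 1) - v ^ (n + 1)‖ + ‖u - v‖ * ‖v‖ ^ (n + 1)
        ≤ M * ((n + 1) * M ^ n * ‖u - v‖) + ‖u - v‖ * M ^ (n + 1) := by gcongr
      _ = _ := by push_cast; ring

/-- A nonconstant composition of simple Hénon maps, with leading term `c * y ^ (e + 1)` and
Jacobian `a`, together with the estimates it satisfies. -/
structure IsComposite (G Gi : ℂ × ℂ → ℂ × ℂ) (e : ℕ) (c a : ℂ) : Prop where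
  he : 1 ≤ e
  hc : c ≠ 0
  ha : a ≠ 0
  diff : Differentiable ℂ G
  diffi : Differentiable ℂ Gi
  left : ∀ z, Gi (G z) = z
  right : ∀ z, G (Gi z) = z
  jac : ∀ z, dx (fun w => (G w).1) z * dy (fun w => (G w).2) z -
    dy (fun w => (G w).1) z * dx (fun w => (G w).2) z = a
  growthi : PolyBdd univ Gi
  est : ∃ C R : ℝ, 1 ≤ C ∧ 1 ≤ R ∧
    (∀ z : ℂ × ℂ, R ≤ ‖z.2‖ → ‖z.1‖ ≤ ‖z.2‖ →
      ‖(G z).2 - c * z.2 ^ (e + 1)‖ ≤ C * ‖z.2‖ ^ e ∧ ‖(G z).1‖ ≤ C * ‖z.2‖ ^ e) ∧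
    ∀ R', R ≤ R' → ∀ z : ℂ × ℂ,
      (R' < ‖z.2‖ → ‖z.1‖ < ‖z.2‖ →
        R' < ‖(G z).2‖ ∧ ‖(G z).1‖ < ‖(G z).2‖ ∧ 2 * ‖z.2‖ ≤ ‖(G z).2‖) ∧
      ∀ M, R' ≤ M → ‖z‖ ≤ M →
        ‖G z‖ ≤ M ∨ (R' < ‖(G z).2‖ ∧ ‖(G z).1‖ < ‖(G z).2‖)

lemma isComposite_henonStep {p : Polynomial ℂ} {a : ℂ} (hp : 2 ≤ p.natDegree) (ha : a ≠ 0) :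
    IsComposite (henonStep p a) (henonStepInv p a) (p.natDegree - 1) p.leadingCoeff a := by
  have hp0 : p.leadingCoeff ≠ 0 := by
    rw [Polynomial.leadingCoeff_ne_zero]; rintro rfl; simp at hp
  obtain ⟨e, he⟩ : ∃ e, p.natDegree = e + 1 := ⟨p.natDegree - 1, by omega⟩
  have he1 : 1 ≤ e := by omega
  rw [show p.natDegree - 1 = e by omega]
  have hd := p.differentiable
  obtain ⟨B, hB, hpB⟩ := norm_eval_le p
  have hid : ∀ z : ℂ × ℂ, 1 + ‖z‖ ≤ (1 + ‖z‖) ^ (e + 1) := fun z =>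
    le_self_pow₀ (by linarith [norm_nonneg z]) (by omega)
  refine ⟨he1, hp0, ha, ?_, ?_, fun z => ?_, fun z => ?_, fun z => ?_, ?_, ?_⟩
  · exact differentiable_snd.prodMk ((hd.comp differentiable_snd).sub
      (differentiable_fst.const_mul a))
  · have h1 : Differentiable ℂ (fun z : ℂ × ℂ => (p.eval z.1 - z.2) / a) := by
      have h0 : Differentiable ℂ (fun z : ℂ × ℂ => p.eval z.1) := hd.comp differentiable_fst
      fun_prop
    exact h1.prodMk differentiable_fst
  · simp [henonStep, henonStepInv, ha]
  · ext
    · simp [henonStep, henonStepInv]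
    · simp only [henonStep, henonStepInv]; field_simp; ring
  · simp only [dx, dy, henonStep]
    simp
  · refine ⟨e + 1, 1 + (B + 1) / ‖a‖, fun z _ => ?_⟩
    have h1 := hpB z.1
    have h2 : (1 + ‖z.1‖) ^ p.natDegree ≤ (1 + ‖z‖) ^ (e + 1) := by
      rw [he]; gcongr; exact norm_fst_le z
    have h3 := norm_fst_le z
    have h4 := norm_snd_le z
    have h5 := hid z
    have h6 : (0 : ℝ) ≤ (1 + ‖z‖) ^ (e + 1) := by positivity
    have h7 : B * (1 + ‖z.1‖) ^ p.natDegree ≤ B * (1 + ‖z‖) ^ (e + 1) := by gcongr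
    have ha' : 0 < ‖a‖ := norm_pos_iff.2 ha
    refine max_le ?_ ?_
    · change ‖(p.eval z.1 - z.2) / a‖ ≤ _
      have h8 := norm_sub_le (p.eval z.1) z.2
      have h9 : ‖p.eval z.1 - z.2‖ ≤ (B + 1) * (1 + ‖z‖) ^ (e + 1) := by nlinarith
      calc ‖(p.eval z.1 - z.2) / a‖ ≤ (B + 1) * (1 + ‖z‖) ^ (e + 1) / ‖a‖ := by
            rw [norm_div]; gcongr
        _ = (B + 1) / ‖a‖ * (1 + ‖z‖) ^ (e + 1) := by ring
        _ ≤ _ := by gcongr; linarith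
    · change ‖z.1‖ ≤ _
      have : 0 ≤ (B + 1) / ‖a‖ := by positivity
      nlinarith
  obtain ⟨B', hB', hpB'⟩ := norm_eval_le p.eraseLead
  set C := 1 + ‖a‖ + B' * 2 ^ e with hC
  have hc0 : 0 < ‖p.leadingCoeff‖ := norm_pos_iff.2 hp0
  have hC1 : 1 ≤ C := by
    have : 0 ≤ B' * 2 ^ e := by positivity
    linarith [norm_nonneg a]
  have hR1 : 1 ≤ 1 + (C + 2) / ‖p.leadingCoeff‖ := by
    have : 0 ≤ (C + 2) / ‖p.leadingCoeff‖ := by positivity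
    linarith
  have hest : ∀ z : ℂ × ℂ, 1 ≤ ‖z.2‖ → ‖z.1‖ ≤ ‖z.2‖ →
      ‖(henonStep p a z).2 - p.leadingCoeff * z.2 ^ (e + 1)‖ ≤ C * ‖z.2‖ ^ e ∧
        ‖(henonStep p a z).1‖ ≤ C * ‖z.2‖ ^ e := by
    intro z h1 h2
    have h3 : ‖z.2‖ ≤ ‖z.2‖ ^ e := le_self_pow₀ h1 (by omega)
    constructor
    · have h4 : (henonStep p a z).2 - p.leadingCoeff * z.2 ^ (e + 1) =
          p.eraseLead.eval z.2 - a * z.1 := by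
        have h5 := congrArg (Polynomial.eval z.2) p.eraseLead_add_monomial_natDegree_leadingCoeff
        simp only [Polynomial.eval_add, Polynomial.eval_monomial, he] at h5
        simp only [henonStep]
        rw [← h5]; ring
      rw [h4]
      refine (norm_sub_le _ _).trans ?_
      have h6 : ‖p.eraseLead.eval z.2‖ ≤ B' * 2 ^ e * ‖z.2‖ ^ e := by
        have h7 : p.eraseLead.natDegree ≤ e := by
          have := p.eraseLead_natDegree_le; omega
        calc _ ≤ B' * (1 + ‖z.2‖) ^ p.eraseLead.natDegree := hpB' _
          _ ≤ B' * (1 + ‖z.2‖) ^ e := by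
            gcongr
            linarith
          _ ≤ B' * (2 * ‖z.2‖) ^ e := by gcongr; linarith
          _ = _ := by rw [mul_pow]; ring
      have h8 : ‖a * z.1‖ ≤ ‖a‖ * ‖z.2‖ ^ e := by
        rw [norm_mul]; gcongr; exact h2.trans h3
      nlinarith [norm_nonneg a]
    · change ‖z.2‖ ≤ _
      nlinarith
  refine ⟨C, 1 + (C + 2) / ‖p.leadingCoeff‖, hC1, hR1, fun z hz => hest z (hR1.trans hz),
    fun R' hR' z => ⟨fun h1 h2 => ?_, fun M hM hz => ?_⟩⟩
  · have h3 : 1 ≤ ‖z.2‖ := by linarith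
    have h4 := (hest z h3 h2.le).1
    have h5 := norm_sub_norm_le (p.leadingCoeff * z.2 ^ (e + 1))
      (p.leadingCoeff * z.2 ^ (e + 1) - (henonStep p a z).2)
    rw [sub_sub_cancel, norm_sub_rev (p.leadingCoeff * _), norm_mul, norm_pow, pow_succ] at h5
    have h6 : ‖z.2‖ ≤ ‖z.2‖ ^ e := le_self_pow₀ h3 (by omega)
    have h7 : C + 2 ≤ ‖p.leadingCoeff‖ * ‖z.2‖ := by
      have : (C + 2) / ‖p.leadingCoeff‖ ≤ ‖z.2‖ := by linarith
      rw [div_le_iff₀ hc0] at this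
      linarith
    have h8 : 2 * ‖z.2‖ ≤ ‖(henonStep p a z).2‖ := by
      have : (C + 2) * ‖z.2‖ ^ e ≤ ‖p.leadingCoeff‖ * ‖z.2‖ * ‖z.2‖ ^ e := by gcongr
      nlinarith
    refine ⟨by linarith, ?_, h8⟩
    change ‖z.2‖ < _
    linarith
  · have h1 : ‖(henonStep p a z).1‖ ≤ M := (norm_snd_le z).trans hz
    rcases le_or_gt ‖(henonStep p a z).2‖ M with h2 | h2
    · exact Or.inl (max_le h1 h2)
    · exact Or.inr ⟨by linarith, by linarith⟩

lemma dx_comp {f : ℂ × ℂ → ℂ} {g : ℂ × ℂ → ℂ × ℂ} (hf : Differentiable ℂ f)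
    (hg : Differentiable ℂ g) (z : ℂ × ℂ) : dx (fun w => f (g w)) z =
      dx f (g z) * dx (fun w => (g w).1) z + dy f (g z) * dx (fun w => (g w).2) z :=
  (hasDerivAt_comp_pair isOpen_univ hf.differentiableOn trivial
    (hasDerivAt_dx (z := z) hg.fst.differentiableAt)
    (hasDerivAt_dx (z := z) hg.snd.differentiableAt)).deriv

lemma dy_comp {f : ℂ × ℂ → ℂ} {g : ℂ × ℂ → ℂ × ℂ} (hf : Differentiable ℂ f)
    (hg : Differentiable ℂ g) (z : ℂ × ℂ) : dy (fun w => f (g w)) z =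
      dx f (g z) * dy (fun w => (g w).1) z + dy f (g z) * dy (fun w => (g w).2) z :=
  (hasDerivAt_comp_pair isOpen_univ hf.differentiableOn trivial
    (hasDerivAt_dy (z := z) hg.fst.differentiableAt)
    (hasDerivAt_dy (z := z) hg.snd.differentiableAt)).deriv

lemma IsComposite.comp {G Gi F Fi : ℂ × ℂ → ℂ × ℂ} {e e' : ℕ} {c a c' a' : ℂ}
    (hF : IsComposite F Fi e' c' a') (hG : IsComposite G Gi e c a) :
    IsComposite (fun z => F (G z)) (fun z => Gi (Fi z)) (e + (e + 1) * e')
      (c' * c ^ (e' + 1)) (a' * a) := by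
  have he := hG.he
  have he' := hF.he
  refine ⟨by omega, mul_ne_zero hF.hc (pow_ne_zero _ hG.hc), mul_ne_zero hF.ha hG.ha,
    hF.diff.comp hG.diff, hG.diffi.comp hF.diffi, fun z => ?_, fun z => ?_, fun z => ?_,
    hG.growthi.comp hF.growthi, ?_⟩
  · rw [hF.left, hG.left]
  · rw [hG.right, hF.right]
  · rw [dx_comp (f := fun w => (F w).1) hF.diff.fst hG.diff,
      dx_comp (f := fun w => (F w).2) hF.diff.snd hG.diff,
      dy_comp (f := fun w => (F w).1) hF.diff.fst hG.diff,
      dy_comp (f := fun w => (F w).2) hF.diff.snd hG.diff, ← hF.jac (G z), ← hG.jac z]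
    ring
  obtain ⟨C, R, hC, hR, hest, hdyn⟩ := hG.est
  obtain ⟨C', R', hC', hR', hest', hdyn'⟩ := hF.est
  have hc : 0 < ‖c‖ := norm_pos_iff.2 hG.hc
  have hpos : 0 ≤ 2 * C / ‖c‖ := by positivity
  set A := ‖c‖ + C with hA
  have hA1 : 1 ≤ A := by linarith
  set K := ‖c'‖ * ((e' + 1) * A ^ e' * C) with hK
  have hK0 : 0 ≤ K := by positivity
  have hAp : 1 ≤ A ^ e' := one_le_pow₀ hA1
  refine ⟨K + C' * A ^ e', max R R' + 2 * C / ‖c‖, by nlinarith,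
    by linarith [le_max_left R R'], fun z h1 h2 => ?_, fun R₁ hR₁ z => ⟨fun h1 h2 => ?_,
      fun M hM hz => ?_⟩⟩
  · have hzR : R ≤ ‖z.2‖ := by linarith [le_max_left R R']
    have hzR' : R' ≤ ‖z.2‖ := by linarith [le_max_right R R']
    have hz1 : 1 ≤ ‖z.2‖ := hR.trans hzR
    obtain ⟨h3, h4⟩ := hest z hzR h2
    have hcy : 2 * C ≤ ‖c‖ * ‖z.2‖ := by
      have : 2 * C / ‖c‖ ≤ ‖z.2‖ := by linarith [le_max_left R R']
      rw [div_le_iff₀ hc] at this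
      linarith
    have hp : ‖z.2‖ ≤ ‖z.2‖ ^ e := le_self_pow₀ hz1 (by omega)
    have h5 : C * ‖z.2‖ ^ e ≤ ‖(G z).2‖ := by
      have h6 := norm_sub_norm_le (c * z.2 ^ (e + 1)) (c * z.2 ^ (e + 1) - (G z).2)
      rw [sub_sub_cancel, norm_sub_rev (c * _), norm_mul, norm_pow, pow_succ] at h6
      have : 2 * C * ‖z.2‖ ^ e ≤ ‖c‖ * ‖z.2‖ * ‖z.2‖ ^ e := by gcongr
      nlinarith
    have h6 : ‖(G z).2‖ ≤ A * ‖z.2‖ ^ (e + 1) := by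
      have h7 := norm_add_le ((G z).2 - c * z.2 ^ (e + 1)) (c * z.2 ^ (e + 1))
      rw [sub_add_cancel, norm_mul, norm_pow] at h7
      have h8 : ‖z.2‖ ^ e ≤ ‖z.2‖ ^ (e + 1) := pow_le_pow_right₀ hz1 (by omega)
      nlinarith
    obtain ⟨h7, h8⟩ := hest' (G z) (by nlinarith) (h4.trans h5)
    have h9 : C' * ‖(G z).2‖ ^ e' ≤ C' * A ^ e' * ‖z.2‖ ^ (e + (e + 1) * e') := by
      calc C' * ‖(G z).2‖ ^ e' ≤ C' * (A * ‖z.2‖ ^ (e + 1)) ^ e' := by gcongr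
        _ = C' * A ^ e' * ‖z.2‖ ^ ((e + 1) * e') := by rw [mul_pow, ← pow_mul]; ring
        _ ≤ _ := by
          gcongr
          omega
    have hKp : 0 ≤ K * ‖z.2‖ ^ (e + (e + 1) * e') := by positivity
    refine ⟨?_, by nlinarith⟩
    have h10 := norm_pow_sub_pow_le (u := (G z).2) (v := c * z.2 ^ (e + 1)) h6 (by
      rw [norm_mul, norm_pow]; gcongr; linarith) e'
    have h11 : ‖c' * ((G z).2 ^ (e' + 1) - (c * z.2 ^ (e + 1)) ^ (e' + 1))‖ ≤
        K * ‖z.2‖ ^ (e + (e + 1) * e') := by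
      rw [norm_mul]
      calc _ ≤ ‖c'‖ * ((e' + 1) * (A * ‖z.2‖ ^ (e + 1)) ^ e' * (C * ‖z.2‖ ^ e)) := by
            gcongr
            exact h10.trans (by gcongr)
        _ = _ := by rw [mul_pow, ← pow_mul, pow_add]; ring
    have h12 : (F (G z)).2 - c' * c ^ (e' + 1) * z.2 ^ (e + (e + 1) * e' + 1) =
        ((F (G z)).2 - c' * (G z).2 ^ (e' + 1)) +
          c' * ((G z).2 ^ (e' + 1) - (c * z.2 ^ (e + 1)) ^ (e' + 1)) := by
      rw [mul_pow, ← pow_mul, show e + (e + 1) * e' + 1 = (e + 1) * (e' + 1) by ring]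
      ring
    rw [h12]
    refine (norm_add_le _ _).trans ?_
    linarith
  · obtain ⟨h3, h4, h5⟩ := (hdyn R₁ (by linarith [le_max_left R R']) z).1 h1 h2
    obtain ⟨h6, h7, h8⟩ := (hdyn' R₁ (by linarith [le_max_right R R']) (G z)).1 h3 h4
    exact ⟨h6, h7, by linarith [norm_nonneg z.2]⟩
  · rcases (hdyn R₁ (by linarith [le_max_left R R']) z).2 M hM hz with h3 | h3
    · exact (hdyn' R₁ (by linarith [le_max_right R R']) (G z)).2 M hM h3
    · obtain ⟨h6, h7, h8⟩ := (hdyn' R₁ (by linarith [le_max_right R R']) (G z)).1 h3.1 h3.2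
      exact Or.inr ⟨h6, h7⟩

lemma exists_isComposite_foldl (l : List (Polynomial ℂ × ℂ))
    (hl : ∀ s ∈ l, 2 ≤ s.1.natDegree ∧ s.2 ≠ 0) (hne : l ≠ []) :
    ∃ Gi e c a, IsComposite
      (fun z => (l.map fun s => henonStep s.1 s.2).foldl (fun w g => g w) z) Gi e c a := by
  induction l using List.reverseRecOn with
  | nil => exact absurd rfl hne
  | append_singleton l s ih =>
    have hs := hl s (by simp)
    have h1 := isComposite_henonStep hs.1 hs.2
    simp only [List.map_append, List.foldl_append, List.map_cons, List.map_nil, List.foldl_cons,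
      List.foldl_nil]
    rcases eq_or_ne l [] with rfl | h0
    · exact ⟨_, _, _, _, h1⟩
    · obtain ⟨Gi, e, c, a, h2⟩ := ih (fun t ht => hl t (by simp [ht])) h0
      exact ⟨_, _, _, _, h1.comp h2⟩

lemma exists_isComposite (H : GenHenon) : ∃ Gi e c a, IsComposite H.toFun Gi e c a := by
  have h1 := exists_isComposite_foldl (List.ofFn fun i => (H.p i, H.a i)) (by
    intro s hs
    rw [List.mem_ofFn] at hs
    obtain ⟨i, rfl⟩ := hs
    exact ⟨H.hdeg i, H.ha i⟩) (by
    intro h0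
    have := congrArg List.length h0
    have := H.hm
    simp at *
    omega)
  rw [List.map_ofFn] at h1
  exact h1

lemma not_isBounded_iff_of_dynamics {G : ℂ × ℂ → ℂ × ℂ} {R : ℝ} (hR : 0 ≤ R)
    (hdyn : ∀ z : ℂ × ℂ,
      (R < ‖z.2‖ → ‖z.1‖ < ‖z.2‖ →
        R < ‖(G z).2‖ ∧ ‖(G z).1‖ < ‖(G z).2‖ ∧ 2 * ‖z.2‖ ≤ ‖(G z).2‖) ∧
      ∀ M, R ≤ M → ‖z‖ ≤ M →
        ‖G z‖ ≤ M ∨ (R < ‖(G z).2‖ ∧ ‖(G z).1‖ < ‖(G z).2‖)) (w : ℂ × ℂ) :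
    ¬ Bornology.IsBounded (range fun n : ℕ => G^[n] w) ↔
      ∃ n, R < ‖(G^[n] w).2‖ ∧ ‖(G^[n] w).1‖ < ‖(G^[n] w).2‖ := by
  constructor
  · intro h
    by_contra hn
    apply h
    rw [isBounded_iff_forall_norm_le]
    refine ⟨max R ‖w‖, ?_⟩
    rintro _ ⟨n, rfl⟩
    induction n with
    | zero => exact le_max_right _ _
    | succ n ih =>
      simp only [Function.iterate_succ_apply']
      rcases (hdyn (G^[n] w)).2 _ (le_max_left _ _) ih with h1 | h1
      · exact h1
      · rw [← Function.iterate_succ_apply' G] at h1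
        exact absurd ⟨n + 1, h1⟩ hn
  · rintro ⟨n, h1, h2⟩ hb
    rw [isBounded_iff_forall_norm_le] at hb
    obtain ⟨M, hM⟩ := hb
    have h3 : ∀ m : ℕ, R < ‖(G^[m + n] w).2‖ ∧ ‖(G^[m + n] w).1‖ < ‖(G^[m + n] w).2‖ ∧
        2 ^ m * ‖(G^[n] w).2‖ ≤ ‖(G^[m + n] w).2‖ := by
      intro m
      induction m with
      | zero => simpa using ⟨h1, h2⟩
      | succ m ih =>
        obtain ⟨h4, h5, h6⟩ := (hdyn _).1 ih.1 ih.2.1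
        rw [show m + 1 + n = m + n + 1 by ring, Function.iterate_succ_apply']
        refine ⟨h4, h5, le_trans ?_ h6⟩
        rw [pow_succ]
        linarith [ih.2.2]
    have h0 : 0 < ‖(G^[n] w).2‖ := by linarith
    obtain ⟨m, hm⟩ := pow_unbounded_of_one_lt (M / ‖(G^[n] w).2‖) (one_lt_two (α := ℝ))
    rw [div_lt_iff₀ h0] at hm
    have h4 := hM _ ⟨m + n, rfl⟩
    have h5 := norm_snd_le (G^[m + n] w)
    linarith [(h3 m).2.2]

lemma PolyBdd.smul (γ : ℂ) : PolyBdd univ (fun z => γ • z) :=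
  ⟨1, ‖γ‖, fun z _ => by rw [norm_smul, pow_one]; gcongr; linarith⟩

lemma IsComposite.exists_henonLike {G Gi : ℂ × ℂ → ℂ × ℂ} {e : ℕ} {c a : ℂ}
    (hG : IsComposite G Gi e c a) : ∃ (h : HenonLike) (γ : ℂ), γ ≠ 0 ∧
      ∀ z, γ • z ∈ h.K ↔ Bornology.IsBounded (range fun n : ℕ => G^[n] z) := by
  have he := hG.he
  obtain ⟨γ, hγ⟩ := IsAlgClosed.exists_pow_nat_eq c (n := e) (by omega)
  have hγ0 : γ ≠ 0 := by
    rintro rfl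
    rw [zero_pow (by omega)] at hγ
    exact hG.hc hγ.symm
  obtain ⟨C, R, hC, hR, hest, hdyn⟩ := hG.est
  have hg : 0 < ‖γ‖ := norm_pos_iff.2 hγ0
  set C' := 1 + C * ‖γ‖ * (‖γ‖⁻¹) ^ e with hC'
  have hC1 : 1 ≤ C' := by
    have : 0 ≤ C * ‖γ‖ * (‖γ‖⁻¹) ^ e := by positivity
    linarith
  have hiter : ∀ (n : ℕ) (z : ℂ × ℂ),
      (fun z => γ • G (γ⁻¹ • z))^[n] z = γ • G^[n] (γ⁻¹ • z) := by
    intro n z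
    induction n with
    | zero => simp [hγ0]
    | succ n ih =>
      rw [Function.iterate_succ_apply', Function.iterate_succ_apply', ih, inv_smul_smul₀ hγ0]
  have hreg : ∀ z : ℂ × ℂ, max (64 * C') (‖γ‖ * R) ≤ ‖z.2‖ → ‖z.1‖ ≤ ‖z.2‖ →
      R ≤ ‖(γ⁻¹ • z).2‖ ∧ ‖(γ⁻¹ • z).1‖ ≤ ‖(γ⁻¹ • z).2‖ := by
    intro z h1 h2
    simp only [Prod.smul_fst, Prod.smul_snd, norm_smul, norm_inv]
    constructor
    · rw [inv_mul_eq_div, le_div_iff₀' hg]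
      exact (le_max_right _ _).trans h1
    · gcongr
  have hmul : ∀ z : ℂ × ℂ, ‖γ‖ * (C * ‖(γ⁻¹ • z).2‖ ^ e) ≤ C' * ‖z.2‖ ^ e := by
    intro z
    simp only [Prod.smul_snd, norm_smul, norm_inv, mul_pow]
    rw [hC', add_mul]
    have : 0 ≤ 1 * ‖z.2‖ ^ e := by positivity
    linarith
  have hs : Differentiable ℂ (fun z : ℂ × ℂ => γ⁻¹ • z) := by fun_prop
  refine ⟨{ H := fun z => γ • G (γ⁻¹ • z)
            Hi := fun z => γ • Gi (γ⁻¹ • z)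
            e := e
            he := he
            a := a
            ha := hG.ha
            C := C'
            R := max (64 * C') (‖γ‖ * R)
            hC := hC1
            hR := le_max_left _ _
            diff := (hG.diff.comp hs).const_smul γ
            diffi := (hG.diffi.comp hs).const_smul γ
            left := fun z => by simp only [inv_smul_smul₀ hγ0, hG.left, smul_inv_smul₀ hγ0]
            right := fun z => by simp only [inv_smul_smul₀ hγ0, hG.right, smul_inv_smul₀ hγ0]
            jac := fun z => ?_
            snd_est := fun z h1 h2 => ?_
            fst_est := fun z h1 h2 => ?_
            growthi := ?_
            K := {z | Bornology.IsBounded (range fun n : ℕ => G^[n] (γ⁻¹ • z))}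
            hK := fun R' hR' z => ?_ }, γ, hγ0, fun z => ?_⟩
  · have h1 : ∀ f : ℂ × ℂ → ℂ, Differentiable ℂ f →
        dx (fun w => γ * f (γ⁻¹ • w)) z = dx f (γ⁻¹ • z) ∧
          dy (fun w => γ * f (γ⁻¹ • w)) z = dy f (γ⁻¹ • z) := by
      intro f hf
      constructor
      · have h2 := hasDerivAt_comp_pair isOpen_univ hf.differentiableOn (t := z.1) trivial
          ((hasDerivAt_id z.1).const_mul γ⁻¹) (hasDerivAt_const z.1 (γ⁻¹ * z.2))
        have h3 := (h2.const_mul γ).deriv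
        simp only [mul_one, mul_zero, add_zero, id] at h3
        refine h3.trans ?_
        rw [mul_comm (dx _ _), mul_inv_cancel_left₀ hγ0]
        rfl
      · have h2 := hasDerivAt_comp_pair isOpen_univ hf.differentiableOn (t := z.2) trivial
          (hasDerivAt_const z.2 (γ⁻¹ * z.1)) ((hasDerivAt_id z.2).const_mul γ⁻¹)
        have h3 := (h2.const_mul γ).deriv
        simp only [mul_one, mul_zero, zero_add, id] at h3
        refine h3.trans ?_
        rw [mul_comm (dy _ _), mul_inv_cancel_left₀ hγ0]
        rfl
    have h2 := h1 (fun w => (G w).1) hG.diff.fst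
    have h3 := h1 (fun w => (G w).2) hG.diff.snd
    simp only [Prod.smul_fst, Prod.smul_snd, smul_eq_mul] at h2 h3 ⊢
    rw [h2.1, h2.2, h3.1, h3.2]
    exact hG.jac _
  · have h3 := hreg z h1 h2
    have h4 := (hest _ h3.1 h3.2).1
    have h5 : (γ • G (γ⁻¹ • z)).2 - z.2 ^ (e + 1) =
        γ * ((G (γ⁻¹ • z)).2 - c * (γ⁻¹ • z).2 ^ (e + 1)) := by
      have h6 : γ ^ (e + 1) * (γ⁻¹ * z.2) ^ (e + 1) = z.2 ^ (e + 1) := by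
        rw [← mul_pow, mul_inv_cancel_left₀ hγ0]
      simp only [Prod.smul_snd, smul_eq_mul, mul_sub, ← hγ]
      rw [← h6]
      ring
    rw [h5, norm_mul]
    exact (mul_le_mul_of_nonneg_left h4 hg.le).trans (hmul z)
  · have h3 := hreg z h1 h2
    have h4 := (hest _ h3.1 h3.2).2
    simp only [Prod.smul_fst, norm_smul]
    exact (mul_le_mul_of_nonneg_left h4 hg.le).trans (hmul z)
  · obtain ⟨n, d, hd⟩ := (PolyBdd.smul γ).comp (hG.growthi.comp (PolyBdd.smul γ⁻¹))
    exact ⟨n, d, fun z => hd z trivial⟩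
  · have h1 : R ≤ ‖γ‖⁻¹ * R' := by
      rw [inv_mul_eq_div, le_div_iff₀' hg]
      exact (le_max_right _ _).trans hR'
    refine (not_isBounded_iff_of_dynamics (R := ‖γ‖⁻¹ * R') (by linarith) (hdyn _ h1)
      (γ⁻¹ • z)).trans ?_
    simp only [hiter, Prod.smul_fst, Prod.smul_snd, norm_smul, mul_lt_mul_iff_right₀ hg,
      inv_mul_lt_iff₀ hg]
  · simp [hγ0]

theorem isPolyMap_of_maps_escaping (H F : GenHenon) {ψ : ℂ × ℂ → ℂ × ℂ}
    (hψ : Differentiable ℂ ψ) (hinj : Function.Injective ψ)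
    (hK : ∀ z, z ∉ H.Kplus → ψ z ∉ F.Kplus) : IsPolyMap ψ := by
  obtain ⟨Gi, e, c, a, hG⟩ := exists_isComposite H
  obtain ⟨Gi', e', c', a', hG'⟩ := exists_isComposite F
  obtain ⟨h, γ, hγ, hh⟩ := hG.exists_henonLike
  obtain ⟨k, δ, hδ, hk⟩ := hG'.exists_henonLike
  have h1 : PolyBdd univ (fun z => δ • ψ (γ⁻¹ • z)) := by
    refine polyBdd_of_escaping (h := h) (k := k)
      ((hψ.comp (by fun_prop : Differentiable ℂ (fun z : ℂ × ℂ => γ⁻¹ • z))).const_smul δ)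
      (fun x y hxy => ?_) (fun z hz => ?_)
    · exact smul_right_injective _ (inv_ne_zero hγ) (hinj (smul_right_injective _ hδ hxy))
    · rw [hk]
      refine hK _ fun hz' => hz ?_
      have := (hh (γ⁻¹ • z)).2 hz'
      rwa [smul_inv_smul₀ hγ] at this
  have h2 := (PolyBdd.smul δ⁻¹).comp (h1.comp (PolyBdd.smul γ))
  simp only [inv_smul_smul₀ hγ, inv_smul_smul₀ hδ] at h2
  exact isPolyMap_of_polyBdd hψ h2

end HenonRigidity

/-- **Automorphisms mapping one non-escaping set into another are polynomial**: if `H` and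
`F` are generalised Hénon maps and `φ ∈ Aut(ℂ²)` satisfies `φ(K_F⁺) ⊆ K_H⁺`, then `φ` is a
polynomial automorphism of `ℂ²` (and likewise its inverse). -/
theorem automorphism_mapping_Kplus_is_polynomial (H F : GenHenon)
    (φ : ℂ × ℂ → ℂ × ℂ) (hφ : IsAutC2 φ) (hK : φ '' F.Kplus ⊆ H.Kplus) :
    IsPolyMap φ ∧ ∀ g : ℂ × ℂ → ℂ × ℂ,
      Function.LeftInverse g φ → Function.RightInverse g φ → IsPolyMap g := by
  obtain ⟨hd, ψ, hψ, hl, hr⟩ := hφ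
  have h1 : IsPolyMap ψ := by
    refine HenonRigidity.isPolyMap_of_maps_escaping H F hψ hr.injective fun z hz hz' => hz ?_
    have := hK ⟨ψ z, hz', rfl⟩
    rwa [hr z] at this
  refine ⟨HenonRigidity.isPolyMap_of_leftInverse h1 hd hl, fun g _ hgr => ?_⟩
  have hg : g = ψ := by
    ext1 z
    rw [← hl (g z), hgr z]
  rwa [hg]
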